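/- arXiv:0801.0612 — 2 statements merged into one kernel-verified Lean document; each statement's English description precedes it below -/
import Mathlib

section
/- Let d ≥ 2. For every η ∈ (0,π) and every ε > 0 there exist constants K_η > 1 and c_{η,ε} > 0 such that for every s ∈ ℝᵈ∖{0} and every Borel set M ⊂ V_s^η with vol_{S₁^{d−1}}(M) > 0: one has λ_s(M) > 0, and the normalized measure λ_s(M)⁻¹·λ_s|_M equals g · vol_{S₁^{d−1}}(M)⁻¹·vol_{S₁^{d−1}}|_M for some continuous function g: M → ℝ_{>0} with g(u) ∈ [K_η⁻¹, K_η] for all u ∈ M. If moreover M has diameter at most c_{η,ε} (i.e. φ(u₁,u₂) ≤ c_{η,ε} for all u₁,u₂ ∈ M), then g(u) ∈ [1−ε, 1+ε] for all u ∈ M. -/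
open MeasureTheory Metric Set Filter InnerProductGeometry
open scoped Topology ENNReal RealInnerProductSpace

noncomputable section

/-- Euclidean space `ℝᵈ`. -/
abbrev Vec (d : ℕ) : Type := EuclideanSpace ℝ (Fin d)

/-- The unit sphere `S₁^{d-1} ⊂ ℝᵈ`. -/
def sph (d : ℕ) : Set (Vec d) := Metric.sphere (0 : Vec d) 1

/-- The Lebesgue surface measure on the unit sphere, viewed as a measure on `ℝᵈ`. -/
def sphVol (d : ℕ) : Measure (Vec d) :=
  Measure.map Subtype.val (volume : Measure (Vec d)).toSphere

/-- Direction of the outgoing ray after specular reflection in the unit sphere, for an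
incoming ray of direction `ŝ = s/‖s‖` passing through the point `x` of the disc
`{ŝ}^⊥ ∩ B₁ᵈ` (impact location `w = x - √(1-‖x‖²) ŝ`). -/
def scatterDir {d : ℕ} (s x : Vec d) : Vec d :=
  (‖s‖⁻¹ • s) - (2 * ⟪‖s‖⁻¹ • s, x - Real.sqrt (1 - ‖x‖ ^ 2) • (‖s‖⁻¹ • s)⟫) •
    (x - Real.sqrt (1 - ‖x‖ ^ 2) • (‖s‖⁻¹ • s))

/-- `(d-1)`-dimensional Lebesgue measure on the unit disc `{s}^⊥ ∩ B₁ᵈ`. -/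
def discMeas {d : ℕ} (s : Vec d) : Measure (Vec d) :=
  (μH[(d : ℝ) - 1]).restrict {x | ⟪x, s⟫ = 0 ∧ ‖x‖ < 1}

/-- The exit-direction law `λ_s` of a ray of direction `ŝ` scattered in the unit sphere,
with uniformly distributed impact parameter. -/
def lamS {d : ℕ} (s : Vec d) : Measure (Vec d) :=
  (discMeas s Set.univ)⁻¹ • Measure.map (scatterDir s) (discMeas s)

/-- `V_s^η = {u ∈ S₁^{d-1} : φ(u,s) > η}`. -/
def Vseta {d : ℕ} (s : Vec d) (η : ℝ) : Set (Vec d) :=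
  {u ∈ sph d | η < angle u s}

/-- The line `ℝ` parametrized by `t ∈ (ρ, ∞)` via `t ↦ t² / (2m) - m`, `m = √(t² - ρ²)`. -/
lemma lintegral_eq_lintegral_Ioi_comp {ρ : ℝ} (hρ : 0 < ρ) (f : ℝ → ℝ≥0∞) :
    ∫⁻ z, f z = ∫⁻ t in Ioi ρ, ENNReal.ofReal (t ^ 3 / (2 * √(t ^ 2 - ρ ^ 2) ^ 3)) *
      f (t ^ 2 / (2 * √(t ^ 2 - ρ ^ 2)) - √(t ^ 2 - ρ ^ 2)) := by
  set Z : ℝ → ℝ := fun t => t ^ 2 / (2 * √(t ^ 2 - ρ ^ 2)) - √(t ^ 2 - ρ ^ 2) with hZ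
  have hpos : ∀ t ∈ Ioi ρ, 0 < t ^ 2 - ρ ^ 2 := fun t ht => by
    have : ρ < t := ht
    nlinarith
  have hm : ∀ t ∈ Ioi ρ, 0 < √(t ^ 2 - ρ ^ 2) := fun t ht => Real.sqrt_pos.2 (hpos t ht)
  have hsq : ∀ t ∈ Ioi ρ, √(t ^ 2 - ρ ^ 2) ^ 2 = t ^ 2 - ρ ^ 2 :=
    fun t ht => Real.sq_sqrt (hpos t ht).le
  have himg : Z '' Ioi ρ = univ := by
    refine eq_univ_of_forall fun z => ?_
    set m : ℝ := √(z ^ 2 + ρ ^ 2) - z with hmdef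
    have h1 : √(z ^ 2 + ρ ^ 2) ^ 2 = z ^ 2 + ρ ^ 2 := Real.sq_sqrt (by positivity)
    have hm0 : 0 < m := by
      have : z < √(z ^ 2 + ρ ^ 2) := by
        apply lt_of_le_of_lt (le_abs_self z)
        rw [← Real.sqrt_sq_eq_abs]
        exact Real.sqrt_lt_sqrt (sq_nonneg _) (by nlinarith)
      linarith
    have hmq : m ^ 2 + 2 * z * m - ρ ^ 2 = 0 := by rw [hmdef]; linear_combination h1
    have ht2 : √(m ^ 2 + ρ ^ 2) ^ 2 = m ^ 2 + ρ ^ 2 := Real.sq_sqrt (by positivity)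
    refine ⟨√(m ^ 2 + ρ ^ 2), ?_, ?_⟩
    · exact Real.lt_sqrt_of_sq_lt (by nlinarith)
    · have h2 : √(m ^ 2 + ρ ^ 2 - ρ ^ 2) = m := by
        rw [add_sub_cancel_right, Real.sqrt_sq hm0.le]
      simp only [hZ, ht2, h2]
      field_simp
      linear_combination -hmq
  have hinj : InjOn Z (Ioi ρ) := by
    intro a ha b hb hab
    have ha1 := hm a ha
    have hb1 := hm b hb
    have ha2 := hsq a ha
    have hb2 := hsq b hb
    simp only [hZ] at hab
    set m := √(a ^ 2 - ρ ^ 2)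
    set k := √(b ^ 2 - ρ ^ 2)
    field_simp at hab
    have h3 : (m - k) * (ρ ^ 2 + m * k) = 0 := by
      linear_combination -hab - k * ha2 + m * hb2
    have h4 : m = k := by
      rcases mul_eq_zero.1 h3 with h | h
      · linarith
      · exact absurd h (by positivity)
    have h5 : a ^ 2 = b ^ 2 := by rw [h4] at ha2; linarith
    exact (pow_left_inj₀ (hρ.trans ha).le (hρ.trans hb).le two_ne_zero).1 h5
  have hderiv : ∀ t ∈ Ioi ρ,
      HasDerivWithinAt Z (-(t ^ 3 / (2 * √(t ^ 2 - ρ ^ 2) ^ 3))) (Ioi ρ) t := by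
    intro t ht
    have h1 : HasDerivAt (fun t : ℝ => t ^ 2 - ρ ^ 2) (2 * t) t := by
      simpa using (hasDerivAt_pow 2 t).sub_const (ρ ^ 2)
    have h2 := h1.sqrt (hpos t ht).ne'
    have h3 := ((hasDerivAt_pow 2 t).fun_div (h2.const_mul 2)
      (by have := hm t ht; positivity)).sub h2
    refine (h3.congr_deriv ?_).hasDerivWithinAt
    have h4 := hm t ht
    field_simp
    push_cast
    ring
  have := lintegral_image_eq_lintegral_abs_deriv_mul measurableSet_Ioi hderiv hinj f
  rw [himg, setLIntegral_univ] at this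
  rw [this]
  refine setLIntegral_congr_fun measurableSet_Ioi fun t ht => ?_
  have h4 := hm t ht
  have h5 : 0 < t := hρ.trans ht
  simp only [hZ]
  rw [abs_neg, abs_of_nonneg (by positivity)]

lemma lintegral_eq_mul_lintegral_smul {H : Type*} [NormedAddCommGroup H] [NormedSpace ℝ H]
    [FiniteDimensional ℝ H] [MeasurableSpace H] [BorelSpace H] (μ : Measure H)
    [μ.IsAddHaarMeasure] {t : ℝ} (ht : 0 < t) (g : H → ℝ≥0∞) :
    ∫⁻ v, g v ∂μ = ENNReal.ofReal (t ^ Module.finrank ℝ H) * ∫⁻ x, g (t • x) ∂μ := by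
  have h1 := Measure.map_addHaar_smul μ ht.ne'
  have h2 : ∫⁻ x, g (t • x) ∂μ = ∫⁻ v, g v ∂(Measure.map (t • ·) μ) :=
    (lintegral_map_equiv g (Homeomorph.smulOfNeZero t ht.ne').toMeasurableEquiv).symm
  rw [h2, h1, lintegral_smul_measure, smul_eq_mul, ← mul_assoc,
    ← ENNReal.ofReal_mul (by positivity), abs_of_pos (by positivity),
    mul_inv_cancel₀ (by positivity), ENNReal.ofReal_one, one_mul]

/-- Change of variables `(v, z) = (t x, t (1 / (2q) - q))`, `q = √(1 - ‖x‖²)`. -/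
lemma lintegral_lintegral_eq_cone {H : Type*} [NormedAddCommGroup H] [NormedSpace ℝ H]
    [FiniteDimensional ℝ H] [Nontrivial H] [MeasurableSpace H] [BorelSpace H] (μ : Measure H)
    [μ.IsAddHaarMeasure] {F : H × ℝ → ℝ≥0∞} (hF : Measurable F) :
    ∫⁻ v, (∫⁻ z, F (v, z)) ∂μ = ∫⁻ x in ball (0 : H) 1, (∫⁻ t in Ioi (0 : ℝ),
      ENNReal.ofReal (t ^ Module.finrank ℝ H) *
        (ENNReal.ofReal (1 / (2 * √(1 - ‖x‖ ^ 2) ^ 3)) *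
          F (t • x, t * (1 / (2 * √(1 - ‖x‖ ^ 2)) - √(1 - ‖x‖ ^ 2))))) ∂μ := by
  set G : H → ℝ → ℝ≥0∞ := fun v t => (Ioi ‖v‖).indicator (fun t =>
    ENNReal.ofReal (t ^ 3 / (2 * √(t ^ 2 - ‖v‖ ^ 2) ^ 3)) *
      F (v, t ^ 2 / (2 * √(t ^ 2 - ‖v‖ ^ 2)) - √(t ^ 2 - ‖v‖ ^ 2))) t with hG
  have hmeas1 : Measurable (Function.uncurry G) := by
    have hs : MeasurableSet {p : H × ℝ | ‖p.1‖ < p.2} :=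
      measurableSet_lt (by fun_prop) (by fun_prop)
    have : Function.uncurry G = {p : H × ℝ | ‖p.1‖ < p.2}.indicator (fun p =>
      ENNReal.ofReal (p.2 ^ 3 / (2 * √(p.2 ^ 2 - ‖p.1‖ ^ 2) ^ 3)) *
      F (p.1, p.2 ^ 2 / (2 * √(p.2 ^ 2 - ‖p.1‖ ^ 2)) - √(p.2 ^ 2 - ‖p.1‖ ^ 2))) := by
      ext ⟨v, t⟩
      simp [hG, Function.uncurry, indicator_apply]
    rw [this]
    refine Measurable.indicator ?_ hs
    exact Measurable.mul (by fun_prop) (hF.comp (by fun_prop))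
  have step1 : ∫⁻ v, (∫⁻ z, F (v, z)) ∂μ = ∫⁻ v, (∫⁻ t in Ioi (0 : ℝ), G v t) ∂μ := by
    have hne : ∀ᵐ v ∂μ, v ≠ 0 := by
      have : μ {(0 : H)} = 0 := measure_singleton 0
      exact measure_eq_zero_iff_ae_notMem.1 this
    refine lintegral_congr_ae ?_
    filter_upwards [hne] with v hv
    rw [lintegral_eq_lintegral_Ioi_comp (norm_pos_iff.2 hv)]
    simp only [hG]
    rw [lintegral_indicator measurableSet_Ioi, Measure.restrict_restrict measurableSet_Ioi,
      inter_eq_left.2 (Ioi_subset_Ioi (norm_nonneg v))]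
  have step2 : ∀ t ∈ Ioi (0 : ℝ), ∫⁻ v, G v t ∂μ = ∫⁻ x in ball (0 : H) 1,
      ENNReal.ofReal (t ^ Module.finrank ℝ H) *
        (ENNReal.ofReal (1 / (2 * √(1 - ‖x‖ ^ 2) ^ 3)) *
          F (t • x, t * (1 / (2 * √(1 - ‖x‖ ^ 2)) - √(1 - ‖x‖ ^ 2)))) ∂μ := by
    intro t ht
    have ht : 0 < t := ht
    rw [lintegral_eq_mul_lintegral_smul μ ht, ← lintegral_const_mul' _ _ ENNReal.ofReal_ne_top,
      ← lintegral_indicator measurableSet_ball]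
    refine lintegral_congr fun x => ?_
    by_cases hx : ‖x‖ < 1
    · rw [indicator_of_mem (by simpa using hx)]
      have hmem : t ∈ Ioi ‖t • x‖ := by
        rw [mem_Ioi, norm_smul, Real.norm_of_nonneg ht.le]
        nlinarith
      have hs : √(t ^ 2 - ‖t • x‖ ^ 2) = t * √(1 - ‖x‖ ^ 2) := by
        rw [norm_smul, Real.norm_of_nonneg ht.le,
          show t ^ 2 - (t * ‖x‖) ^ 2 = t ^ 2 * (1 - ‖x‖ ^ 2) by ring,
          Real.sqrt_mul (by positivity), Real.sqrt_sq ht.le]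
      have hq : 0 < √(1 - ‖x‖ ^ 2) := Real.sqrt_pos.2 (by nlinarith [norm_nonneg x])
      have e1 : t ^ 3 / (2 * (t * √(1 - ‖x‖ ^ 2)) ^ 3) = 1 / (2 * √(1 - ‖x‖ ^ 2) ^ 3) := by
        field_simp
      have e2 : t ^ 2 / (2 * (t * √(1 - ‖x‖ ^ 2))) - t * √(1 - ‖x‖ ^ 2) =
          t * (1 / (2 * √(1 - ‖x‖ ^ 2)) - √(1 - ‖x‖ ^ 2)) := by
        field_simp
      simp only [hG]
      rw [indicator_of_mem hmem, hs, e1, e2]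
    · rw [indicator_of_notMem (by simpa using hx)]
      have hmem : t ∉ Ioi ‖t • x‖ := by
        rw [mem_Ioi, norm_smul, Real.norm_of_nonneg ht.le]
        push Not at hx ⊢
        nlinarith
      simp only [hG]
      rw [indicator_of_notMem hmem, mul_zero]
  rw [step1, lintegral_lintegral_swap hmeas1.aemeasurable,
    setLIntegral_congr_fun measurableSet_Ioi step2, lintegral_lintegral_swap]
  refine Measurable.aemeasurable ?_
  refine Measurable.mul (by fun_prop) (Measurable.mul (by fun_prop) (hF.comp (by fun_prop)))

lemma lintegral_Ioo_ofReal_pow (n : ℕ) {a : ℝ} (ha : 0 ≤ a) :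
    ∫⁻ t in Ioo 0 a, ENNReal.ofReal (t ^ n) = ENNReal.ofReal (a ^ (n + 1) / (n + 1)) := by
  rw [← ofReal_integral_eq_lintegral_ofReal, ← integral_Ioc_eq_integral_Ioo,
    ← intervalIntegral.integral_of_le ha]
  · simp
  · exact ((continuous_pow n).integrableOn_Icc).mono_set Ioo_subset_Icc_self
  · filter_upwards [ae_restrict_mem measurableSet_Ioo] with t ht
    exact pow_nonneg ht.1.le n

lemma finrank_orthogonal_span {d : ℕ} (hd : 1 ≤ d) {s : Vec d} (hs : s ≠ 0) :
    Module.finrank ℝ (ℝ ∙ s)ᗮ = d - 1 := by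
  have : Fact (Module.finrank ℝ (Vec d) = (d - 1) + 1) := ⟨by simp; omega⟩
  exact Submodule.finrank_orthogonal_span_singleton hs

/-- Lebesgue measure on `ℝᵈ` is a multiple of the product measure on `{s}^⊥ × ℝ e`. -/
lemma exists_volume_eq_lintegral {d : ℕ} (hd : 1 ≤ d) {s e : Vec d} (hs : s ≠ 0)
    (he : ‖e‖ = 1) (hse : ∀ x ∈ (ℝ ∙ s)ᗮ, ⟪e, x⟫ = 0)
    (μ : Measure (ℝ ∙ s)ᗮ) [μ.IsAddHaarMeasure] :
    ∃ C : ℝ≥0∞, C ≠ 0 ∧ C ≠ ∞ ∧ ∀ S : Set (Vec d), MeasurableSet S →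
      volume S = C * ∫⁻ v, (∫⁻ z : ℝ, S.indicator 1 ((v : Vec d) + z • e)) ∂μ := by
  set f : ((ℝ ∙ s)ᗮ × ℝ) →ₗ[ℝ] Vec d :=
    ((ℝ ∙ s)ᗮ.subtype).coprod (LinearMap.toSpanSingleton ℝ (Vec d) e) with hf
  have hfa : ∀ p, f p = (p.1 : Vec d) + p.2 • e := fun p => by simp [hf]
  have hinj : Function.Injective f := by
    rw [injective_iff_map_eq_zero]
    rintro ⟨v, z⟩ h
    rw [hfa] at h
    have h1 : ⟪e, (v : Vec d) + z • e⟫ = 0 := by rw [h, inner_zero_right]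
    rw [inner_add_right, hse v v.2, inner_smul_right, real_inner_self_eq_norm_sq, he] at h1
    have hz : z = 0 := by simpa using h1
    subst hz
    simpa using h
  have hdim : Module.finrank ℝ ((ℝ ∙ s)ᗮ × ℝ) = Module.finrank ℝ (Vec d) := by
    rw [Module.finrank_prod, finrank_orthogonal_span hd hs]
    simp
    omega
  set L : ((ℝ ∙ s)ᗮ × ℝ) ≃L[ℝ] Vec d :=
    (LinearMap.linearEquivOfInjective f hinj hdim).toContinuousLinearEquiv with hL
  have hLa : ∀ p, L p = (p.1 : Vec d) + p.2 • e := fun p => by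
    rw [← hfa]; rfl
  set ν : Measure (Vec d) := Measure.map L (μ.prod volume) with hν
  have : ν.IsAddHaarMeasure := L.isAddHaarMeasure_map _
  refine ⟨Measure.addHaarScalarFactor volume ν, ?_, ENNReal.coe_ne_top, fun S hS => ?_⟩
  · exact_mod_cast (Measure.addHaarScalarFactor_pos_of_isAddHaarMeasure volume ν).ne'
  · have h1 : volume S = Measure.addHaarScalarFactor volume ν * ν S := by
      conv_lhs => rw [Measure.isAddLeftInvariant_eq_smul (volume : Measure (Vec d)) ν]
      rfl
    rw [h1]
    congr 1
    rw [hν, ← lintegral_indicator_one hS,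
      lintegral_map (measurable_one.indicator hS) L.continuous.measurable, lintegral_prod]
    · simp_rw [hLa]
    · exact ((measurable_one.indicator hS).comp L.continuous.measurable).aemeasurable

section Scatter

variable {d : ℕ} {s x : Vec d}

lemma norm_inv_smul_self (hs : s ≠ 0) : ‖‖s‖⁻¹ • s‖ = 1 := by
  simpa using norm_smul_inv_norm (𝕜 := ℝ) hs

lemma scatterDir_sub (hs : s ≠ 0) (hx : ⟪s, x⟫ = 0) :
    scatterDir s x - ‖s‖⁻¹ • s =
      (2 * √(1 - ‖x‖ ^ 2)) • (x - √(1 - ‖x‖ ^ 2) • (‖s‖⁻¹ • s)) := by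
  have he := norm_inv_smul_self hs
  have hex : ⟪‖s‖⁻¹ • s, x⟫ = 0 := by rw [inner_smul_left, hx, mul_zero]
  unfold scatterDir
  generalize ‖s‖⁻¹ • s = e at *
  rw [inner_sub_right, hex, inner_smul_right, real_inner_self_eq_norm_sq, he]
  module

lemma norm_impact (hs : s ≠ 0) (hx : ⟪s, x⟫ = 0) (hx1 : ‖x‖ < 1) :
    ‖x - √(1 - ‖x‖ ^ 2) • (‖s‖⁻¹ • s)‖ = 1 := by
  have he := norm_inv_smul_self hs
  have hex : ⟪x, ‖s‖⁻¹ • s⟫ = 0 := by rw [inner_smul_right, real_inner_comm, hx, mul_zero]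
  have hq : √(1 - ‖x‖ ^ 2) ^ 2 = 1 - ‖x‖ ^ 2 := Real.sq_sqrt (by nlinarith [norm_nonneg x])
  have h := norm_sub_sq_real x (√(1 - ‖x‖ ^ 2) • (‖s‖⁻¹ • s))
  rw [inner_smul_right, hex, norm_smul, he, Real.norm_of_nonneg (Real.sqrt_nonneg _), mul_one,
    hq] at h
  rw [← pow_left_inj₀ (norm_nonneg _) zero_le_one two_ne_zero, h]
  ring

lemma norm_scatterDir_sub (hs : s ≠ 0) (hx : ⟪s, x⟫ = 0) (hx1 : ‖x‖ < 1) :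
    ‖scatterDir s x - ‖s‖⁻¹ • s‖ = 2 * √(1 - ‖x‖ ^ 2) := by
  rw [scatterDir_sub hs hx, norm_smul, norm_impact hs hx hx1, mul_one,
    Real.norm_of_nonneg (by positivity)]

lemma norm_scatterDir (hs : s ≠ 0) (hx : ⟪s, x⟫ = 0) (hx1 : ‖x‖ < 1) :
    ‖scatterDir s x‖ = 1 := by
  have he := norm_inv_smul_self hs
  have hex : ⟪‖s‖⁻¹ • s, x⟫ = 0 := by rw [inner_smul_left, hx, mul_zero]
  have h1 := norm_scatterDir_sub hs hx hx1
  have h2 : scatterDir s x = ‖s‖⁻¹ • s + (scatterDir s x - ‖s‖⁻¹ • s) := by abel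
  have h := norm_add_sq_real (‖s‖⁻¹ • s) (scatterDir s x - ‖s‖⁻¹ • s)
  rw [← h2, he, h1, scatterDir_sub hs hx, inner_smul_right, inner_sub_right, hex,
    inner_smul_right, real_inner_self_eq_norm_sq, he] at h
  rw [← pow_left_inj₀ (norm_nonneg _) zero_le_one two_ne_zero, h]
  ring

lemma smul_add_smul_eq_smul_scatterDir (hs : s ≠ 0) (hx : ⟪s, x⟫ = 0) (hx1 : ‖x‖ < 1) (t : ℝ) :
    t • x + (t * (1 / (2 * √(1 - ‖x‖ ^ 2)) - √(1 - ‖x‖ ^ 2))) • (‖s‖⁻¹ • s) =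
      (t / (2 * √(1 - ‖x‖ ^ 2))) • scatterDir s x := by
  have h2 : scatterDir s x = ‖s‖⁻¹ • s + (scatterDir s x - ‖s‖⁻¹ • s) := by abel
  rw [h2, scatterDir_sub hs hx]
  have hq : 0 < √(1 - ‖x‖ ^ 2) := Real.sqrt_pos.2 (by nlinarith [norm_nonneg x])
  generalize √(1 - ‖x‖ ^ 2) = q at *
  generalize ‖s‖⁻¹ • s = e at *
  match_scalars <;> field_simp
  ring

lemma continuous_scatterDir (s : Vec d) : Continuous (scatterDir s) := by
  unfold scatterDir
  fun_prop

end Scatter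

/-- The surface measure of `A` is `d` times the volume of the cone over `A`. -/
lemma sphVol_apply {d : ℕ} (A : Set (Vec d)) (hA : MeasurableSet A) :
    MeasurableSet {y : Vec d | ‖y‖ ∈ Ioo (0 : ℝ) 1 ∧ ‖y‖⁻¹ • y ∈ A} ∧
    sphVol d A = d * volume {y : Vec d | ‖y‖ ∈ Ioo (0 : ℝ) 1 ∧ ‖y‖⁻¹ • y ∈ A} := by
  constructor
  · refine (measurable_norm measurableSet_Ioo).inter ?_
    have : Measurable fun y : Vec d => ‖y‖⁻¹ • y := by fun_prop
    exact this hA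
  · have h := Measure.toSphere_apply' (volume : Measure (Vec d))
      (s := Subtype.val ⁻¹' A) (measurable_subtype_coe hA)
    rw [sphVol, Measure.map_apply measurable_subtype_coe hA, h]
    congr 1
    · simp
    · congr 1
      ext y
      rw [Set.mem_smul, Set.mem_ofPred_eq]
      constructor
      · rintro ⟨r, hr, _, ⟨u, hu, rfl⟩, rfl⟩
        have hun : ‖(u : Vec d)‖ = 1 := by simp
        have : ‖r • (u : Vec d)‖ = r := by
          rw [norm_smul, hun, mul_one, Real.norm_of_nonneg hr.1.le]
        rw [this, smul_smul, inv_mul_cancel₀ hr.1.ne', one_smul]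
        exact ⟨hr, hu⟩
      · rintro ⟨hr, hy⟩
        have hy0 : y ≠ 0 := norm_pos_iff.1 hr.1
        refine ⟨‖y‖, hr, ‖y‖⁻¹ • y, ⟨⟨‖y‖⁻¹ • y, ?_⟩, hy, rfl⟩, ?_⟩
        · simpa using norm_inv_smul_self hy0
        · exact smul_inv_smul₀ hr.1.ne' y

lemma discMeas_eq_map {d : ℕ} (hd : 1 ≤ d) {s : Vec d} (hs : s ≠ 0) :
    discMeas s = Measure.map (Subtype.val : (ℝ ∙ s)ᗮ → Vec d)
      ((μH[(Module.finrank ℝ (ℝ ∙ s)ᗮ : ℝ)]).restrict (ball 0 1)) := by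
  have hdim : (Module.finrank ℝ (ℝ ∙ s)ᗮ : ℝ) = (d : ℝ) - 1 := by
    rw [finrank_orthogonal_span hd hs, Nat.cast_sub hd, Nat.cast_one]
  have hset : {x : Vec d | ⟪x, s⟫ = 0 ∧ ‖x‖ < 1} =
      ball 0 1 ∩ range (Subtype.val : (ℝ ∙ s)ᗮ → Vec d) := by
    ext x
    simp only [Set.mem_ofPred_eq, mem_inter_iff, mem_ball_zero_iff, Subtype.range_coe_subtype]
    rw [Submodule.mem_orthogonal_singleton_iff_inner_left, and_comm]
  have hd' : (1 : ℝ) ≤ d := by exact_mod_cast hd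
  have hmap := (isometry_subtype_coe (s := ((ℝ ∙ s)ᗮ : Set (Vec d)))).map_hausdorffMeasure
    (d := (d : ℝ) - 1) (Or.inl (by linarith))
  have hpre : ball (0 : (ℝ ∙ s)ᗮ) 1 = Subtype.val ⁻¹' (ball (0 : Vec d) 1) := by
    ext x; simp
  rw [discMeas, hset, ← Measure.restrict_restrict measurableSet_ball, hdim, hpre,
    ← Measure.restrict_map measurable_subtype_coe measurableSet_ball]
  congr 1
  exact hmap.symm

/-- The surface measure has density proportional to `‖u - ŝ‖^(d-3)` with respect to the image of
the disc measure under scattering. -/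
lemma exists_sphVol_eq {d : ℕ} (hd : 2 ≤ d) {s : Vec d} (hs : s ≠ 0) :
    ∃ C : ℝ≥0∞, C ≠ 0 ∧ C ≠ ∞ ∧
      sphVol d = C • (Measure.map (scatterDir s) (discMeas s)).withDensity
        (fun u => ENNReal.ofReal (‖u - ‖s‖⁻¹ • s‖ ^ d / ‖u - ‖s‖⁻¹ • s‖ ^ 3)) := by
  have hd1 : 1 ≤ d := by omega
  have horth : ∀ x ∈ (ℝ ∙ s)ᗮ, ⟪s, x⟫ = 0 := fun x hx =>
    Submodule.mem_orthogonal_singleton_iff_inner_right.1 hx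
  have horth' : ∀ x ∈ (ℝ ∙ s)ᗮ, ⟪‖s‖⁻¹ • s, x⟫ = 0 := fun x hx => by
    rw [inner_smul_left, horth x hx, mul_zero]
  have hfr := finrank_orthogonal_span hd1 hs
  have : Nontrivial (ℝ ∙ s)ᗮ := Module.nontrivial_of_finrank_pos (R := ℝ) (by omega)
  set μ : Measure (ℝ ∙ s)ᗮ := μH[(Module.finrank ℝ (ℝ ∙ s)ᗮ : ℝ)] with hμ
  obtain ⟨C, hC0, hCt, hC⟩ :=
    exists_volume_eq_lintegral hd1 hs (norm_inv_smul_self hs) horth' μ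
  refine ⟨d * C * ENNReal.ofReal (4 / d), ?_, by finiteness, ?_⟩
  · have : 0 < (4 : ℝ) / d := by positivity
    simp [hC0, this]
    omega
  ext A hA
  obtain ⟨hcm, hcv⟩ := sphVol_apply A hA
  set S := {y : Vec d | ‖y‖ ∈ Ioo (0 : ℝ) 1 ∧ ‖y‖⁻¹ • y ∈ A} with hS
  have hFm : Measurable fun p : (ℝ ∙ s)ᗮ × ℝ =>
      (S.indicator 1 ((p.1 : Vec d) + p.2 • (‖s‖⁻¹ • s)) : ℝ≥0∞) :=
    (measurable_one.indicator hcm).comp (by fun_prop)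
  have hwm : Measurable fun u : Vec d =>
      ENNReal.ofReal (‖u - ‖s‖⁻¹ • s‖ ^ d / ‖u - ‖s‖⁻¹ • s‖ ^ 3) := by fun_prop
  have hwm2 : Measurable fun x : Vec d => A.indicator (fun u => ENNReal.ofReal
      (‖u - ‖s‖⁻¹ • s‖ ^ d / ‖u - ‖s‖⁻¹ • s‖ ^ 3)) (scatterDir s x) :=
    (hwm.indicator hA).comp (continuous_scatterDir s).measurable
  have hkey := lintegral_lintegral_eq_cone μ hFm
  rw [hcv, hC S hcm, hkey, Measure.smul_apply, smul_eq_mul, withDensity_apply _ hA,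
    ← lintegral_indicator hA, lintegral_map (hwm.indicator hA) (continuous_scatterDir s).measurable,
    discMeas_eq_map hd1 hs, lintegral_map hwm2 measurable_subtype_coe, mul_assoc (_ * _),
    ← lintegral_const_mul' _ _ ENNReal.ofReal_ne_top, mul_assoc]
  congr 2
  refine setLIntegral_congr_fun measurableSet_ball fun x hx => ?_
  have hx1 : ‖(x : Vec d)‖ < 1 := by simpa using hx
  have hx0 := horth x x.2
  have hq : 0 < √(1 - ‖x‖ ^ 2) :=
    Real.sqrt_pos.2 (by have := norm_nonneg x; have : ‖x‖ < 1 := hx1; nlinarith)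
  have hns : ‖scatterDir s x - ‖s‖⁻¹ • s‖ = 2 * √(1 - ‖x‖ ^ 2) := norm_scatterDir_sub hs hx0 hx1
  have hsm : ∀ t : ℝ, ((t • x : (ℝ ∙ s)ᗮ) : Vec d) +
      (t * (1 / (2 * √(1 - ‖x‖ ^ 2)) - √(1 - ‖x‖ ^ 2))) • (‖s‖⁻¹ • s) =
      (t / (2 * √(1 - ‖x‖ ^ 2))) • scatterDir s x := smul_add_smul_eq_smul_scatterDir hs hx0 hx1
  set q := √(1 - ‖x‖ ^ 2)
  have hmem : ∀ t ∈ Ioi (0 : ℝ),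
      ((t / (2 * q)) • scatterDir s x ∈ S ↔ t < 2 * q ∧ scatterDir s x ∈ A) := by
    intro t ht
    have ht : 0 < t := ht
    have hn : ‖(t / (2 * q)) • scatterDir s x‖ = t / (2 * q) := by
      rw [norm_smul, norm_scatterDir hs hx0 hx1, mul_one, Real.norm_of_nonneg (by positivity)]
    rw [hS, Set.mem_ofPred_eq, hn, smul_smul, inv_mul_cancel₀ (by positivity), one_smul, mem_Ioo,
      div_lt_one (by positivity)]
    have : 0 < t / (2 * q) := by positivity
    tauto
  simp only [hsm]
  by_cases hu : scatterDir s x ∈ A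
  · rw [indicator_of_mem hu, hns]
    have hint : ∀ t ∈ Ioi (0 : ℝ), ENNReal.ofReal (t ^ Module.finrank ℝ (ℝ ∙ s)ᗮ) *
        (ENNReal.ofReal (1 / (2 * q ^ 3)) * S.indicator 1 ((t / (2 * q)) • scatterDir s x)) =
        (Iio (2 * q)).indicator (fun t => ENNReal.ofReal (t ^ (d - 1)) *
          ENNReal.ofReal (1 / (2 * q ^ 3))) t := by
      intro t ht
      rw [hfr]
      by_cases h : t < 2 * q
      · rw [indicator_of_mem ((hmem t ht).2 ⟨h, hu⟩), indicator_of_mem (by exact h)]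
        simp
      · rw [indicator_of_notMem ((hmem t ht).not.2 (fun h' => h h'.1)),
          indicator_of_notMem (by exact h)]
        simp
    rw [setLIntegral_congr_fun measurableSet_Ioi hint, lintegral_indicator measurableSet_Iio,
      Measure.restrict_restrict measurableSet_Iio, inter_comm, Ioi_inter_Iio,
      lintegral_mul_const' _ _ ENNReal.ofReal_ne_top, lintegral_Ioo_ofReal_pow _ (by positivity),
      ← ENNReal.ofReal_mul (by positivity), ← ENNReal.ofReal_mul (by positivity),
      Nat.cast_sub hd1, Nat.cast_one, sub_add_cancel, Nat.sub_add_cancel hd1]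
    congr 1
    field_simp
    norm_num
  · rw [indicator_of_notMem hu, mul_zero, ← lintegral_zero (μ := volume.restrict (Ioi (0 : ℝ)))]
    refine setLIntegral_congr_fun measurableSet_Ioi fun t ht => ?_
    have := (hmem t ht).not.2 (fun h => hu h.2)
    rw [indicator_of_notMem this]
    simp

lemma discMeas_univ_ne {d : ℕ} (hd : 1 ≤ d) {s : Vec d} (hs : s ≠ 0) :
    discMeas s univ ≠ 0 ∧ discMeas s univ ≠ ∞ := by
  rw [discMeas_eq_map hd hs, Measure.map_apply measurable_subtype_coe MeasurableSet.univ,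
    preimage_univ, Measure.restrict_apply_univ]
  exact ⟨(measure_ball_pos _ _ one_pos).ne', measure_ball_lt_top.ne⟩

lemma ae_map_scatterDir_norm_sub_pos {d : ℕ} {s : Vec d} (hs : s ≠ 0) :
    ∀ᵐ u ∂(Measure.map (scatterDir s) (discMeas s)), 0 < ‖u - ‖s‖⁻¹ • s‖ := by
  rw [ae_map_iff (continuous_scatterDir s).measurable.aemeasurable
    (measurableSet_lt (f := fun _ => (0 : ℝ)) (g := fun u : Vec d => ‖u - ‖s‖⁻¹ • s‖)
      measurable_const (by fun_prop))]
  have hm : MeasurableSet {x : Vec d | ⟪x, s⟫ = 0 ∧ ‖x‖ < 1} :=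
    (measurableSet_eq_fun (f := fun x : Vec d => ⟪x, s⟫) (g := fun _ => (0 : ℝ))
      (by fun_prop) (by fun_prop)).inter (measurableSet_lt (f := fun x : Vec d => ‖x‖)
      (g := fun _ => (1 : ℝ)) (by fun_prop) (by fun_prop))
  unfold discMeas
  filter_upwards [ae_restrict_mem hm] with x hx
  rw [norm_scatterDir_sub hs (by rw [real_inner_comm]; exact hx.1) hx.2]
  have : 0 < √(1 - ‖x‖ ^ 2) := Real.sqrt_pos.2 (by nlinarith [norm_nonneg x, hx.2])
  positivity

/-- The law `λ_s` has density proportional to `‖u - ŝ‖^(3-d)` on the unit sphere. -/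
lemma exists_lamS_eq {d : ℕ} (hd : 2 ≤ d) {s : Vec d} (hs : s ≠ 0) :
    ∃ C : ℝ≥0∞, C ≠ 0 ∧ C ≠ ∞ ∧
      lamS s = C • (sphVol d).withDensity
        (fun u => ENNReal.ofReal (‖u - ‖s‖⁻¹ • s‖ ^ 3 / ‖u - ‖s‖⁻¹ • s‖ ^ d)) := by
  obtain ⟨C, hC0, hCt, hC⟩ := exists_sphVol_eq hd hs
  obtain ⟨h0, ht⟩ := discMeas_univ_ne (by omega : 1 ≤ d) hs
  refine ⟨(discMeas s univ)⁻¹ * C⁻¹, ?_, ?_, ?_⟩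
  · exact mul_ne_zero (ENNReal.inv_ne_zero.2 ht) (ENNReal.inv_ne_zero.2 hCt)
  · exact ENNReal.mul_ne_top (ENNReal.inv_ne_top.2 h0) (ENNReal.inv_ne_top.2 hC0)
  · rw [hC, withDensity_smul_measure, smul_smul, mul_assoc, ENNReal.inv_mul_cancel hC0 hCt,
      mul_one, ← withDensity_mul _ (by fun_prop) (by fun_prop), lamS]
    congr 1
    conv_lhs => rw [← withDensity_one (μ := Measure.map (scatterDir s) (discMeas s))]
    refine withDensity_congr_ae ?_
    filter_upwards [ae_map_scatterDir_norm_sub_pos hs] with u hu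
    rw [Pi.mul_apply, ← ENNReal.ofReal_mul (by positivity), Pi.one_apply,
      ← ENNReal.ofReal_one]
    generalize ‖u - ‖s‖⁻¹ • s‖ = a at hu
    congr 1
    field_simp

lemma mul_div_lintegral_mem_Icc {α : Type*} [MeasurableSpace α] {σ : Measure α} {M : Set α}
    (hM : MeasurableSet M) (h0 : σ M ≠ 0) (ht : σ M ≠ ∞) {w : α → ℝ} (hw : ∀ u ∈ M, 0 < w u)
    {R : ℝ} (hR : ∀ u ∈ M, ∀ u' ∈ M, w u ≤ R * w u') :
    0 < ∫⁻ u in M, ENNReal.ofReal (w u) ∂σ ∧ ∫⁻ u in M, ENNReal.ofReal (w u) ∂σ < ∞ ∧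
      ∀ u ∈ M, w u * (σ M).toReal / (∫⁻ u in M, ENNReal.ofReal (w u) ∂σ).toReal ∈
        Icc R⁻¹ R := by
  set I := ∫⁻ u in M, ENNReal.ofReal (w u) ∂σ with hI
  have hσ : 0 < (σ M).toReal := ENNReal.toReal_pos h0 ht
  have hRpos : ∀ u ∈ M, 0 < R := fun u hu =>
    pos_of_mul_pos_left ((hw u hu).trans_le (hR u hu u hu)) (hw u hu).le
  have hup : ∀ u ∈ M, I ≤ ENNReal.ofReal (R * w u * (σ M).toReal) := by
    intro u hu
    have h1 : I ≤ ∫⁻ _ in M, ENNReal.ofReal (R * w u) ∂σ :=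
      setLIntegral_mono' hM fun u' hu' => ENNReal.ofReal_le_ofReal (hR u' hu' u hu)
    rwa [setLIntegral_const, ← ENNReal.ofReal_toReal ht,
      ← ENNReal.ofReal_mul (mul_pos (hRpos u hu) (hw u hu)).le] at h1
  have hlo : ∀ u ∈ M, ENNReal.ofReal (w u / R * (σ M).toReal) ≤ I := by
    intro u hu
    have h1 : ∫⁻ _ in M, ENNReal.ofReal (w u / R) ∂σ ≤ I :=
      setLIntegral_mono' hM fun u' hu' => ENNReal.ofReal_le_ofReal <| by
        rw [div_le_iff₀' (hRpos u hu)]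
        exact hR u hu u' hu'
    rwa [setLIntegral_const, ← ENNReal.ofReal_toReal ht,
      ← ENNReal.ofReal_mul (div_pos (hw u hu) (hRpos u hu)).le] at h1
  obtain ⟨u₀, hu₀⟩ : M.Nonempty := nonempty_of_measure_ne_zero h0
  have hIt : I < ∞ := (hup u₀ hu₀).trans_lt ENNReal.ofReal_lt_top
  have hI0 : 0 < I := lt_of_lt_of_le (ENNReal.ofReal_pos.2
    (mul_pos (div_pos (hw u₀ hu₀) (hRpos u₀ hu₀)) hσ)) (hlo u₀ hu₀)
  have hIr : 0 < I.toReal := ENNReal.toReal_pos hI0.ne' hIt.ne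
  refine ⟨hI0, hIt, fun u hu => ?_⟩
  have hwu := hw u hu
  have hRu := hRpos u hu
  have h1 : I.toReal ≤ R * w u * (σ M).toReal :=
    ENNReal.toReal_le_of_le_ofReal (by positivity) (hup u hu)
  have h2 : w u / R * (σ M).toReal ≤ I.toReal :=
    (ENNReal.ofReal_le_iff_le_toReal hIt.ne).1 (hlo u hu)
  constructor
  · rw [le_div_iff₀ hIr, inv_mul_le_iff₀ hRu]
    linarith
  · rw [div_le_iff₀ hIr]
    rw [div_mul_eq_mul_div, div_le_iff₀ hRu] at h2
    linarith

lemma pow_div_pow_le_mul {a b T : ℝ} (ha : 0 < a) (hb : 0 < b) (hab : a ≤ T * b)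
    (hba : b ≤ T * a) (m n : ℕ) : a ^ m / a ^ n ≤ T ^ (n + m) * (b ^ m / b ^ n) := by
  have h1 : a ^ m ≤ (T * b) ^ m := pow_le_pow_left₀ ha.le hab m
  have h2 : b ^ n ≤ (T * a) ^ n := pow_le_pow_left₀ hb.le hba n
  rw [← mul_div_assoc, div_le_div_iff₀ (by positivity) (by positivity)]
  calc a ^ m * b ^ n ≤ (T * b) ^ m * (T * a) ^ n :=
        mul_le_mul h1 h2 (by positivity) ((pow_nonneg ha.le m).trans h1)
    _ = T ^ (n + m) * b ^ m * a ^ n := by rw [mul_pow, mul_pow, pow_add]; ring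

lemma norm_sub_sq_eq_of_norm_eq_one {d : ℕ} {u v : Vec d} (hu : ‖u‖ = 1) (hv : ‖v‖ = 1) :
    ‖u - v‖ ^ 2 = 2 - 2 * Real.cos (angle u v) := by
  rw [norm_sub_sq_real, cos_angle, hu, hv]
  ring

lemma norm_sub_le_angle {d : ℕ} {u v : Vec d} (hu : ‖u‖ = 1) (hv : ‖v‖ = 1) :
    ‖u - v‖ ≤ angle u v := by
  rw [← pow_le_pow_iff_left₀ (norm_nonneg _) (angle_nonneg _ _) two_ne_zero,
    norm_sub_sq_eq_of_norm_eq_one hu hv]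
  linarith [Real.one_sub_sq_div_two_le_cos (x := angle u v)]

lemma le_norm_sub_of_mem_Vseta {d : ℕ} {s u : Vec d} {η : ℝ} (hη : 0 < η) (hs : s ≠ 0)
    (hu : u ∈ Vseta s η) : √(2 - 2 * Real.cos η) ≤ ‖u - ‖s‖⁻¹ • s‖ := by
  have hu1 : ‖u‖ = 1 := mem_sphere_zero_iff_norm.1 hu.1
  refine Real.sqrt_le_iff.2 ⟨norm_nonneg _, ?_⟩
  rw [norm_sub_sq_eq_of_norm_eq_one hu1 (norm_inv_smul_self hs),
    angle_smul_right_of_pos _ _ (by positivity)]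
  linarith [Real.cos_le_cos_of_nonneg_of_le_pi hη.le (angle_le_pi u s) hu.2.le]

/-- Lemma `COMPARABILITYLEM` of Marklof–Strömbergsson: on subsets of
`V_s^η`, the scattering measure `λ_s` and the surface measure are comparable, with
distortion close to `1` on sets of small diameter. -/
theorem statement8 (d : ℕ) (hd : 2 ≤ d) (η : ℝ) (hη : η ∈ Set.Ioo 0 Real.pi)
    (ε : ℝ) (hε : 0 < ε) :
    ∃ Kη > (1:ℝ), ∃ c > (0:ℝ),
      ∀ s : Vec d, s ≠ 0 → ∀ M : Set (Vec d), MeasurableSet M → M ⊆ Vseta s η →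
        0 < sphVol d M →
          0 < lamS s M ∧
          ∃ g : Vec d → ℝ, ContinuousOn g M ∧
            (∀ u ∈ M, 0 < g u ∧ g u ∈ Set.Icc Kη⁻¹ Kη) ∧
            (lamS s M)⁻¹ • (lamS s).restrict M =
              ((sphVol d M)⁻¹ • (sphVol d).restrict M).withDensity
                (fun u => ENNReal.ofReal (g u)) ∧
            ((∀ u₁ ∈ M, ∀ u₂ ∈ M, angle u₁ u₂ ≤ c) →
              ∀ u ∈ M, g u ∈ Set.Icc (1 - ε) (1 + ε)) := by
  obtain ⟨hη0, hηπ⟩ := hη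
  have hcos1 : Real.cos η < 1 := by
    simpa using Real.cos_lt_cos_of_nonneg_of_le_pi le_rfl hηπ.le hη0
  have hcos2 : -1 < Real.cos η := by
    simpa using Real.cos_lt_cos_of_nonneg_of_le_pi hη0.le le_rfl hηπ
  set δ : ℝ := √(2 - 2 * Real.cos η) with hδdef
  have hδ : 0 < δ := Real.sqrt_pos.2 (by linarith)
  have hδ2 : δ < 2 := (Real.sqrt_lt' two_pos).2 (by linarith)
  obtain ⟨c, hc0, hc⟩ : ∃ c > (0 : ℝ), (1 + c / δ) ^ (d + 3) ≤ 1 + ε := by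
    have hcont : Tendsto (fun c : ℝ => (1 + c / δ) ^ (d + 3)) (𝓝[>] 0) (𝓝 1) := by
      have h : Continuous fun c : ℝ => (1 + c / δ) ^ (d + 3) := by fun_prop
      simpa using (h.tendsto 0).mono_left nhdsWithin_le_nhds
    obtain ⟨c, h1, h2⟩ := ((hcont.eventually_lt_const (by linarith : 1 < 1 + ε)).and
      self_mem_nhdsWithin).exists
    exact ⟨c, h2, h1.le⟩
  refine ⟨(2 / δ) ^ (d + 3), one_lt_pow₀ ((one_lt_div hδ).2 hδ2) (by omega), c, hc0, ?_⟩
  intro s hs M hM hMV hMpos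
  obtain ⟨C, hC0, hCt, hC⟩ := exists_lamS_eq hd hs
  set e : Vec d := ‖s‖⁻¹ • s with he
  have hnorm : ∀ u ∈ M, ‖u‖ = 1 := fun u hu => mem_sphere_zero_iff_norm.1 (hMV hu).1
  have hlow : ∀ u ∈ M, δ ≤ ‖u - e‖ := fun u hu => le_norm_sub_of_mem_Vseta hη0 hs (hMV hu)
  have hupp : ∀ u ∈ M, ‖u - e‖ ≤ 2 := fun u hu => by
    have := norm_sub_le u e
    rw [hnorm u hu, he, norm_inv_smul_self hs] at this
    linarith
  have hpos : ∀ u ∈ M, 0 < ‖u - e‖ := fun u hu => hδ.trans_le (hlow u hu)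
  set w : Vec d → ℝ := fun u => ‖u - e‖ ^ 3 / ‖u - e‖ ^ d with hw
  have hwpos : ∀ u ∈ M, 0 < w u := fun u hu => by
    have := hpos u hu
    positivity
  have hfin : sphVol d M ≠ ∞ := by
    rw [sphVol, Measure.map_apply measurable_subtype_coe hM]
    exact measure_ne_top _ _
  have hratio : ∀ u ∈ M, ∀ u' ∈ M, w u ≤ (2 / δ) ^ (d + 3) * w u' := by
    have h : ∀ u ∈ M, ∀ u' ∈ M, ‖u - e‖ ≤ 2 / δ * ‖u' - e‖ := fun u hu u' hu' => by
      rw [div_mul_eq_mul_div, le_div_iff₀ hδ]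
      nlinarith [hlow u' hu', hupp u hu]
    exact fun u hu u' hu' =>
      pow_div_pow_le_mul (hpos u hu) (hpos u' hu') (h u hu u' hu') (h u' hu' u hu) 3 d
  obtain ⟨hI0, hIt, hIb⟩ := mul_div_lintegral_mem_Icc hM hMpos.ne' hfin hwpos hratio
  have hlamM : lamS s M = C * ∫⁻ u in M, ENNReal.ofReal (w u) ∂(sphVol d) := by
    rw [hC, Measure.smul_apply, smul_eq_mul, withDensity_apply _ hM]
  refine ⟨by rw [hlamM]; exact ENNReal.mul_pos hC0 hI0.ne', fun u => w u * (sphVol d M).toReal /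
    (∫⁻ u in M, ENNReal.ofReal (w u) ∂(sphVol d)).toReal, ?_, ?_, ?_, ?_⟩
  · refine ContinuousOn.div_const (ContinuousOn.mul_const ?_ _) _
    exact ContinuousOn.div (by fun_prop) (by fun_prop) fun u hu => (pow_pos (hpos u hu) d).ne'
  · exact fun u hu => ⟨(inv_pos.2 (by positivity)).trans_le (hIb u hu).1, hIb u hu⟩
  · have hwm : Measurable fun u => ENNReal.ofReal (w u) := by fun_prop
    rw [hlamM, hC, Measure.restrict_smul, restrict_withDensity hM, withDensity_smul_measure]
    set I := ∫⁻ u in M, ENNReal.ofReal (w u) ∂(sphVol d)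
    have hg : (fun u => ENNReal.ofReal (w u * (sphVol d M).toReal / I.toReal)) =
        (sphVol d M / I) • fun u => ENNReal.ofReal (w u) := by
      ext u
      have hw0 : 0 ≤ w u := by positivity
      rw [mul_div_assoc, ENNReal.ofReal_mul hw0, ← ENNReal.toReal_div,
        ENNReal.ofReal_toReal (ENNReal.div_ne_top hfin hI0.ne'), Pi.smul_apply, smul_eq_mul,
        mul_comm]
    rw [hg, withDensity_smul _ hwm, smul_smul, smul_smul,
      ENNReal.mul_inv (Or.inl hC0) (Or.inl hCt), mul_right_comm, ENNReal.inv_mul_cancel hC0 hCt,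
      one_mul, ENNReal.div_eq_inv_mul, mul_left_comm, ENNReal.inv_mul_cancel hMpos.ne' hfin, mul_one]
  · intro hdiam u hu
    have h : ∀ u ∈ M, ∀ u' ∈ M, ‖u - e‖ ≤ (1 + c / δ) * ‖u' - e‖ := fun u hu u' hu' => by
      have h1 : ‖u - e‖ ≤ ‖u - u'‖ + ‖u' - e‖ := norm_sub_le_norm_sub_add_norm_sub u u' e
      have h2 := (norm_sub_le_angle (hnorm u hu) (hnorm u' hu')).trans (hdiam u hu u' hu')
      have h3 : c ≤ c / δ * ‖u' - e‖ := by
        rw [div_mul_eq_mul_div, le_div_iff₀ hδ]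
        exact mul_le_mul_of_nonneg_left (hlow u' hu') hc0.le
      linarith
    have hratio' : ∀ u ∈ M, ∀ u' ∈ M, w u ≤ (1 + ε) * w u' := fun u hu u' hu' =>
      (pow_div_pow_le_mul (hpos u hu) (hpos u' hu') (h u hu u' hu') (h u' hu' u hu) 3 d).trans
        (mul_le_mul_of_nonneg_right hc (hwpos u' hu').le)
    obtain ⟨-, -, hIb'⟩ := mul_div_lintegral_mem_Icc hM hMpos.ne' hfin hwpos hratio'
    refine ⟨le_trans ?_ (hIb' u hu).1, (hIb' u hu).2⟩
    rw [← one_div, le_div_iff₀ (by linarith)]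
    nlinarith
end
end

section
/- Fix a lattice L = ℤᵈM₀, a point q₀ ∈ ℝᵈ, a C¹ function β: S₁^{d−1} → ℝᵈ (satisfying, in case q₀ ∈ L, that (β(v)+ℝ_{>0}v)∩B₁ᵈ = ∅ for all v ∈ S₁^{d−1}), and a Borel probability measure λ on S₁^{d−1} absolutely continuous with respect to vol_{S₁^{d−1}}. Then for every t > 0 and every ε > 0 there exist ρ₀ > 0 and N ∈ ℤ_{>0} such that for all ρ ∈ (0,ρ₀): λ({v₀ ∈ S₁^{d−1} : the trajectory with initial data (q₀+ρβ(v₀),v₀) undergoes at least N collisions and ‖s₁‖+‖s₂‖+⋯+‖s_N‖ ≤ ρ^{−(d−1)}t}) < ε, where sₖ = sₖ(q₀+ρβ(v₀),v₀;ρ). -/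
open MeasureTheory Metric Set Filter InnerProductGeometry
open scoped Topology ENNReal RealInnerProductSpace

noncomputable section

instance sphVol_finite (d : ℕ) : IsFiniteMeasure (sphVol d) := by
  constructor
  rw [sphVol, Measure.map_apply measurable_subtype_coe MeasurableSet.univ]
  exact measure_lt_top _ _

/-- The lattice `ℤᵈ M₀`. -/
def lattice {d : ℕ} (M₀ : Matrix (Fin d) (Fin d) ℝ) : Set (Vec d) :=
  {x | ∃ m : Fin d → ℤ, ∀ i, x i = ∑ j, (m j : ℝ) * M₀ j i}

/-- The billiard domain `K_ρ`: complement of the union of open balls of radius `ρ`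
centered at the lattice points. -/
def Kset {d : ℕ} (M₀ : Matrix (Fin d) (Fin d) ℝ) (ρ : ℝ) : Set (Vec d) :=
  {x | ∀ y ∈ lattice M₀, ρ ≤ dist x y}

/-- The ray from `q` in direction `v` leaves `K_ρ`, i.e. the free path length is finite. -/
def collides {d : ℕ} (M₀ : Matrix (Fin d) (Fin d) ℝ) (ρ : ℝ) (q v : Vec d) : Prop :=
  ∃ t > 0, q + t • v ∉ Kset M₀ ρ

/-- The free path length `τ₁(q,v;ρ)` (junk value `0` if no collision ever occurs). -/
def tau1 {d : ℕ} (M₀ : Matrix (Fin d) (Fin d) ℝ) (ρ : ℝ) (q v : Vec d) : ℝ :=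
  sInf {t | 0 < t ∧ q + t • v ∉ Kset M₀ ρ}

/-- Position of the first collision. -/
def qColl {d : ℕ} (M₀ : Matrix (Fin d) (Fin d) ℝ) (ρ : ℝ) (q v : Vec d) : Vec d :=
  q + tau1 M₀ ρ q v • v

/-- The lattice point (scatterer) met at the first collision. -/
def mColl {d : ℕ} (M₀ : Matrix (Fin d) (Fin d) ℝ) (ρ : ℝ) (q v : Vec d) : Vec d :=
  Classical.epsilon fun y => y ∈ lattice M₀ ∧ dist (qColl M₀ ρ q v) y = ρ

/-- The impact location `w₁(q,v;ρ)` on the unit sphere. -/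
def wColl {d : ℕ} (M₀ : Matrix (Fin d) (Fin d) ℝ) (ρ : ℝ) (q v : Vec d) : Vec d :=
  ρ⁻¹ • (qColl M₀ ρ q v - mColl M₀ ρ q v)

/-- The outgoing velocity `v₁(q,v;ρ)` after specular reflection. -/
def vColl {d : ℕ} (M₀ : Matrix (Fin d) (Fin d) ℝ) (ρ : ℝ) (q v : Vec d) : Vec d :=
  v - (2 * ⟪v, wColl M₀ ρ q v⟫) • wColl M₀ ρ q v

/-- State (position, outgoing velocity) after `n` collisions. -/
def traj {d : ℕ} (M₀ : Matrix (Fin d) (Fin d) ℝ) (ρ : ℝ) (x : Vec d × Vec d) :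
    ℕ → Vec d × Vec d
  | 0 => x
  | n + 1 =>
      (qColl M₀ ρ (traj M₀ ρ x n).1 (traj M₀ ρ x n).2,
        vColl M₀ ρ (traj M₀ ρ x n).1 (traj M₀ ρ x n).2)

/-- The `(k+1)`-st collision time `τ_{k+1}`. -/
def tauN {d : ℕ} (M₀ : Matrix (Fin d) (Fin d) ℝ) (ρ : ℝ) (x : Vec d × Vec d) (k : ℕ) : ℝ :=
  tau1 M₀ ρ (traj M₀ ρ x k).1 (traj M₀ ρ x k).2

/-- The `(k+1)`-st path segment `s_{k+1} = τ_{k+1} v_k`. -/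
def seg {d : ℕ} (M₀ : Matrix (Fin d) (Fin d) ℝ) (ρ : ℝ) (x : Vec d × Vec d) (k : ℕ) : Vec d :=
  tauN M₀ ρ x k • (traj M₀ ρ x k).2

/-- The first `n` collisions all occur. -/
def hitsAll {d : ℕ} (M₀ : Matrix (Fin d) (Fin d) ℝ) (ρ : ℝ) (x : Vec d × Vec d) (n : ℕ) : Prop :=
  ∀ k < n, collides M₀ ρ (traj M₀ ρ x k).1 (traj M₀ ρ x k).2

/-- `T_n = τ₁ + ⋯ + τ_n`. -/
def Tcoll {d : ℕ} (M₀ : Matrix (Fin d) (Fin d) ℝ) (ρ : ℝ) (x : Vec d × Vec d) (n : ℕ) : ℝ :=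
  ∑ k ∈ Finset.range n, tauN M₀ ρ x k

/-- Number of collisions up to time `t`. -/
def nColl {d : ℕ} (M₀ : Matrix (Fin d) (Fin d) ℝ) (ρ : ℝ) (x : Vec d × Vec d) (t : ℝ) : ℕ :=
  sInf {n : ℕ | ¬(hitsAll M₀ ρ x (n + 1) ∧ Tcoll M₀ ρ x (n + 1) ≤ t)}

/-- The billiard flow: position and velocity at time `t` for initial data `x`. -/
def flow {d : ℕ} (M₀ : Matrix (Fin d) (Fin d) ℝ) (ρ : ℝ) (x : Vec d × Vec d) (t : ℝ) :
    Vec d × Vec d :=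
  ((traj M₀ ρ x (nColl M₀ ρ x t)).1 +
      (t - Tcoll M₀ ρ x (nColl M₀ ρ x t)) • (traj M₀ ρ x (nColl M₀ ρ x t)).2,
    (traj M₀ ρ x (nColl M₀ ρ x t)).2)

/-- Normalized direction `Ŝ = S/‖S‖`. -/
def dir {d : ℕ} (x : Vec d) : Vec d := ‖x‖⁻¹ • x

/-- The set `B_n` of `n`-tuples of nonzero vectors with consecutive directions distinct. -/
def Bset (d n : ℕ) : Set (Fin n → Vec d) :=
  {S | (∀ j, S j ≠ 0) ∧
    ∀ j k : Fin n, (k : ℕ) = (j : ℕ) + 1 → dir (S j) ≠ dir (S k)}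
/-! ### Grid codes -/

/-- Points of a box are encoded by the cells of a grid of mesh `h`. -/
theorem exists_grid_code {d : ℕ} (b : OrthonormalBasis (Fin d) ℝ (Vec d)) (y₀ : Vec d)
    (a : Fin d → ℝ) {h : ℝ} (hh : 0 < h) (ha : ∀ i, h ≤ a i) :
    ∃ (F : Finset (Fin d → ℤ)) (c : Vec d → Fin d → ℤ),
      (F.card : ℝ) ≤ ∏ i, (5 * a i / h) ∧
      (∀ y, (∀ i, |⟪b i, y - y₀⟫| ≤ a i) → c y ∈ F) ∧
      ∀ y z, c y = c z → ‖y - z‖ ≤ √d * h := by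
  refine ⟨Fintype.piFinset fun i => Finset.Icc (-⌈a i / h⌉) ⌈a i / h⌉,
    fun y i => ⌊⟪b i, y - y₀⟫ / h⌋, ?_, ?_, ?_⟩
  · rw [Fintype.card_piFinset, Nat.cast_prod]
    refine Finset.prod_le_prod (fun i _ => by positivity) fun i _ => ?_
    have h1 : 1 ≤ a i / h := (one_le_div hh).2 (ha i)
    have h2 : (0 : ℤ) ≤ ⌈a i / h⌉ := Int.ceil_nonneg (by linarith)
    have h3 := Int.ceil_lt_add_one (a i / h)
    have h4 : ((Finset.Icc (-⌈a i / h⌉) ⌈a i / h⌉).card : ℝ) = 2 * ⌈a i / h⌉ + 1 := by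
      have : ((Finset.Icc (-⌈a i / h⌉) ⌈a i / h⌉).card : ℤ) = 2 * ⌈a i / h⌉ + 1 := by
        rw [Int.card_Icc, Int.toNat_of_nonneg (by omega)]; ring
      exact_mod_cast this
    rw [h4, mul_div_assoc]
    linarith
  · intro y hy
    rw [Fintype.mem_piFinset]
    intro i
    have h1 := abs_le.1 (hy i)
    rw [Finset.mem_Icc]
    constructor
    · rw [Int.le_floor]
      push_cast
      have : -(a i / h) ≤ ⟪b i, y - y₀⟫ / h := by
        rw [← neg_div]; gcongr; exact h1.1
      linarith [Int.le_ceil (a i / h)]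
    · have : ⟪b i, y - y₀⟫ / h ≤ a i / h := by gcongr; exact h1.2
      exact_mod_cast (Int.floor_le _).trans (this.trans (Int.le_ceil _))
  · intro y z hyz
    have key : ∀ i, ‖⟪b i, y - z⟫‖ ^ 2 ≤ h ^ 2 := by
      intro i
      have h1 := Int.abs_sub_lt_one_of_floor_eq_floor (congrFun hyz i)
      rw [← sub_div, ← inner_sub_right, sub_sub_sub_cancel_right, abs_div, abs_of_pos hh,
        div_lt_one hh] at h1
      rw [Real.norm_eq_abs]
      gcongr
    have h2 : ‖y - z‖ ^ 2 ≤ d * h ^ 2 := by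
      rw [← b.sum_sq_norm_inner_right (y - z)]
      refine (Finset.sum_le_sum fun i _ => key i).trans ?_
      simp
    refine le_of_sq_le_sq ?_ (by positivity)
    rw [mul_pow, Real.sq_sqrt (by positivity)]
    exact h2

theorem exists_orthonormalBasis_head {r : ℕ} {e : Vec (r + 2)} (he : ‖e‖ = 1) :
    ∃ b : OrthonormalBasis (Fin (r + 2)) ℝ (Vec (r + 2)), b 0 = e := by
  have hv : Orthonormal ℝ (({0} : Set (Fin (r + 2))).domRestrict fun _ => e) := by
    constructor
    · intro i; exact he
    · intro i j hij; exact absurd (Subsingleton.elim i j) hij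
  obtain ⟨b, hb⟩ := hv.exists_orthonormalBasis_extension_of_card_eq (by simp)
  exact ⟨b, hb 0 rfl⟩

theorem exists_orthonormalBasis_head₂ {r : ℕ} {e f : Vec (r + 2)} (he : ‖e‖ = 1) (hf : ‖f‖ = 1)
    (hef : ⟪e, f⟫ = 0) :
    ∃ b : OrthonormalBasis (Fin (r + 2)) ℝ (Vec (r + 2)), b 0 = e ∧ b 1 = f := by
  have hv : Orthonormal ℝ
      (({0, 1} : Set (Fin (r + 2))).domRestrict fun i => if i = 0 then e else f) := by
    constructor
    · rintro ⟨i, rfl | rfl⟩ <;> simp [he, hf]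
    · rintro ⟨i, rfl | rfl⟩ ⟨j, rfl | rfl⟩ hij <;>
        simp_all [real_inner_comm]
  obtain ⟨b, hb⟩ := hv.exists_orthonormalBasis_extension_of_card_eq (by simp)
  exact ⟨b, by simpa using hb 0 (by simp), by simpa using hb 1 (by simp)⟩

/-- A separated finite set inside a box has at most the expected number of points. -/
theorem card_le_of_separated_of_box {d : ℕ} (b : OrthonormalBasis (Fin d) ℝ (Vec d))
    (a : Fin d → ℝ) {h r₁ : ℝ} (hh : 0 < h) (hr : √d * h < r₁) (ha : ∀ i, h ≤ a i)
    (X : Finset (Vec d)) (hX : ∀ x ∈ X, ∀ y ∈ X, x ≠ y → r₁ ≤ ‖x - y‖)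
    (hbox : ∀ x ∈ X, ∀ i, |⟪b i, x⟫| ≤ a i) :
    (X.card : ℝ) ≤ ∏ i, (5 * a i / h) := by
  obtain ⟨F, c, hF, hc, hd⟩ := exists_grid_code b 0 a hh ha
  refine le_trans ?_ hF
  have : X.card ≤ F.card := by
    refine Finset.card_le_card_of_injOn c (fun x hx => hc x (by simpa using hbox x hx)) ?_
    intro x hx y hy hxy
    by_contra hne
    exact absurd (hX x hx y hy hne) (not_le.2 ((hd x y hxy).trans_lt hr))
  exact_mod_cast this
/-! ### Measure of spherical caps -/

theorem measure_le_card_mul {α ι : Type*} [MeasurableSpace α] (μ : Measure α) (S : Set α)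
    (F : Finset ι) (c : α → ι) (hc : ∀ x ∈ S, c x ∈ F) (K : ℝ≥0∞)
    (hK : ∀ i ∈ F, μ {x ∈ S | c x = i} ≤ K) : μ S ≤ F.card * K := by
  have h1 : S ⊆ ⋃ i ∈ F, {x ∈ S | c x = i} := fun x hx => by
    simp only [mem_iUnion]
    exact ⟨c x, hc x hx, hx, rfl⟩
  calc μ S ≤ μ (⋃ i ∈ F, {x ∈ S | c x = i}) := measure_mono h1
    _ ≤ ∑ i ∈ F, μ {x ∈ S | c x = i} := measure_biUnion_finset_le _ _
    _ ≤ ∑ i ∈ F, K := Finset.sum_le_sum hK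
    _ = F.card * K := by simp

theorem volume_le_of_forall_norm_sub_le {d : ℕ} (S : Set (Vec d)) {δ : ℝ} (hδ : 0 ≤ δ)
    (hS : ∀ x ∈ S, ∀ y ∈ S, ‖x - y‖ ≤ δ) :
    volume S ≤ ENNReal.ofReal (δ ^ d) * volume (ball (0 : Vec d) 1) := by
  rcases S.eq_empty_or_nonempty with rfl | ⟨x, hx⟩
  · simp
  · have h1 : S ⊆ closedBall x δ := fun y hy => by
      rw [mem_closedBall, dist_eq_norm]; exact hS y hy x hx
    refine (measure_mono h1).trans (le_of_eq ?_)
    rw [Measure.addHaar_closedBall _ _ hδ]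
    simp

open scoped Pointwise in
theorem sphVol_le_of_isClosed {r : ℕ} {S : Set (Vec (r + 2))} (hS : S ⊆ sph (r + 2))
    (hSc : IsClosed S) {δ : ℝ} (hδ : 0 < δ)
    (hdiam : ∀ x ∈ S, ∀ y ∈ S, ‖x - y‖ ≤ δ) :
    sphVol (r + 2) S ≤ ((r + 2 : ℕ) : ℝ≥0∞) * (ENNReal.ofReal
      ((5 * (2 + δ) / δ) * 5 ^ (r + 1) * (√((r + 2 : ℕ) : ℝ) * δ) ^ (r + 2)) *
        volume (ball (0 : Vec (r + 2)) 1)) := by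
  rcases S.eq_empty_or_nonempty with rfl | ⟨e, heS⟩
  · simp
  have he : ‖e‖ = 1 := by simpa [sph] using hS heS
  obtain ⟨b, hb⟩ := exists_orthonormalBasis_head he
  obtain ⟨F, c, hF, hc, hd⟩ := exists_grid_code b 0 (Fin.cons (2 + δ) fun _ => δ) hδ (by
    intro i; refine Fin.cases ?_ (fun j => ?_) i <;> simp)
  have hmeas : MeasurableSet ((Subtype.val : sphere (0 : Vec (r + 2)) 1 → _) ⁻¹' S) :=
    measurable_subtype_coe hSc.measurableSet
  rw [sphVol, Measure.map_apply measurable_subtype_coe hSc.measurableSet,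
    Measure.toSphere_apply' _ hmeas, finrank_euclideanSpace, Fintype.card_fin]
  gcongr
  set A : Set (Vec (r + 2)) := Ioo (0 : ℝ) 1 • (Subtype.val '' (Subtype.val ⁻¹' S :
    Set (sphere (0 : Vec (r + 2)) 1))) with hA
  have hAc : ∀ y ∈ A, c y ∈ F := by
    rintro y ⟨t, ht, x, ⟨⟨x, hx'⟩, hxS, rfl⟩, rfl⟩
    apply hc
    have h1 : ‖x - e‖ ≤ δ := hdiam x hxS e heS
    have hx1 : ‖x‖ = 1 := by simpa using hx'
    intro i
    refine Fin.cases ?_ (fun j => ?_) i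
    · simp only [sub_zero, Fin.cons_zero]
      refine (abs_real_inner_le_norm _ _).trans ?_
      rw [b.orthonormal.1, norm_smul, hx1, Real.norm_eq_abs, abs_of_pos ht.1]
      linarith [ht.2]
    · simp only [sub_zero, Fin.cons_succ]
      have h2 : ⟪b j.succ, e⟫ = 0 := by
        rw [← hb]; exact b.orthonormal.2 (Fin.succ_ne_zero j)
      have h3 : ⟪b j.succ, t • x⟫ = t * ⟪b j.succ, x - e⟫ := by
        rw [inner_smul_right, inner_sub_right, h2, sub_zero]
      rw [h3, abs_mul, abs_of_pos ht.1]
      have h4 : |⟪b j.succ, x - e⟫| ≤ δ := by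
        refine (abs_real_inner_le_norm _ _).trans ?_
        rw [b.orthonormal.1, one_mul]; exact h1
      nlinarith [ht.1, ht.2, abs_nonneg ⟪b j.succ, x - e⟫]
  refine (measure_le_card_mul volume A F c hAc (ENNReal.ofReal
    ((√((r + 2 : ℕ) : ℝ) * δ) ^ (r + 2)) * volume (ball (0 : Vec (r + 2)) 1)) ?_).trans ?_
  · intro i _
    refine volume_le_of_forall_norm_sub_le _ (by positivity) ?_
    rintro x ⟨-, hx⟩ y ⟨-, hy⟩
    exact hd x y (hx.trans hy.symm)
  · rw [← mul_assoc]
    gcongr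
    rw [ENNReal.ofReal_mul (p := 5 * (2 + δ) / δ * 5 ^ (r + 1)) (by positivity)]
    gcongr
    rw [← ENNReal.ofReal_natCast]
    apply ENNReal.ofReal_le_ofReal
    refine hF.trans (le_of_eq ?_)
    rw [Fin.prod_univ_succ]
    simp [hδ.ne']

/-- A subset of the sphere of diameter `δ` has measure `O(δ^{d-1})`. -/
theorem exists_sphVol_le (r : ℕ) : ∃ C > (0 : ℝ), ∀ S ⊆ sph (r + 2), ∀ δ > (0 : ℝ),
    (∀ x ∈ S, ∀ y ∈ S, ‖x - y‖ ≤ δ) → sphVol (r + 2) S ≤ ENNReal.ofReal (C * δ ^ (r + 1)) := by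
  set V := (volume (ball (0 : Vec (r + 2)) 1)).toReal with hV
  have hVtop : volume (ball (0 : Vec (r + 2)) 1) ≠ ⊤ := measure_ball_lt_top.ne
  have hVpos : 0 < V := ENNReal.toReal_pos (measure_ball_pos _ _ one_pos).ne' hVtop
  have hVe : volume (ball (0 : Vec (r + 2)) 1) = ENNReal.ofReal V :=
    (ENNReal.ofReal_toReal hVtop).symm
  refine ⟨(r + 2 : ℕ) * (20 * 5 ^ (r + 1) * (√((r + 2 : ℕ) : ℝ)) ^ (r + 2) * V), by positivity, ?_⟩
  intro S hS δ hδ hdiam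
  set η := min δ 2 with hη
  have hη0 : 0 < η := by positivity
  have hη2 : η ≤ 2 := min_le_right _ _
  have hSc : closure S ⊆ sph (r + 2) := closure_minimal hS isClosed_sphere
  have hdc : ∀ x ∈ closure S, ∀ y ∈ closure S, ‖x - y‖ ≤ η := by
    intro x hx y hy
    refine le_min ?_ ?_
    · have : ∀ p ∈ closure (S ×ˢ S), ‖p.1 - p.2‖ ≤ δ := by
        intro p hp
        have hcl : IsClosed {p : Vec (r + 2) × Vec (r + 2) | ‖p.1 - p.2‖ ≤ δ} :=
          isClosed_le (by fun_prop) (by fun_prop)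
        exact closure_minimal (fun q hq => hdiam q.1 hq.1 q.2 hq.2) hcl hp
      exact this (x, y) (by rw [closure_prod_eq]; exact ⟨hx, hy⟩)
    · have h1 : ‖x‖ = 1 := by simpa [sph] using hSc hx
      have h2 : ‖y‖ = 1 := by simpa [sph] using hSc hy
      linarith [norm_sub_le x y]
  refine (measure_mono subset_closure).trans
    ((sphVol_le_of_isClosed hSc isClosed_closure hη0 hdc).trans ?_)
  rw [hVe, ← ENNReal.ofReal_mul (by positivity), ← ENNReal.ofReal_natCast,
    ← ENNReal.ofReal_mul (by positivity)]
  apply ENNReal.ofReal_le_ofReal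
  have h5 : 5 * (2 + η) / η * 5 ^ (r + 1) * (√((r + 2 : ℕ) : ℝ) * η) ^ (r + 2) * V
      = 5 * (2 + η) * 5 ^ (r + 1) * (√((r + 2 : ℕ) : ℝ)) ^ (r + 2) * V * η ^ (r + 1) := by
    field_simp
    ring
  rw [h5, mul_assoc ((r + 2 : ℕ) : ℝ)]
  have h6 : η ^ (r + 1) ≤ δ ^ (r + 1) := by gcongr; exact min_le_left _ _
  have h7 : 5 * (2 + η) ≤ 20 := by linarith
  gcongr
/-! ### Covering thin pieces of the sphere -/

theorem inner_sub_self_of_norm_eq_one {d : ℕ} {w w₀ : Vec d} (hw : ‖w‖ = 1) (hw₀ : ‖w₀‖ = 1) :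
    ⟪w₀, w - w₀⟫ = -(‖w - w₀‖ ^ 2 / 2) := by
  have h1 := norm_sub_sq_real w w₀
  rw [inner_sub_right, real_inner_self_eq_norm_sq, real_inner_comm, h1, hw, hw₀]
  ring

theorem exists_slab_code (r : ℕ) : ∃ C > (0 : ℝ), ∀ (w₀ u : Vec (r + 2)) (δ R : ℝ),
    ‖w₀‖ = 1 → ‖u‖ = 1 → 0 < δ → δ ≤ R → R ^ 2 ≤ δ → (|⟪u, w₀⟫| ≤ 1 / 2 ∨ R ≤ 64 * δ) →
    ∃ (F : Finset (Fin (r + 2) → ℤ)) (c : Vec (r + 2) → Fin (r + 2) → ℤ),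
      (F.card : ℝ) ≤ C * (R / δ) ^ r ∧
      (∀ w, ‖w‖ = 1 → ‖w - w₀‖ ≤ R → |⟪u, w - w₀⟫| ≤ 2 * δ → c w ∈ F) ∧
      ∀ y z, c y = c z → ‖y - z‖ ≤ √((r + 2 : ℕ) : ℝ) * δ := by
  refine ⟨15 * 15 * 5 ^ r + 320 ^ (r + 2), by positivity, ?_⟩
  intro w₀ u δ R hw₀ hu hδ hδR hR2 hcase
  have hRδ : 1 ≤ R / δ := (one_le_div hδ).2 hδR
  rcases hcase with hcase | hcase
  · set g := u - ⟪u, w₀⟫ • w₀ with hg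
    have hg0 : ⟪w₀, g⟫ = 0 := by
      rw [hg, inner_sub_right, inner_smul_right, real_inner_self_eq_norm_sq, hw₀,
        real_inner_comm]
      ring
    have hgn : ‖g‖ ^ 2 = 1 - ⟪u, w₀⟫ ^ 2 := by
      rw [hg, norm_sub_sq_real, norm_smul, inner_smul_right, hu, hw₀, Real.norm_eq_abs, mul_one,
        sq_abs]
      ring
    have hg34 : 3 / 4 ≤ ‖g‖ := by
      have h1 := abs_le.1 hcase
      refine le_of_sq_le_sq ?_ (norm_nonneg _)
      rw [hgn]
      nlinarith
    have hgpos : 0 < ‖g‖ := by linarith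
    obtain ⟨b, hb0, hb1⟩ := exists_orthonormalBasis_head₂ (e := w₀) (f := ‖g‖⁻¹ • g) hw₀
      (by rw [norm_smul, norm_inv, norm_norm, inv_mul_cancel₀ hgpos.ne'])
      (by rw [inner_smul_right, hg0, mul_zero])
    obtain ⟨F, c, hF, hc, hd⟩ := exists_grid_code b w₀
      (Fin.cons (3 * δ) (Fin.cons (3 * δ) fun _ => R)) hδ (by
        intro i
        refine Fin.cases ?_ (fun j => Fin.cases ?_ (fun k => ?_) j) i
        · simp only [Fin.cons_zero]; linarith
        · simp only [Fin.cons_succ, Fin.cons_zero]; linarith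
        · simpa using hδR)
    refine ⟨F, c, ?_, ?_, hd⟩
    · refine hF.trans ?_
      rw [Fin.prod_univ_succ, Fin.prod_univ_succ]
      simp only [Fin.cons_zero, Fin.cons_succ, Finset.prod_const, Finset.card_univ,
        Fintype.card_fin]
      have h1 : 5 * (3 * δ) / δ = 15 := by field_simp; norm_num
      have h2 : 5 * R / δ = 5 * (R / δ) := by ring
      rw [h1, h2, mul_pow]
      have : 0 ≤ 320 ^ (r + 2) * (R / δ) ^ r := by positivity
      nlinarith
    · intro w hw hwR hwu
      have h1 := inner_sub_self_of_norm_eq_one hw hw₀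
      have h2 : ‖w - w₀‖ ^ 2 ≤ δ := le_trans (by gcongr) hR2
      have h3 : |⟪w₀, w - w₀⟫| ≤ δ / 2 := by
        rw [h1, abs_neg, abs_of_nonneg (by positivity)]; linarith
      apply hc
      intro i
      refine Fin.cases ?_ (fun j => Fin.cases ?_ (fun k => ?_) j) i
      · simp only [Fin.cons_zero, hb0]; linarith
      · rw [Fin.cons_succ, Fin.cons_zero, Fin.succ_zero_eq_one, hb1, inner_smul_left, abs_mul]
        simp only [map_inv₀, conj_trivial, abs_inv, abs_norm]
        have h4 : |⟪g, w - w₀⟫| ≤ 9 / 4 * δ := by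
          rw [hg, inner_sub_left, inner_smul_left]
          simp only [conj_trivial]
          refine (abs_sub _ _).trans ?_
          rw [abs_mul]
          have : |⟪u, w₀⟫| * |⟪w₀, w - w₀⟫| ≤ 1 / 2 * (δ / 2) := by gcongr
          linarith
        rw [inv_mul_le_iff₀ hgpos]
        nlinarith
      · simp only [Fin.cons_succ]
        refine (abs_real_inner_le_norm _ _).trans ?_
        rw [b.orthonormal.1, one_mul]; exact hwR
  · obtain ⟨b, -⟩ := exists_orthonormalBasis_head hw₀
    obtain ⟨F, c, hF, hc, hd⟩ := exists_grid_code b w₀ (fun _ => R) hδ fun _ => hδR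
    refine ⟨F, c, ?_, ?_, hd⟩
    · refine hF.trans ?_
      simp only [Finset.prod_const, Finset.card_univ, Fintype.card_fin]
      have h1 : 5 * R / δ ≤ 320 := by rw [div_le_iff₀ hδ]; linarith
      have h2 : (5 * R / δ) ^ (r + 2) ≤ 320 ^ (r + 2) := by
        have : 0 ≤ R := hδ.le.trans hδR
        gcongr
      have h3 : 1 ≤ (R / δ) ^ r := one_le_pow₀ hRδ
      have h4 : (0 : ℝ) ≤ 15 * 15 * 5 ^ r := by positivity
      have h5 : (0 : ℝ) < 320 ^ (r + 2) := by positivity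
      nlinarith
    · intro w hw hwR _
      refine hc w fun i => (abs_real_inner_le_norm _ _).trans ?_
      rw [b.orthonormal.1, one_mul]; exact hwR

theorem exists_equator_code {r : ℕ} {u : Vec (r + 2)} {σ : ℝ} (hu : ‖u‖ = 1) (hσ : 0 < σ)
    (hσ1 : σ ≤ 1) :
    ∃ (F : Finset (Fin (r + 2) → ℤ)) (c : Vec (r + 2) → Fin (r + 2) → ℤ),
      (F.card : ℝ) ≤ 5 ^ (r + 2) * (1 / σ) ^ (r + 1) ∧
      (∀ w, ‖w‖ = 1 → |⟪u, w⟫| ≤ σ → c w ∈ F) ∧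
      ∀ y z, c y = c z → ‖y - z‖ ≤ √((r + 2 : ℕ) : ℝ) * σ := by
  obtain ⟨b, hb⟩ := exists_orthonormalBasis_head hu
  obtain ⟨F, c, hF, hc, hd⟩ := exists_grid_code b 0 (Fin.cons σ fun _ => 1) hσ (by
    intro i; refine Fin.cases ?_ (fun j => ?_) i <;> simp [hσ1])
  refine ⟨F, c, hF.trans (le_of_eq ?_), ?_, hd⟩
  · rw [Fin.prod_univ_succ]
    simp only [Fin.cons_zero, Fin.cons_succ, Finset.prod_const, Finset.card_univ,
        Fintype.card_fin]
    rw [mul_div_assoc, div_self hσ.ne', mul_one, div_eq_mul_one_div 5 σ, mul_pow]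
    ring
  · intro w hw hwu
    apply hc
    intro i
    refine Fin.cases ?_ (fun j => ?_) i
    · simpa [hb] using hwu
    · simp only [sub_zero, Fin.cons_succ]
      refine (abs_real_inner_le_norm _ _).trans ?_
      rw [b.orthonormal.1, hw, one_mul]

/-- If the images of `S` under `W` lie in a small thin piece of the sphere, then the measure of `S`
is controlled by the measure of its parts with image of diameter `O(δ)`. -/
theorem exists_measure_le_of_slab (r : ℕ) : ∃ C > (0 : ℝ), ∀ {α : Type} [MeasurableSpace α]
    (μ : Measure α) (S : Set α) (W : α → Vec (r + 2)) (w₀ u : Vec (r + 2)) (δ R : ℝ) (K : ℝ≥0∞),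
    ‖w₀‖ = 1 → ‖u‖ = 1 → 0 < δ → δ ≤ R → R ^ 2 ≤ δ → (|⟪u, w₀⟫| ≤ 1 / 2 ∨ R ≤ 64 * δ) →
    (∀ x ∈ S, ‖W x‖ = 1) → (∀ x ∈ S, ‖W x - w₀‖ ≤ R) → (∀ x ∈ S, |⟪u, W x - w₀⟫| ≤ 2 * δ) →
    (∀ S' ⊆ S, (∀ x ∈ S', ∀ y ∈ S', ‖W x - W y‖ ≤ √((r + 2 : ℕ) : ℝ) * δ) → μ S' ≤ K) →
    μ S ≤ ENNReal.ofReal (C * (R / δ) ^ r) * K := by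
  obtain ⟨C, hC, h⟩ := exists_slab_code r
  refine ⟨C, hC, ?_⟩
  intro α _ μ S W w₀ u δ R K hw₀ hu hδ hδR hR2 hcase h1 h2 h3 hK
  obtain ⟨F, c, hF, hc, hd⟩ := h w₀ u δ R hw₀ hu hδ hδR hR2 hcase
  refine (measure_le_card_mul μ S F (fun x => c (W x))
    (fun x hx => hc _ (h1 x hx) (h2 x hx) (h3 x hx)) K ?_).trans ?_
  · intro i _
    refine hK _ (fun x hx => hx.1) ?_
    rintro x ⟨-, hx⟩ y ⟨-, hy⟩
    exact hd _ _ (hx.trans hy.symm)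
  · gcongr
    rw [← ENNReal.ofReal_natCast]
    exact ENNReal.ofReal_le_ofReal hF

/-- If the images of `S` under `W` lie within `σ²` of an equator, then the measure of `S` is
controlled by the measure of its parts with image of diameter `O(σ²)`. -/
theorem exists_measure_le_of_equator (r : ℕ) : ∃ C > (0 : ℝ), ∀ {α : Type} [MeasurableSpace α]
    (μ : Measure α) (S : Set α) (W : α → Vec (r + 2)) (u : Vec (r + 2)) (σ : ℝ) (K : ℝ≥0∞),
    ‖u‖ = 1 → 0 < σ → σ ≤ 1 / 2 → √((r + 2 : ℕ) : ℝ) * σ ≤ 1 →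
    (∀ x ∈ S, ‖W x‖ = 1) → (∀ x ∈ S, |⟪u, W x⟫| ≤ σ ^ 2) →
    (∀ S' ⊆ S, (∀ x ∈ S', ∀ y ∈ S',
      ‖W x - W y‖ ≤ √((r + 2 : ℕ) : ℝ) * ((r + 2 : ℕ) * σ ^ 2)) → μ S' ≤ K) →
    μ S ≤ ENNReal.ofReal (C * (1 / σ) ^ (2 * r + 1)) * K := by
  obtain ⟨C, hC, h⟩ := exists_measure_le_of_slab r
  refine ⟨5 ^ (r + 2) * C, by positivity, ?_⟩
  intro α _ μ S W u σ K hu hσ hσ2 hσd h1 h2 hK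
  obtain ⟨F, c, hF, hc, hd⟩ := exists_equator_code hu hσ (by linarith)
  set s := √((r + 2 : ℕ) : ℝ) with hs
  have hss : s ^ 2 = (r + 2 : ℕ) := Real.sq_sqrt (by positivity)
  have hs1 : 1 ≤ s := by
    rw [hs, Real.one_le_sqrt]; push_cast; linarith [(Nat.cast_nonneg r : (0 : ℝ) ≤ r)]
  have hspos : 0 < s := by linarith
  refine (measure_le_card_mul μ S F (fun x => c (W x))
    (fun x hx => hc _ (h1 x hx) ((h2 x hx).trans (by nlinarith)))
      (ENNReal.ofReal (C * (1 / σ) ^ r) * K) ?_).trans ?_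
  · intro i _
    rcases ({x ∈ S | c (W x) = i}).eq_empty_or_nonempty with he | ⟨x₀, hx₀, hx₀i⟩
    · rw [he]; simp
    have hRd : s * σ / ((r + 2 : ℕ) * σ ^ 2) ≤ 1 / σ := by
      rw [← hss, div_le_div_iff₀ (by positivity) hσ]
      nlinarith [mul_pos hspos (pow_pos hσ 2)]
    have h0 : 0 ≤ s * σ / ((r + 2 : ℕ) * σ ^ 2) := by positivity
    refine (h μ {x ∈ S | c (W x) = i} W (W x₀) u ((r + 2 : ℕ) * σ ^ 2) (s * σ) K (h1 _ hx₀) hu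
      (by positivity) ?_ ?_ (Or.inl ?_) (fun x hx => h1 x hx.1) ?_ ?_ ?_).trans ?_
    · rw [← hss]; nlinarith [mul_pos hspos hσ]
    · rw [← hss]; apply le_of_eq; ring
    · exact (h2 _ hx₀).trans (by nlinarith)
    · rintro x ⟨-, hx⟩
      exact hd _ _ (hx.trans hx₀i.symm)
    · rintro x ⟨hx, -⟩
      rw [inner_sub_right]
      refine (abs_sub _ _).trans ?_
      have h5 : (1 : ℝ) ≤ (r + 2 : ℕ) := by
        push_cast; linarith [(Nat.cast_nonneg r : (0 : ℝ) ≤ r)]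
      nlinarith [h2 x hx, h2 x₀ hx₀, sq_nonneg σ]
    · intro S' hS' hd'
      exact hK S' (fun x hx => (hS' hx).1) hd'
    · gcongr
  · rw [← mul_assoc]
    gcongr
    rw [← ENNReal.ofReal_natCast, ← ENNReal.ofReal_mul (by positivity)]
    apply ENNReal.ofReal_le_ofReal
    calc (F.card : ℝ) * (C * (1 / σ) ^ r)
        ≤ 5 ^ (r + 2) * (1 / σ) ^ (r + 1) * (C * (1 / σ) ^ r) := by gcongr
      _ = _ := by ring

/-! ### Sums over separated sets of points -/

theorem norm_smul_dir {d : ℕ} (x : Vec d) : ‖x‖ • dir x = x := by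
  rcases eq_or_ne x 0 with rfl | hx
  · simp
  · rw [dir, smul_smul, mul_inv_cancel₀ (norm_ne_zero_iff.2 hx), one_smul]

theorem norm_dir {d : ℕ} {x : Vec d} (hx : x ≠ 0) : ‖dir x‖ = 1 := by
  rw [dir, norm_smul, norm_inv, norm_norm, inv_mul_cancel₀ (norm_ne_zero_iff.2 hx)]

theorem exists_card_le_of_cone (r : ℕ) {r₁ : ℝ} (hr₁ : 0 < r₁) (hr₁' : r₁ ≤ 1) :
    ∃ C > (0 : ℝ), ∀ (u : Vec (r + 2)) (R θ : ℝ) (X : Finset (Vec (r + 2))), ‖u‖ = 1 →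
    0 < R → θ ≤ 2 → 1 ≤ R * θ → (∀ x ∈ X, ∀ y ∈ X, x ≠ y → r₁ ≤ ‖x - y‖) → (∀ x ∈ X, ‖x‖ ≤ R) →
    (∀ x ∈ X, ‖dir x - u‖ ≤ θ) → (X.card : ℝ) ≤ C * R ^ (r + 2) * θ ^ (r + 1) := by
  set s := √((r + 2 : ℕ) : ℝ) with hs
  have hs1 : 1 ≤ s := by
    rw [hs, Real.one_le_sqrt]; push_cast; linarith [(Nat.cast_nonneg r : (0 : ℝ) ≤ r)]
  have hs0 : 0 < s := by linarith
  set h := r₁ / (2 * s) with hh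
  have hh0 : 0 < h := by positivity
  have hh1 : h ≤ 1 := by rw [hh, div_le_one (by positivity)]; linarith
  have hsh : s * h < r₁ := by
    have : s * h = r₁ / 2 := by rw [hh]; field_simp
    linarith
  refine ⟨10 / h * (5 / h) ^ (r + 1), by positivity, ?_⟩
  intro u R θ X hu hR0 hθ hRθ hX hR hdir
  have hθ0 : 0 < θ := by
    by_contra hc
    nlinarith
  obtain ⟨b, hb⟩ := exists_orthonormalBasis_head hu
  have := card_le_of_separated_of_box b (Fin.cons (2 * R) fun _ => R * θ) hh0 hsh (by
    intro i; refine Fin.cases ?_ (fun j => ?_) i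
    · simp only [Fin.cons_zero]; nlinarith
    · simp only [Fin.cons_succ]; linarith) X hX (by
    intro x hx i; refine Fin.cases ?_ (fun j => ?_) i
    · simp only [Fin.cons_zero]
      refine (abs_real_inner_le_norm _ _).trans ?_
      rw [b.orthonormal.1]; linarith [hR x hx]
    · simp only [Fin.cons_succ]
      have h2 : ⟪b j.succ, u⟫ = 0 := by
        rw [← hb]; exact b.orthonormal.2 (Fin.succ_ne_zero j)
      have h3 : ⟪b j.succ, x⟫ = ‖x‖ * ⟪b j.succ, dir x - u⟫ := by
        rw [inner_sub_right, h2, sub_zero, ← inner_smul_right, norm_smul_dir]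
      rw [h3, abs_mul, abs_norm]
      refine mul_le_mul (hR x hx) ?_ (abs_nonneg _) hR0.le
      refine (abs_real_inner_le_norm _ _).trans ?_
      rw [b.orthonormal.1, one_mul]; exact hdir x hx)
  refine this.trans (le_of_eq ?_)
  rw [Fin.prod_univ_succ]
  simp only [Fin.cons_zero, Fin.cons_succ, Finset.prod_const, Finset.card_univ, Fintype.card_fin]
  rw [show 5 * (R * θ) / h = 5 / h * (R * θ) by ring, mul_pow, mul_pow]
  ring

theorem exists_sum_cone_le (r : ℕ) {r₁ : ℝ} (hr₁ : 0 < r₁) (hr₁' : r₁ ≤ 1) :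
    ∃ C > (0 : ℝ), ∀ (u : Vec (r + 2)) (R θ : ℝ) (X : Finset (Vec (r + 2))), ‖u‖ = 1 →
    0 < R → 0 < θ → θ ≤ 2 → (∀ x ∈ X, ∀ y ∈ X, x ≠ y → r₁ ≤ ‖x - y‖) → (∀ x ∈ X, ‖x‖ ≤ R) →
    (∀ x ∈ X, ‖dir x - u‖ ≤ θ) → (∀ x ∈ X, 1 ≤ ‖x‖ * θ) →
    ∑ x ∈ X, (‖x‖ ^ (r + 1))⁻¹ ≤ C * R * θ ^ (r + 1) := by
  obtain ⟨C, hC, h⟩ := exists_card_le_of_cone r hr₁ hr₁'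
  refine ⟨2 * (C * 2 ^ (r + 1)), by positivity, ?_⟩
  intro u R θ X hu hR hθ hθ2 hX hXR hdir hX1
  obtain ⟨k, hk⟩ := pow_unbounded_of_one_lt (R * θ) (one_lt_two (α := ℝ))
  induction k generalizing R X with
  | zero =>
    have : X = ∅ := by
      by_contra hne
      obtain ⟨x, hx⟩ := Finset.nonempty_iff_ne_empty.2 hne
      have := mul_le_mul_of_nonneg_right (hXR x hx) hθ.le
      simp only [pow_zero] at hk
      linarith [hX1 x hx]
    rw [this, Finset.sum_empty]; positivity
  | succ k ih =>
    rw [← Finset.sum_filter_add_sum_filter_not X (fun x => ‖x‖ ≤ R / 2)]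
    have e1 := ih (R / 2) (X.filter fun x => ‖x‖ ≤ R / 2) (by positivity)
      (fun x hx y hy => hX x (Finset.mem_filter.1 hx).1 y (Finset.mem_filter.1 hy).1)
      (fun x hx => (Finset.mem_filter.1 hx).2) (fun x hx => hdir x (Finset.mem_filter.1 hx).1)
      (fun x hx => hX1 x (Finset.mem_filter.1 hx).1) (by rw [pow_succ] at hk; linarith)
    have e2 : ∑ x ∈ X.filter (fun x => ¬ ‖x‖ ≤ R / 2), (‖x‖ ^ (r + 1))⁻¹ ≤
        C * 2 ^ (r + 1) * R * θ ^ (r + 1) := by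
      rcases (X.filter fun x => ¬ ‖x‖ ≤ R / 2).eq_empty_or_nonempty with he | ⟨x₀, hx₀⟩
      · rw [he, Finset.sum_empty]; positivity
      have hRθ : 1 ≤ R * θ := by
        have hx := (Finset.mem_filter.1 hx₀).1
        have := mul_le_mul_of_nonneg_right (hXR x₀ hx) hθ.le
        linarith [hX1 x₀ hx]
      have e3 := h u R θ (X.filter fun x => ¬ ‖x‖ ≤ R / 2) hu hR hθ2 hRθ
        (fun x hx y hy => hX x (Finset.mem_filter.1 hx).1 y (Finset.mem_filter.1 hy).1)
        (fun x hx => hXR x (Finset.mem_filter.1 hx).1)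
        (fun x hx => hdir x (Finset.mem_filter.1 hx).1)
      calc _ ≤ ∑ x ∈ X.filter (fun x => ¬ ‖x‖ ≤ R / 2), ((R / 2) ^ (r + 1))⁻¹ := by
            refine Finset.sum_le_sum fun x hx => ?_
            have := (Finset.mem_filter.1 hx).2
            gcongr
            linarith
        _ ≤ C * R ^ (r + 2) * θ ^ (r + 1) * ((R / 2) ^ (r + 1))⁻¹ := by
            rw [Finset.sum_const, nsmul_eq_mul]; gcongr
        _ = _ := by
            rw [div_pow, inv_div]; field_simp; ring
    calc _ ≤ _ := add_le_add e1 e2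
      _ = _ := by ring

theorem exists_sum_annulus_le (r : ℕ) {r₁ : ℝ} (hr₁ : 0 < r₁) (hr₁' : r₁ ≤ 1) :
    ∃ C > (0 : ℝ), ∀ (u : Vec (r + 2)) (R γ θ : ℝ) (X : Finset (Vec (r + 2))), ‖u‖ = 1 →
    0 < R → 0 < γ → 0 < θ → θ ≤ 2 → (∀ x ∈ X, ∀ y ∈ X, x ≠ y → r₁ ≤ ‖x - y‖) →
    (∀ x ∈ X, ‖x‖ ≤ R) → (∀ x ∈ X, γ ≤ ‖dir x - u‖) →
    (∀ x ∈ X, ‖dir x - u‖ ≤ θ) → (∀ x ∈ X, 1 ≤ ‖x‖ * ‖dir x - u‖) →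
    ∑ x ∈ X, (‖x‖ ^ (r + 1))⁻¹ * (‖dir x - u‖ ^ r)⁻¹ ≤ C * R * θ := by
  obtain ⟨C, hC, h⟩ := exists_sum_cone_le r hr₁ hr₁'
  refine ⟨2 * (C * 2 ^ r), by positivity, ?_⟩
  intro u R γ θ X hu hR hγ hθ hθ2 hX hXR hXγ hdir hX1
  obtain ⟨k, hk⟩ := pow_unbounded_of_one_lt (θ / γ) (one_lt_two (α := ℝ))
  induction k generalizing θ X with
  | zero =>
    have : X = ∅ := by
      by_contra hne
      obtain ⟨x, hx⟩ := Finset.nonempty_iff_ne_empty.2 hne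
      rw [pow_zero, div_lt_one hγ] at hk
      linarith [hXγ x hx, hdir x hx]
    rw [this, Finset.sum_empty]; positivity
  | succ k ih =>
    rw [← Finset.sum_filter_add_sum_filter_not X (fun x => ‖dir x - u‖ ≤ θ / 2)]
    have e1 := ih (θ / 2) (X.filter fun x => ‖dir x - u‖ ≤ θ / 2) (by positivity) (by linarith)
      (fun x hx y hy => hX x (Finset.mem_filter.1 hx).1 y (Finset.mem_filter.1 hy).1)
      (fun x hx => hXR x (Finset.mem_filter.1 hx).1)
      (fun x hx => hXγ x (Finset.mem_filter.1 hx).1)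
      (fun x hx => (Finset.mem_filter.1 hx).2)
      (fun x hx => hX1 x (Finset.mem_filter.1 hx).1) (by
        rw [pow_succ] at hk; rw [div_right_comm]; linarith)
    have e3 := h u R θ (X.filter fun x => ¬ ‖dir x - u‖ ≤ θ / 2) hu hR hθ hθ2
      (fun x hx y hy => hX x (Finset.mem_filter.1 hx).1 y (Finset.mem_filter.1 hy).1)
      (fun x hx => hXR x (Finset.mem_filter.1 hx).1)
      (fun x hx => hdir x (Finset.mem_filter.1 hx).1)
      (fun x hx => (hX1 x (Finset.mem_filter.1 hx).1).trans
        (mul_le_mul_of_nonneg_left (hdir x (Finset.mem_filter.1 hx).1) (norm_nonneg _)))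
    have e2 : ∑ x ∈ X.filter (fun x => ¬ ‖dir x - u‖ ≤ θ / 2),
        (‖x‖ ^ (r + 1))⁻¹ * (‖dir x - u‖ ^ r)⁻¹ ≤ C * 2 ^ r * R * θ := by
      calc _ ≤ ∑ x ∈ X.filter (fun x => ¬ ‖dir x - u‖ ≤ θ / 2),
            (‖x‖ ^ (r + 1))⁻¹ * ((θ / 2) ^ r)⁻¹ := by
            refine Finset.sum_le_sum fun x hx => ?_
            have := (Finset.mem_filter.1 hx).2
            gcongr
            linarith
        _ ≤ C * R * θ ^ (r + 1) * ((θ / 2) ^ r)⁻¹ := by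
            rw [← Finset.sum_mul]; gcongr
        _ = _ := by
            rw [div_pow, inv_div]; field_simp; ring
    calc _ ≤ _ := add_le_add e1 e2
      _ = _ := by ring

theorem exists_card_le_of_norm_le (r : ℕ) {r₁ : ℝ} (hr₁ : 0 < r₁) (hr₁' : r₁ ≤ 1) :
    ∃ C > (0 : ℝ), ∀ (R : ℝ) (X : Finset (Vec (r + 2))), 1 ≤ R →
    (∀ x ∈ X, ∀ y ∈ X, x ≠ y → r₁ ≤ ‖x - y‖) → (∀ x ∈ X, ‖x‖ ≤ R) →
    (X.card : ℝ) ≤ C * R ^ (r + 2) := by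
  set s := √((r + 2 : ℕ) : ℝ) with hs
  have hs1 : 1 ≤ s := by
    rw [hs, Real.one_le_sqrt]; push_cast; linarith [(Nat.cast_nonneg r : (0 : ℝ) ≤ r)]
  have hs0 : 0 < s := by linarith
  set h := r₁ / (2 * s) with hh
  have hh0 : 0 < h := by positivity
  have hh1 : h ≤ 1 := by rw [hh, div_le_one (by positivity)]; linarith
  have hsh : s * h < r₁ := by
    have : s * h = r₁ / 2 := by rw [hh]; field_simp
    linarith
  refine ⟨(5 / h) ^ (r + 2), by positivity, ?_⟩
  intro R X hR hX hXR
  have b := EuclideanSpace.basisFun (Fin (r + 2)) ℝ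
  have := card_le_of_separated_of_box b (fun _ => R) hh0 hsh (fun _ => by linarith) X hX (by
    intro x hx i
    refine (abs_real_inner_le_norm _ _).trans ?_
    rw [b.orthonormal.1, one_mul]; exact hXR x hx)
  refine this.trans (le_of_eq ?_)
  simp only [Finset.prod_const, Finset.card_univ, Fintype.card_fin]
  rw [← mul_pow]; congr 1; ring

theorem exists_sum_inv_norm_pow_mul_le (r : ℕ) {r₁ : ℝ} (hr₁ : 0 < r₁) (hr₁' : r₁ ≤ 1) :
    ∃ C > (0 : ℝ), ∀ (u : Vec (r + 2)) (R γ : ℝ) (X : Finset (Vec (r + 2))), ‖u‖ = 1 →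
    0 < R → 0 < γ → γ ≤ 1 → (∀ x ∈ X, ∀ y ∈ X, x ≠ y → r₁ ≤ ‖x - y‖) →
    (∀ x ∈ X, r₁ ≤ ‖x‖) → (∀ x ∈ X, ‖x‖ ≤ R) → (∀ x ∈ X, γ ≤ ‖dir x - u‖) →
    ∑ x ∈ X, (‖x‖ ^ (r + 1))⁻¹ * (‖dir x - u‖ ^ r)⁻¹ ≤ C * (R + (γ ^ (2 * r + 2))⁻¹) := by
  obtain ⟨C, hC, h⟩ := exists_sum_annulus_le r hr₁ hr₁'
  obtain ⟨C', hC', h'⟩ := exists_card_le_of_norm_le r hr₁ hr₁'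
  refine ⟨2 * C + C' * (r₁ ^ (r + 1))⁻¹, by positivity, ?_⟩
  intro u R γ X hu hR hγ hγ1 hX hXr hXR hXγ
  rw [← Finset.sum_filter_add_sum_filter_not X (fun x => 1 ≤ ‖x‖ * ‖dir x - u‖)]
  have e1 := h u R γ 2 (X.filter fun x => 1 ≤ ‖x‖ * ‖dir x - u‖) hu hR hγ (by norm_num) le_rfl
    (fun x hx y hy => hX x (Finset.mem_filter.1 hx).1 y (Finset.mem_filter.1 hy).1)
    (fun x hx => hXR x (Finset.mem_filter.1 hx).1)
    (fun x hx => hXγ x (Finset.mem_filter.1 hx).1)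
    (fun x hx => by
      have hx0 : x ≠ 0 := norm_pos_iff.1 (hr₁.trans_le (hXr x (Finset.mem_filter.1 hx).1))
      refine (norm_sub_le _ _).trans ?_
      rw [norm_dir hx0, hu]; norm_num)
    (fun x hx => (Finset.mem_filter.1 hx).2)
  have e3 := h' (1 / γ) (X.filter fun x => ¬ 1 ≤ ‖x‖ * ‖dir x - u‖)
    ((one_le_div hγ).2 hγ1)
    (fun x hx y hy => hX x (Finset.mem_filter.1 hx).1 y (Finset.mem_filter.1 hy).1)
    (fun x hx => by
      obtain ⟨hx1, hx2⟩ := Finset.mem_filter.1 hx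
      rw [le_div_iff₀ hγ]
      have := mul_le_mul_of_nonneg_left (hXγ x hx1) (norm_nonneg x)
      linarith)
  have e2 : ∑ x ∈ X.filter (fun x => ¬ 1 ≤ ‖x‖ * ‖dir x - u‖),
      (‖x‖ ^ (r + 1))⁻¹ * (‖dir x - u‖ ^ r)⁻¹ ≤ C' * (r₁ ^ (r + 1))⁻¹ * (γ ^ (2 * r + 2))⁻¹ := by
    calc _ ≤ ∑ x ∈ X.filter (fun x => ¬ 1 ≤ ‖x‖ * ‖dir x - u‖),
          (r₁ ^ (r + 1))⁻¹ * (γ ^ r)⁻¹ := by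
          refine Finset.sum_le_sum fun x hx => ?_
          obtain ⟨hx1, hx2⟩ := Finset.mem_filter.1 hx
          have := hXr x hx1
          have := hXγ x hx1
          gcongr
      _ ≤ C' * (1 / γ) ^ (r + 2) * ((r₁ ^ (r + 1))⁻¹ * (γ ^ r)⁻¹) := by
          rw [Finset.sum_const, nsmul_eq_mul]; gcongr
      _ = _ := by
          rw [one_div, inv_pow, show 2 * r + 2 = (r + 2) + r by ring, pow_add γ (r + 2) r, mul_inv]
          ring
  have e4 : 0 < (r₁ ^ (r + 1))⁻¹ := by positivity
  have e5 : 0 < (γ ^ (2 * r + 2))⁻¹ := by positivity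
  nlinarith [mul_pos hC e5, mul_pos (mul_pos hC' e4) hR]

theorem exists_sum_inv_norm_pow_le (r : ℕ) {r₁ : ℝ} (hr₁ : 0 < r₁) (hr₁' : r₁ ≤ 1) :
    ∃ C > (0 : ℝ), ∀ (R : ℝ) (X : Finset (Vec (r + 2))), 0 < R →
    (∀ x ∈ X, ∀ y ∈ X, x ≠ y → r₁ ≤ ‖x - y‖) →
    (∀ x ∈ X, r₁ ≤ ‖x‖) → (∀ x ∈ X, ‖x‖ ≤ R) →
    ∑ x ∈ X, (‖x‖ ^ (r + 1))⁻¹ ≤ C * (R + 1) := by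
  obtain ⟨C, hC, h⟩ := exists_sum_inv_norm_pow_mul_le r hr₁ hr₁'
  refine ⟨2 * (2 ^ r * C), by positivity, ?_⟩
  intro R X hR hX hXr hXR
  set u : Vec (r + 2) := EuclideanSpace.basisFun (Fin (r + 2)) ℝ 0 with hu
  have hu1 : ‖u‖ = 1 := (EuclideanSpace.basisFun (Fin (r + 2)) ℝ).orthonormal.1 0
  have key : ∀ u : Vec (r + 2), ‖u‖ = 1 → ∀ Y ⊆ X, (∀ x ∈ Y, 1 ≤ ‖dir x - u‖) →
      ∑ x ∈ Y, (‖x‖ ^ (r + 1))⁻¹ ≤ 2 ^ r * C * (R + 1) := by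
    intro u hu Y hY h1
    have e1 := h u R 1 Y hu hR one_pos le_rfl (fun x hx y hy => hX x (hY hx) y (hY hy))
      (fun x hx => hXr x (hY hx)) (fun x hx => hXR x (hY hx)) h1
    simp only [one_pow, inv_one] at e1
    calc _ ≤ ∑ x ∈ Y, 2 ^ r * ((‖x‖ ^ (r + 1))⁻¹ * (‖dir x - u‖ ^ r)⁻¹) := by
          refine Finset.sum_le_sum fun x hx => ?_
          have hx0 : x ≠ 0 := norm_pos_iff.1 (hr₁.trans_le (hXr x (hY hx)))
          have h2 : ‖dir x - u‖ ≤ 2 := by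
            refine (norm_sub_le _ _).trans ?_
            rw [norm_dir hx0, hu]; norm_num
          have h3 : 0 < ‖dir x - u‖ := by linarith [h1 x hx]
          have h4 : 1 ≤ 2 ^ r * (‖dir x - u‖ ^ r)⁻¹ := by
            rw [← div_eq_mul_inv, one_le_div (by positivity)]; gcongr
          have h5 : 0 ≤ (‖x‖ ^ (r + 1))⁻¹ := by positivity
          nlinarith
      _ ≤ 2 ^ r * (C * (R + 1)) := by rw [← Finset.mul_sum]; gcongr
      _ = _ := by ring
  rw [← Finset.sum_filter_add_sum_filter_not X (fun x => 1 ≤ ‖dir x - u‖)]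
  have e1 := key u hu1 _ (Finset.filter_subset _ _) (fun x hx => (Finset.mem_filter.1 hx).2)
  have e2 := key (-u) (by rwa [norm_neg]) (X.filter fun x => ¬ 1 ≤ ‖dir x - u‖)
    (Finset.filter_subset _ _) (fun x hx => by
      have h1 := (Finset.mem_filter.1 hx).2
      have h2 : (2 : ℝ) = ‖(dir x - -u) - (dir x - u)‖ := by
        rw [show (dir x - -u) - (dir x - u) = (2 : ℝ) • u by rw [two_smul]; abel, norm_smul, hu1]
        norm_num
      have h3 := norm_sub_le (dir x - -u) (dir x - u)
      linarith)
  linarith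

/-! ### The lattice and the geometry of collisions -/

theorem sub_mem_lattice {d : ℕ} {M₀ : Matrix (Fin d) (Fin d) ℝ} {x y : Vec d}
    (hx : x ∈ lattice M₀) (hy : y ∈ lattice M₀) : x - y ∈ lattice M₀ := by
  obtain ⟨m, hm⟩ := hx
  obtain ⟨n, hn⟩ := hy
  refine ⟨m - n, fun i => ?_⟩
  rw [PiLp.sub_apply, hm, hn, ← Finset.sum_sub_distrib]
  refine Finset.sum_congr rfl fun j _ => ?_
  rw [Pi.sub_apply]; push_cast; ring

theorem countable_lattice {d : ℕ} (M₀ : Matrix (Fin d) (Fin d) ℝ) : (lattice M₀).Countable := by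
  have : lattice M₀ ⊆ range fun m : Fin d → ℤ =>
      (WithLp.toLp 2 fun i => ∑ j, (m j : ℝ) * M₀ j i : Vec d) := by
    rintro x ⟨m, hm⟩
    exact ⟨m, by ext i; exact (hm i).symm⟩
  exact (countable_range _).mono this

theorem exists_lattice_separation {d : ℕ} {M₀ : Matrix (Fin d) (Fin d) ℝ} (hM₀ : M₀.det = 1) :
    ∃ r₁ > (0 : ℝ), ∀ x ∈ lattice M₀, ∀ y ∈ lattice M₀, x ≠ y → r₁ ≤ ‖x - y‖ := by
  have hunit : IsUnit M₀.det := by rw [hM₀]; exact isUnit_one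
  set C : ℝ := 1 + ∑ i, ∑ j, |M₀⁻¹ i j| with hC
  have hC0 : 0 < C := by
    have : 0 ≤ ∑ i, ∑ j, |M₀⁻¹ i j| :=
      Finset.sum_nonneg fun i _ => Finset.sum_nonneg fun j _ => abs_nonneg _
    linarith
  refine ⟨C⁻¹, by positivity, fun x hx y hy hxy => ?_⟩
  obtain ⟨m, hm⟩ := sub_mem_lattice hx hy
  set z := x - y with hz
  have hz0 : z ≠ 0 := sub_ne_zero.2 hxy
  have hmz : (fun j => (m j : ℝ)) = Matrix.vecMul (fun i => z i) M₀⁻¹ := by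
    have : (fun i => z i) = Matrix.vecMul (fun j => (m j : ℝ)) M₀ := by
      ext i; rw [hm]; rfl
    rw [this, Matrix.vecMul_vecMul, Matrix.mul_nonsing_inv _ hunit, Matrix.vecMul_one]
  obtain ⟨j, hj⟩ : ∃ j, m j ≠ 0 := by
    by_contra! h0
    apply hz0
    ext i
    rw [hm]
    simp [h0]
  have h1 : (1 : ℝ) ≤ |(m j : ℝ)| := by
    rw [← Int.cast_abs]; exact_mod_cast Int.one_le_abs hj
  have h2 : (m j : ℝ) = ∑ i, z i * M₀⁻¹ i j := congrFun hmz j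
  have h3 : |(m j : ℝ)| ≤ ‖z‖ * C := by
    rw [h2]
    refine (Finset.abs_sum_le_sum_abs _ _).trans ?_
    calc ∑ i, |z i * M₀⁻¹ i j| ≤ ∑ i, ‖z‖ * |M₀⁻¹ i j| := by
          refine Finset.sum_le_sum fun i _ => ?_
          rw [abs_mul]
          gcongr
          exact PiLp.norm_apply_le z i
      _ = ‖z‖ * ∑ i, |M₀⁻¹ i j| := by rw [Finset.mul_sum]
      _ ≤ ‖z‖ * C := by
          gcongr
          have : ∑ i, |M₀⁻¹ i j| ≤ ∑ i, ∑ j, |M₀⁻¹ i j| := Finset.sum_le_sum fun i _ =>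
            Finset.single_le_sum (f := fun j => |M₀⁻¹ i j|) (fun _ _ => abs_nonneg _)
              (Finset.mem_univ j)
          linarith
  rw [inv_le_iff_one_le_mul₀ hC0]
  linarith

theorem exists_point_separation {d : ℕ} {L : Set (Vec d)} {r₁ : ℝ} (hr₁ : 0 < r₁)
    (hL : ∀ x ∈ L, ∀ y ∈ L, x ≠ y → r₁ ≤ ‖x - y‖) (q : Vec d) :
    ∃ r > (0 : ℝ), ∀ y ∈ L, y ≠ q → r ≤ ‖y - q‖ := by
  by_cases h : ∃ y ∈ L, y ≠ q ∧ ‖y - q‖ < r₁ / 2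
  · obtain ⟨y, hy, hyq, hlt⟩ := h
    refine ⟨‖y - q‖, norm_pos_iff.2 (sub_ne_zero.2 hyq), fun z hz hzq => ?_⟩
    by_contra! hc
    have hne : z ≠ y := by rintro rfl; exact lt_irrefl _ hc
    have h1 := hL z hz y hy hne
    have h2 := norm_sub_le (z - q) (y - q)
    rw [sub_sub_sub_cancel_right] at h2
    linarith
  · push Not at h
    exact ⟨r₁ / 2, by positivity, h⟩

theorem collides_real {d : ℕ} {M₀ : Matrix (Fin d) (Fin d) ℝ} {ρ : ℝ} {q v : Vec d}
    (h : collides M₀ ρ q v) : ∃ t > (0 : ℝ), q + t • v ∉ Kset M₀ ρ := by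
  obtain ⟨t, ht, h⟩ := h
  exact ⟨t, by exact_mod_cast ht, by rwa [Nat.cast_smul_eq_nsmul]⟩

theorem collision_spec {d : ℕ} {M₀ : Matrix (Fin d) (Fin d) ℝ} {r₁ ρ : ℝ} (hρ : 0 < ρ)
    (hρr : 2 * ρ < r₁) (hL : ∀ x ∈ lattice M₀, ∀ y ∈ lattice M₀, x ≠ y → r₁ ≤ ‖x - y‖)
    {q v : Vec d} (hq : q ∈ Kset M₀ ρ) (hv : ‖v‖ = 1) 
    (hcol : ∃ t > (0 : ℝ), q + t • v ∉ Kset M₀ ρ) :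
    mColl M₀ ρ q v ∈ lattice M₀ ∧ 0 ≤ tau1 M₀ ρ q v ∧ ‖wColl M₀ ρ q v‖ = 1 ∧
      qColl M₀ ρ q v = mColl M₀ ρ q v + ρ • wColl M₀ ρ q v ∧ qColl M₀ ρ q v ∈ Kset M₀ ρ ∧
      ⟪v, wColl M₀ ρ q v⟫ < 0 ∧ ∃ t > (0 : ℝ), dist (q + t • v) (mColl M₀ ρ q v) < ρ := by
  set T := {t : ℝ | 0 < t ∧ q + t • v ∉ Kset M₀ ρ} with hT
  have hTne : T.Nonempty := by
    obtain ⟨t, ht, h⟩ := hcol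
    exact ⟨t, ht, h⟩
  have hTbdd : BddBelow T := ⟨0, fun t ht => ht.1.le⟩
  set τ := tau1 M₀ ρ q v with hτ
  have hτT : τ = sInf T := rfl
  have hτ0 : 0 ≤ τ := le_csInf hTne fun t ht => ht.1.le
  have hlt : ∀ t, 0 ≤ t → t < τ → q + t • v ∈ Kset M₀ ρ := by
    intro t ht htτ
    rcases ht.eq_or_lt with rfl | ht
    · simpa using hq
    · by_contra hc
      exact absurd (csInf_le hTbdd (show t ∈ T from ⟨ht, hc⟩)) (not_le.2 htτ)
  have hK : q + τ • v ∈ Kset M₀ ρ := by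
    rcases hτ0.eq_or_lt with h0 | h0
    · rw [← h0]; simpa using hq
    intro y hy
    have hcont : Continuous fun t : ℝ => dist (q + t • v) y := by fun_prop
    refine ge_of_tendsto ((hcont.tendsto τ).mono_left (nhdsWithin_le_nhds (s := Iio τ))) ?_
    filter_upwards [Ioo_mem_nhdsLT h0] with t ht
    exact hlt t ht.1.le ht.2 y hy
  have hdist : ∀ s t : ℝ, dist (q + s • v) (q + t • v) = |s - t| := by
    intro s t
    rw [dist_eq_norm, add_sub_add_left_eq_sub, ← sub_smul, norm_smul, hv, mul_one,
      Real.norm_eq_abs]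
  have happ : ∀ η > 0, ∃ t ∈ T, t < τ + η := fun η hη =>
    exists_lt_of_csInf_lt hTne (by rw [← hτT]; linarith)
  set η := r₁ - 2 * ρ with hη
  have hη0 : 0 < η := by rw [hη]; linarith
  have hbad : ∀ t ∈ T, ∃ y ∈ lattice M₀, dist (q + t • v) y < ρ := by
    rintro t ⟨-, ht⟩
    simpa [Kset] using ht
  obtain ⟨t₀, ht₀, ht₀η⟩ := happ η hη0
  obtain ⟨m, hm, hmt₀⟩ := hbad t₀ ht₀
  have hτt₀ : τ ≤ t₀ := csInf_le hTbdd ht₀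
  have huniq : ∀ t ∈ T, t < τ + η → dist (q + t • v) m < ρ := by
    intro t ht htη
    obtain ⟨y, hy, hyt⟩ := hbad t ht
    have hτt : τ ≤ t := csInf_le hTbdd ht
    by_cases hym : y = m
    · rwa [← hym]
    exfalso
    have h1 := hL y hy m hm hym
    rw [← dist_eq_norm] at h1
    have h2 := dist_triangle y (q + t • v) m
    have h3 := dist_triangle (q + t • v) (q + t₀ • v) m
    rw [hdist] at h3
    have h4 : |t - t₀| < η := by rw [abs_lt]; constructor <;> linarith
    linarith [dist_comm y (q + t • v)]
  have hle : dist (q + τ • v) m ≤ ρ := by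
    refine le_of_forall_pos_le_add fun e he => ?_
    obtain ⟨t, ht, hte⟩ := happ (min e η) (lt_min he hη0)
    have h1 := huniq t ht (hte.trans_le (by linarith [min_le_right e η]))
    have h2 := dist_triangle (q + τ • v) (q + t • v) m
    rw [hdist, abs_sub_comm, abs_of_nonneg (sub_nonneg.2 (show τ ≤ t from csInf_le hTbdd ht))] at h2
    linarith [min_le_left e η]
  have heq : dist (q + τ • v) m = ρ := le_antisymm hle (hK m hm)
  have hqc : qColl M₀ ρ q v = q + τ • v := rfl
  have hmc : mColl M₀ ρ q v = m := by
    have hs : mColl M₀ ρ q v ∈ lattice M₀ ∧ dist (qColl M₀ ρ q v) (mColl M₀ ρ q v) = ρ :=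
      Classical.epsilon_spec
        (p := fun y => y ∈ lattice M₀ ∧ dist (qColl M₀ ρ q v) y = ρ) ⟨m, hm, heq⟩
    by_contra hne
    have h1 := hL _ hs.1 m hm hne
    rw [← dist_eq_norm] at h1
    have h2 := dist_triangle (mColl M₀ ρ q v) (qColl M₀ ρ q v) m
    rw [dist_comm (mColl M₀ ρ q v) (qColl M₀ ρ q v), hs.2, hqc, heq] at h2
    linarith
  have hw : wColl M₀ ρ q v = ρ⁻¹ • (q + τ • v - m) := by rw [wColl, hmc, hqc]
  have hρw : q + τ • v = m + ρ • wColl M₀ ρ q v := by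
    rw [hw, smul_smul, mul_inv_cancel₀ hρ.ne', one_smul]; abel
  have hwn : ‖wColl M₀ ρ q v‖ = 1 := by
    rw [hw, norm_smul, ← dist_eq_norm, heq, norm_inv, Real.norm_eq_abs, abs_of_pos hρ,
      inv_mul_cancel₀ hρ.ne']
  refine ⟨hmc ▸ hm, hτ0, hwn, by rw [hqc, hmc, hρw], hqc ▸ hK, ?_, t₀, ht₀.1, hmc.symm ▸ hmt₀⟩
  have hτt : τ < t₀ := by
    refine lt_of_le_of_ne hτt₀ fun h => ?_
    rw [← h, heq] at hmt₀
    exact lt_irrefl _ hmt₀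
  have h1 : q + t₀ • v - m = ρ • wColl M₀ ρ q v + (t₀ - τ) • v := by
    rw [eq_sub_of_add_eq' hρw.symm, sub_smul]; abel
  rw [dist_eq_norm, h1] at hmt₀
  have h2 := norm_add_sq_real (ρ • wColl M₀ ρ q v) ((t₀ - τ) • v)
  rw [norm_smul, norm_smul, hwn, hv, inner_smul_left, inner_smul_right,
    real_inner_comm v, Real.norm_eq_abs, Real.norm_eq_abs, abs_of_pos hρ,
    abs_of_pos (sub_pos.2 hτt), mul_one, mul_one] at h2
  simp only [conj_trivial] at h2
  have h3 : ‖ρ • wColl M₀ ρ q v + (t₀ - τ) • v‖ ^ 2 < ρ ^ 2 := by gcongr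
  by_contra! h4
  have h5 : 0 ≤ ρ * ((t₀ - τ) * ⟪v, wColl M₀ ρ q v⟫) :=
    mul_nonneg hρ.le (mul_nonneg (sub_pos.2 hτt).le h4)
  nlinarith [sq_nonneg (t₀ - τ)]

/-- Scatterer centres visited by a trajectory that starts near `q₀`. -/
def centers {d : ℕ} (M₀ : Matrix (Fin d) (Fin d) ℝ) (ρ : ℝ) (q₀ : Vec d) (x : Vec d × Vec d) :
    ℕ → Vec d
  | 0 => q₀
  | n + 1 => mColl M₀ ρ (traj M₀ ρ x n).1 (traj M₀ ρ x n).2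

/-- Impact locations of a trajectory, with `w₀` the rescaled initial displacement. -/
def impacts {d : ℕ} (M₀ : Matrix (Fin d) (Fin d) ℝ) (ρ : ℝ) (w₀ : Vec d) (x : Vec d × Vec d) :
    ℕ → Vec d
  | 0 => w₀
  | n + 1 => wColl M₀ ρ (traj M₀ ρ x n).1 (traj M₀ ρ x n).2

/-- The relations between consecutive velocities `V`, impact locations `W` and scatterer
centres `M` along a trajectory with `N` collisions. -/
structure IsPath {d : ℕ} (ρ r B : ℝ) (N : ℕ) (V W M : ℕ → Vec d) : Prop where
  norm_V : ∀ k ≤ N, ‖V k‖ = 1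
  norm_W_zero : ‖W 0‖ ≤ B
  norm_W : ∀ k < N, ‖W (k + 1)‖ = 1
  flight : ∀ k < N, ∃ τ ≥ (0 : ℝ), M k + ρ • W k + τ • V k = M (k + 1) + ρ • W (k + 1)
  sep : ∀ k < N, r ≤ ‖M (k + 1) - M k‖
  reflect : ∀ k < N, V (k + 1) - V k = ‖V (k + 1) - V k‖ • W (k + 1)
  norm_reflect : ∀ k < N, ‖V (k + 1) - V k‖ = -2 * ⟪V k, W (k + 1)⟫

theorem isPath_of_hitsAll {d : ℕ} {M₀ : Matrix (Fin d) (Fin d) ℝ} {r ρ B : ℝ} {q₀ v₀ w₀ : Vec d}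
    {N : ℕ} (hρ : 0 < ρ) (hρr : 2 * ρ < r) (hB : 1 ≤ B) (hρB : ρ * (4 * B) ≤ r)
    (hL : ∀ x ∈ lattice M₀, ∀ y ∈ lattice M₀, x ≠ y → r ≤ ‖x - y‖)
    (hq : ∀ y ∈ lattice M₀, y ≠ q₀ → r ≤ ‖y - q₀‖) (hv : ‖v₀‖ = 1) (hw : ‖w₀‖ ≤ B)
    (hqL : q₀ ∈ lattice M₀ → ∀ t > (0 : ℝ), w₀ + t • v₀ ∉ ball (0 : Vec d) 1)
    (hN : ∀ k < N, ∃ t > (0 : ℝ), (traj M₀ ρ (q₀ + ρ • w₀, v₀) k).1 +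
      t • (traj M₀ ρ (q₀ + ρ • w₀, v₀) k).2 ∉ Kset M₀ ρ) :
    IsPath ρ r B N (fun k => (traj M₀ ρ (q₀ + ρ • w₀, v₀) k).2)
        (impacts M₀ ρ w₀ (q₀ + ρ • w₀, v₀)) (centers M₀ ρ q₀ (q₀ + ρ • w₀, v₀)) ∧
      (∀ k < N, centers M₀ ρ q₀ (q₀ + ρ • w₀, v₀) (k + 1) ∈ lattice M₀) ∧
      ∀ k < N, ‖centers M₀ ρ q₀ (q₀ + ρ • w₀, v₀) (k + 1) -
        centers M₀ ρ q₀ (q₀ + ρ • w₀, v₀) k‖ / 2 ≤ ‖seg M₀ ρ (q₀ + ρ • w₀, v₀) k‖ := by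
  set x := (q₀ + ρ • w₀, v₀) with hx
  set V : ℕ → Vec d := fun k => (traj M₀ ρ x k).2 with hV
  set W := impacts M₀ ρ w₀ x with hW
  set M := centers M₀ ρ q₀ x with hM
  have hinv : ∀ k ≤ N, (traj M₀ ρ x k).1 ∈ Kset M₀ ρ ∧ ‖V k‖ = 1 ∧
      (traj M₀ ρ x k).1 = M k + ρ • W k ∧ ‖W k‖ ≤ B ∧ (∀ y ∈ lattice M₀, y ≠ M k → r ≤ ‖y - M k‖) ∧
      (M k ∈ lattice M₀ → ∀ t > (0 : ℝ), ρ ≤ dist ((traj M₀ ρ x k).1 + t • V k) (M k)) := by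
    intro k
    induction k with
    | zero =>
      intro _
      refine ⟨?_, hv, rfl, hw, hq, ?_⟩
      · intro y hy
        change ρ ≤ dist (q₀ + ρ • w₀) y
        by_cases hyq : y = q₀
        · subst hyq
          have h1 : 1 ≤ ‖w₀‖ := by
            have hcont : Continuous fun t : ℝ => ‖w₀ + t • v₀‖ := by fun_prop
            have h2 : Tendsto (fun t : ℝ => ‖w₀ + t • v₀‖) (𝓝[>] 0) (𝓝 ‖w₀‖) := by
              have := (hcont.tendsto 0).mono_left (nhdsWithin_le_nhds (s := Ioi 0))
              simpa using this
            refine ge_of_tendsto h2 ?_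
            filter_upwards [self_mem_nhdsWithin] with t ht
            simpa using hqL hy t ht
          rw [dist_eq_norm, add_sub_cancel_left, norm_smul, Real.norm_eq_abs, abs_of_pos hρ]
          nlinarith
        · have h1 := hq y hy hyq
          rw [dist_comm, dist_eq_norm, ← sub_sub]
          have h2 := norm_sub_norm_le (y - q₀) (ρ • w₀)
          rw [norm_smul, Real.norm_eq_abs, abs_of_pos hρ] at h2
          nlinarith
      · intro hqm t ht
        change ρ ≤ dist (q₀ + ρ • w₀ + t • v₀) q₀
        have h1 := hqL hqm (t / ρ) (by positivity)
        rw [mem_ball_zero_iff, not_lt] at h1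
        have h2 : q₀ + ρ • w₀ + t • v₀ - q₀ = ρ • (w₀ + (t / ρ) • v₀) := by
          rw [smul_add, smul_smul, mul_div_cancel₀ _ hρ.ne']; abel
        rw [dist_eq_norm, h2, norm_smul, Real.norm_eq_abs, abs_of_pos hρ]
        nlinarith
    | succ k ih =>
      intro hk
      obtain ⟨hK, hVn, -, -, -, -⟩ := ih (by omega)
      obtain ⟨hm, -, hwn, hqw, hqK, hneg, -⟩ := collision_spec hρ hρr hL hK hVn (hN k (by omega))
      have hVk : V (k + 1) = V k - (2 * ⟪V k, W (k + 1)⟫) • W (k + 1) := rfl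
      have hwn' : ‖W (k + 1)‖ = 1 := hwn
      have hneg' : ⟪V k, W (k + 1)⟫ < 0 := hneg
      have hqw' : (traj M₀ ρ x (k + 1)).1 = M (k + 1) + ρ • W (k + 1) := hqw
      have hVn1 : ‖V (k + 1)‖ = 1 := by
        have h1 := norm_sub_sq_real (V k) ((2 * ⟪V k, W (k + 1)⟫) • W (k + 1))
        rw [← hVk, norm_smul, hwn', hVn, inner_smul_right, mul_one, Real.norm_eq_abs,
          sq_abs] at h1
        have h2 : ‖V (k + 1)‖ ^ 2 = 1 := by rw [h1]; ring
        have h3 := norm_nonneg (V (k + 1))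
        nlinarith
      refine ⟨hqK, hVn1, hqw', hwn'.le.trans hB, fun y hy hne => hL y hy _ hm hne, ?_⟩
      intro _ t ht
      have h1 : ⟪V (k + 1), W (k + 1)⟫ = -⟪V k, W (k + 1)⟫ := by
        rw [hVk, inner_sub_left, inner_smul_left, real_inner_self_eq_norm_sq, hwn']
        simp only [conj_trivial]; ring
      rw [hqw', dist_eq_norm, show M (k + 1) + ρ • W (k + 1) + t • V (k + 1) - M (k + 1) =
        ρ • W (k + 1) + t • V (k + 1) by abel]
      have h2 := norm_add_sq_real (ρ • W (k + 1)) (t • V (k + 1))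
      rw [norm_smul, norm_smul, hwn', hVn1, inner_smul_left, inner_smul_right, real_inner_comm,
        h1, mul_one, mul_one, Real.norm_eq_abs, Real.norm_eq_abs, sq_abs, sq_abs] at h2
      simp only [conj_trivial] at h2
      have h3 : 0 ≤ ρ * (t * -⟪V k, W (k + 1)⟫) :=
        mul_nonneg hρ.le (mul_nonneg ht.le (by linarith))
      have h4 : ρ ^ 2 ≤ ‖ρ • W (k + 1) + t • V (k + 1)‖ ^ 2 := by nlinarith [sq_nonneg t]
      exact (sq_le_sq₀ hρ.le (norm_nonneg _)).1 h4
  have hstep : ∀ k < N, M (k + 1) ∈ lattice M₀ ∧ 0 ≤ tauN M₀ ρ x k ∧ ‖W (k + 1)‖ = 1 ∧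
      M k + ρ • W k + tauN M₀ ρ x k • V k = M (k + 1) + ρ • W (k + 1) ∧
      ⟪V k, W (k + 1)⟫ < 0 ∧ r ≤ ‖M (k + 1) - M k‖ := by
    intro k hk
    obtain ⟨hK, hVn, hqk, -, hsep, hray⟩ := hinv k hk.le
    obtain ⟨hm, hτ, hwn, hqw, -, hneg, t, ht, hdist⟩ :=
      collision_spec hρ hρr hL hK hVn (hN k hk)
    refine ⟨hm, hτ, hwn, ?_, hneg, hsep _ hm fun heq => ?_⟩
    · rw [← hqk]; exact hqw
    · have heq' : mColl M₀ ρ (traj M₀ ρ x k).1 (traj M₀ ρ x k).2 = M k := heq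
      rw [heq'] at hm hdist
      exact absurd hdist (not_lt.2 (hray hm t ht))
  have hVd : ∀ k, V (k + 1) - V k = (-2 * ⟪V k, W (k + 1)⟫) • W (k + 1) := by
    intro k
    have hVk : V (k + 1) = V k - (2 * ⟪V k, W (k + 1)⟫) • W (k + 1) := rfl
    rw [hVk, sub_sub_cancel_left, ← neg_smul, neg_mul]
  have hVdn : ∀ k < N, ‖V (k + 1) - V k‖ = -2 * ⟪V k, W (k + 1)⟫ := by
    intro k hk
    obtain ⟨-, -, hwn, -, hneg, -⟩ := hstep k hk
    rw [hVd, norm_smul, hwn, mul_one, Real.norm_eq_abs, abs_of_pos (by linarith)]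
  refine ⟨⟨fun k hk => (hinv k hk).2.1, hw, fun k hk => (hstep k hk).2.2.1,
    fun k hk => ⟨_, (hstep k hk).2.1, (hstep k hk).2.2.2.1⟩,
    fun k hk => (hstep k hk).2.2.2.2.2, fun k hk => by rw [hVdn k hk, ← hVd], hVdn⟩,
    fun k hk => (hstep k hk).1, fun k hk => ?_⟩
  obtain ⟨-, hτ, hwn, hfl, -, hsep⟩ := hstep k hk
  obtain ⟨-, hVn, -, hWB, -⟩ := hinv k hk.le
  have h1 : M (k + 1) - M k = ρ • W k - ρ • W (k + 1) + seg M₀ ρ x k := by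
    have : seg M₀ ρ x k = tauN M₀ ρ x k • V k := rfl
    rw [this, eq_sub_of_add_eq' hfl]; abel
  have h2 := norm_add_le (ρ • W k - ρ • W (k + 1)) (seg M₀ ρ x k)
  have h3 := norm_sub_le (ρ • W k) (ρ • W (k + 1))
  rw [← h1] at h2
  rw [norm_smul, norm_smul, hwn, Real.norm_eq_abs, abs_of_pos hρ] at h3
  nlinarith

/-! ### Expansion along pairs of trajectories -/

theorem mul_norm_sub_le_of_norm_eq_one {E : Type*} [NormedAddCommGroup E] [InnerProductSpace ℝ E]
    {v v' : E} {a a' c : ℝ} (hv : ‖v‖ = 1) (hv' : ‖v'‖ = 1) (hc : 0 ≤ c) (ha : c ≤ a)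
    (ha' : c ≤ a') : c * ‖v - v'‖ ≤ ‖a • v - a' • v'‖ := by
  have h1 := norm_sub_sq_real (a • v) (a' • v')
  have h2 := norm_sub_sq_real v v'
  rw [norm_smul, norm_smul, hv, hv', inner_smul_left, inner_smul_right, mul_one, mul_one,
    Real.norm_eq_abs, Real.norm_eq_abs, sq_abs, sq_abs] at h1
  simp only [conj_trivial] at h1
  rw [hv, hv'] at h2
  have h3 : ‖a • v - a' • v'‖ ^ 2 = (a - a') ^ 2 + a * a' * ‖v - v'‖ ^ 2 := by
    rw [h1, h2]; ring
  have h4 : c * c ≤ a * a' := mul_le_mul ha ha' hc (hc.trans ha)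
  have h5 : (c * ‖v - v'‖) ^ 2 ≤ ‖a • v - a' • v'‖ ^ 2 := by
    rw [h3, mul_pow]
    nlinarith [sq_nonneg (a - a'), mul_le_mul_of_nonneg_right h4 (sq_nonneg ‖v - v'‖)]
  exact (sq_le_sq₀ (by positivity) (norm_nonneg _)).1 h5

theorem norm_sub_le_of_smul_norm {E : Type*} [NormedAddCommGroup E] [NormedSpace ℝ E]
    {x y w w' : E} (hx : x = ‖x‖ • w) (hy : y = ‖y‖ • w') (hx0 : 0 < ‖x‖) (hw' : ‖w'‖ = 1) :
    ‖w - w'‖ ≤ 2 / ‖x‖ * ‖x - y‖ := by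
  have h1 : ‖x‖ • (w - w') = (x - y) + (‖y‖ - ‖x‖) • w' := by
    have h0 : x - y = ‖x‖ • w - ‖y‖ • w' := by rw [← hx, ← hy]
    rw [h0, smul_sub, sub_smul]; abel
  have h2 : ‖x‖ * ‖w - w'‖ ≤ ‖x - y‖ + ‖x - y‖ := by
    calc ‖x‖ * ‖w - w'‖ = ‖‖x‖ • (w - w')‖ := by rw [norm_smul, norm_norm]
      _ ≤ ‖x - y‖ + ‖(‖y‖ - ‖x‖) • w'‖ := by rw [h1]; exact norm_add_le _ _
      _ ≤ ‖x - y‖ + ‖x - y‖ := by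
        gcongr
        rw [norm_smul, hw', mul_one, Real.norm_eq_abs, abs_sub_comm]
        exact abs_norm_sub_norm_le x y
  rw [div_mul_eq_mul_div, le_div_iff₀ hx0]
  linarith

namespace IsPath

variable {d : ℕ} {ρ r B : ℝ} {N : ℕ} {V W M V' W' M' : ℕ → Vec d}

theorem norm_W_le (h : IsPath ρ r B N V W M) (hB : 1 ≤ B) {k : ℕ} (hk : k ≤ N) : ‖W k‖ ≤ B := by
  cases k with
  | zero => exact h.norm_W_zero
  | succ k => exact (h.norm_W k (by omega)).le.trans hB

theorem exists_flight (h : IsPath ρ r B N V W M) (hρ : 0 < ρ) (hB : 1 ≤ B) (hρB : ρ * (4 * B) ≤ r)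
    {k : ℕ} (hk : k < N) : ∃ a, ‖M (k + 1) - M k‖ / 2 ≤ a ∧
      a • V k = (M (k + 1) - M k) + ρ • (W (k + 1) - W k) := by
  obtain ⟨a, ha, hfl⟩ := h.flight k hk
  have h1 : a • V k = (M (k + 1) - M k) + ρ • (W (k + 1) - W k) := by
    rw [eq_sub_of_add_eq' hfl, smul_sub]; abel
  refine ⟨a, ?_, h1⟩
  have h2 : M (k + 1) - M k = a • V k - ρ • (W (k + 1) - W k) := by rw [h1]; abel
  have h3 : ‖M (k + 1) - M k‖ ≤ a + ρ * (2 * B) := by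
    rw [h2]
    refine (norm_sub_le _ _).trans ?_
    rw [norm_smul, norm_smul, h.norm_V k hk.le, Real.norm_eq_abs, Real.norm_eq_abs,
      abs_of_nonneg ha, abs_of_pos hρ, mul_one]
    gcongr
    refine (norm_sub_le _ _).trans ?_
    linarith [h.norm_W_le hB hk.le, h.norm_W_le hB (k := k + 1) hk]
  linarith [h.sep k hk]

theorem norm_V_sub_dir_le (h : IsPath ρ r B N V W M) (hρ : 0 < ρ) (hB : 1 ≤ B)
    (hr : 0 < r) (hρB : ρ * (4 * B) ≤ r) {k : ℕ} (hk : k < N) :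
    ‖V k - dir (M (k + 1) - M k)‖ ≤ 4 * ρ * B / r := by
  obtain ⟨a, ha, hfl⟩ := h.exists_flight hρ hB hρB hk
  have hn := h.sep k hk
  have hn0 : 0 < ‖M (k + 1) - M k‖ := hr.trans_le hn
  have h1 := mul_norm_sub_le_of_norm_eq_one (h.norm_V k hk.le) (norm_dir (norm_pos_iff.1 hn0))
    (by positivity) ha (a' := ‖M (k + 1) - M k‖) (by linarith)
  rw [norm_smul_dir, hfl, add_sub_cancel_left, norm_smul, Real.norm_eq_abs, abs_of_pos hρ] at h1
  have h2 : ‖W (k + 1) - W k‖ ≤ 2 * B := by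
    refine (norm_sub_le _ _).trans ?_
    linarith [h.norm_W_le hB hk.le, h.norm_W_le hB (k := k + 1) hk]
  have h3 : r * ‖V k - dir (M (k + 1) - M k)‖ ≤
      ‖M (k + 1) - M k‖ * ‖V k - dir (M (k + 1) - M k)‖ := by gcongr
  have h4 : ρ * ‖W (k + 1) - W k‖ ≤ ρ * (2 * B) := by gcongr
  rw [le_div_iff₀ hr]
  linarith

theorem abs_norm_sub_norm_dir_le (h : IsPath ρ r B N V W M) (hρ : 0 < ρ) (hB : 1 ≤ B)
    (hr : 0 < r) {γ : ℝ} (hγ : γ ≤ 1) (hρB : ρ * (16 * B) ≤ r * γ) {k : ℕ} (hk : k + 1 < N) :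
    |‖V (k + 1) - V k‖ -
      ‖dir (M (k + 2) - M (k + 1)) - dir (M (k + 1) - M k)‖| ≤ γ / 2 := by
  have hρB' : ρ * (4 * B) ≤ r := by nlinarith [mul_pos hρ (by linarith : 0 < B)]
  have h1 := h.norm_V_sub_dir_le hρ hB hr hρB' hk
  have h2 := h.norm_V_sub_dir_le hρ hB hr hρB' (k := k) (by omega)
  have h3 : 4 * ρ * B / r ≤ γ / 4 := by rw [div_le_iff₀ hr]; linarith
  refine (abs_norm_sub_norm_le _ _).trans ?_
  rw [sub_sub_sub_comm]
  refine (norm_sub_le _ _).trans ?_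
  linarith

theorem pair_expansion (h : IsPath ρ r B N V W M) (h' : IsPath ρ r B N V' W' M') (hρ : 0 < ρ)
    (hB : 1 ≤ B) (hr : 0 < r) {γ K : ℝ} (hγ0 : 0 < γ) (hγ : γ ≤ 1) (hρB : ρ * (16 * B) ≤ r * γ)
    (hρK : ρ * (4 * K) ≤ r) {n : ℕ} (hn : n ≤ N) (hM : ∀ i ≤ n, M i = M' i)
    (hng : ∀ k, k + 1 < n → γ ≤ ‖V (k + 1) - V k‖)
    (hW : ‖W 0 - W' 0‖ ≤ K * ‖V 0 - V' 0‖) :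
    ∀ k < n, ‖V k - V' k‖ ≤ 4 * ρ / ‖M (k + 1) - M k‖ * ‖W (k + 1) - W' (k + 1)‖ ∧
      (k + 1 < n → ‖W (k + 1) - W' (k + 1)‖ ≤
        4 / ‖V (k + 1) - V k‖ * ‖V (k + 1) - V' (k + 1)‖) := by
  have hρB' : ρ * (4 * B) ≤ r := by nlinarith [mul_pos hρ (by linarith : 0 < B)]
  have hrγ : 16 * ρ ≤ r * γ := by nlinarith
  have hD : ∀ k < n, ∀ Λ : ℝ, ρ * (4 * Λ) ≤ r → ‖W k - W' k‖ ≤ Λ * ‖V k - V' k‖ →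
      ‖V k - V' k‖ ≤ 4 * ρ / ‖M (k + 1) - M k‖ * ‖W (k + 1) - W' (k + 1)‖ := by
    intro k hk Λ hΛ hWk
    obtain ⟨a, ha, hfl⟩ := h.exists_flight hρ hB hρB' (hk.trans_le hn)
    obtain ⟨a', ha', hfl'⟩ := h'.exists_flight hρ hB hρB' (hk.trans_le hn)
    rw [← hM k hk.le, ← hM (k + 1) hk] at ha' hfl'
    have hs := h.sep k (hk.trans_le hn)
    have hn0 : 0 < ‖M (k + 1) - M k‖ := hr.trans_le hs
    have h1 := mul_norm_sub_le_of_norm_eq_one (h.norm_V k (by omega)) (h'.norm_V k (by omega))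
      (by positivity) ha ha'
    rw [hfl, hfl', add_sub_add_left_eq_sub, ← smul_sub, norm_smul, Real.norm_eq_abs,
      abs_of_pos hρ, sub_sub_sub_comm] at h1
    have h2 := norm_sub_le (W (k + 1) - W' (k + 1)) (W k - W' k)
    have h3 : ρ * ‖W (k + 1) - W' (k + 1) - (W k - W' k)‖ ≤
        ρ * ‖W (k + 1) - W' (k + 1)‖ + ρ * (Λ * ‖V k - V' k‖) := by
      rw [← mul_add]; gcongr; linarith
    have h4 : ρ * (4 * Λ) * ‖V k - V' k‖ ≤ ‖M (k + 1) - M k‖ * ‖V k - V' k‖ := by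
      gcongr; linarith
    rw [div_mul_eq_mul_div, le_div_iff₀ hn0]
    linarith
  have hR : ∀ k, k + 1 < n →
      ‖V k - V' k‖ ≤ 4 * ρ / ‖M (k + 1) - M k‖ * ‖W (k + 1) - W' (k + 1)‖ →
      ‖W (k + 1) - W' (k + 1)‖ ≤ 4 / ‖V (k + 1) - V k‖ * ‖V (k + 1) - V' (k + 1)‖ := by
    intro k hk hDk
    have hx := hng k hk
    have hx0 := hγ0.trans_le hx
    have hs := h.sep k (by omega)
    have hn0 : 0 < ‖M (k + 1) - M k‖ := hr.trans_le hs
    have h1 := norm_sub_le_of_smul_norm (h.reflect k (by omega)) (h'.reflect k (by omega)) hx0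
      (h'.norm_W k (by omega))
    have h2 := norm_sub_le (V (k + 1) - V' (k + 1)) (V k - V' k)
    rw [sub_sub_sub_comm] at h2
    rw [div_mul_eq_mul_div, le_div_iff₀ hx0] at h1 ⊢
    rw [div_mul_eq_mul_div, le_div_iff₀ hn0] at hDk
    have h3 : r * ‖V k - V' k‖ ≤ ‖M (k + 1) - M k‖ * ‖V k - V' k‖ := by gcongr
    have h4 : r * ‖V k - V' k‖ ≤ r * (γ / 4 * ‖W (k + 1) - W' (k + 1)‖) := by
      nlinarith [norm_nonneg (W (k + 1) - W' (k + 1))]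
    have h5 := le_of_mul_le_mul_left h4 hr
    have h6 := mul_le_mul_of_nonneg_left hx (norm_nonneg (W (k + 1) - W' (k + 1)))
    linarith
  have h4γ : ρ * (4 * (4 / γ)) ≤ r := by
    rw [show ρ * (4 * (4 / γ)) = 16 * ρ / γ by ring, div_le_iff₀ hγ0]; exact hrγ
  intro k
  induction k with
  | zero =>
    intro hk
    have h1 := hD 0 hk K hρK hW
    exact ⟨h1, fun hk' => hR 0 hk' h1⟩
  | succ k ih =>
    intro hk
    obtain ⟨-, h1⟩ := ih (by omega)
    have h2 := hD (k + 1) hk (4 / γ) h4γ ((h1 hk).trans (by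
      have := hng k hk
      gcongr))
    exact ⟨h2, fun hk' => hR (k + 1) hk' h2⟩

end IsPath

/-! ### Measure of cylinders -/

/-- Factor gained by a cylinder when the centre `p (k + 1)` is appended to `p 0, …, p k`. -/
def stepWeight {d : ℕ} (r : ℕ) (c : ℝ) (p : ℕ → Vec d) : ℕ → ℝ
  | 0 => c * (‖p 1 - p 0‖ ^ (r + 1))⁻¹
  | k + 1 => c * ((‖p (k + 2) - p (k + 1)‖ ^ (r + 1))⁻¹ *
      (‖dir (p (k + 2) - p (k + 1)) - dir (p (k + 1) - p k)‖ ^ r)⁻¹)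

/-- Product of the factors `stepWeight` along `p 0, …, p n`. -/
def pathWeight {d : ℕ} (r : ℕ) (c : ℝ) (n : ℕ) (p : ℕ → Vec d) : ℝ :=
  ∏ k ∈ Finset.range n, stepWeight r c p k

theorem stepWeight_nonneg {d r : ℕ} {c : ℝ} (hc : 0 ≤ c) (p : ℕ → Vec d) (k : ℕ) :
    0 ≤ stepWeight r c p k := by
  cases k <;> · rw [stepWeight]; positivity

theorem pathWeight_nonneg {d r : ℕ} {c : ℝ} (hc : 0 ≤ c) (n : ℕ) (p : ℕ → Vec d) :
    0 ≤ pathWeight r c n p :=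
  Finset.prod_nonneg fun k _ => stepWeight_nonneg hc p k

/-- A family of trajectories indexed by the initial velocity, whose rescaled initial
displacement depends on it in a Lipschitz way. -/
structure PathFamily {d : ℕ} (ρ r₁ B K : ℝ) (N : ℕ) (Z : Set (Vec d))
    (V W M : Vec d → ℕ → Vec d) : Prop where
  isPath : ∀ x ∈ Z, IsPath ρ r₁ B N (V x) (W x) (M x)
  V_zero : ∀ x ∈ Z, V x 0 = x
  lipschitz : ∀ x ∈ Z, ∀ y ∈ Z, ‖W x 0 - W y 0‖ ≤ K * ‖x - y‖

/-- The radius `ρ` is small in terms of the other parameters. -/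
structure SmallRadius (d : ℕ) (ρ r₁ B K γ : ℝ) : Prop where
  pos : 0 < ρ
  one_le : 1 ≤ B
  r_pos : 0 < r₁
  γ_pos : 0 < γ
  γ_le : γ ≤ 1
  mul_B : ρ * (16 * B) ≤ r₁ * γ
  mul_K : ρ * (4 * K) ≤ r₁
  mul_sq : ρ * (2048 * √(d : ℝ)) ≤ r₁ * γ ^ 2

/-- Initial velocities in `Z` whose first `n` scatterers are `p 0, …, p n` and whose first
`n - 1` collisions are not nearly grazing. -/
def pathCylinder {d : ℕ} (γ : ℝ) (Z : Set (Vec d)) (V M : Vec d → ℕ → Vec d) (n : ℕ)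
    (p : ℕ → Vec d) : Set (Vec d) :=
  {x ∈ Z | (∀ k ≤ n, M x k = p k) ∧ ∀ k, k + 1 < n → γ ≤ ‖V x (k + 1) - V x k‖}

theorem pathCylinder_succ_subset {d : ℕ} {γ : ℝ} {Z : Set (Vec d)} {V M : Vec d → ℕ → Vec d} {n : ℕ}
    {p : ℕ → Vec d} : pathCylinder γ Z V M (n + 1) p ⊆ pathCylinder γ Z V M n p :=
  fun _ hx => ⟨hx.1, fun k hk => hx.2.1 k (by omega), fun k hk => hx.2.2 k (by omega)⟩

theorem PathFamily.expansion {d : ℕ} {ρ r₁ B K γ : ℝ} {N : ℕ} {Z : Set (Vec d)}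
    {V W M : Vec d → ℕ → Vec d} (h : PathFamily ρ r₁ B K N Z V W M)
    (hs : SmallRadius d ρ r₁ B K γ) {n : ℕ} (hn : n ≤ N) {p : ℕ → Vec d} {x y : Vec d}
    (hx : x ∈ pathCylinder γ Z V M n p) (hy : y ∈ pathCylinder γ Z V M n p) :
    ∀ k < n, ‖V x k - V y k‖ ≤ 4 * ρ / ‖p (k + 1) - p k‖ * ‖W x (k + 1) - W y (k + 1)‖ ∧
      (k + 1 < n → ‖W x (k + 1) - W y (k + 1)‖ ≤
        4 / ‖V x (k + 1) - V x k‖ * ‖V x (k + 1) - V y (k + 1)‖) := by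
  intro k hk
  have := (h.isPath x hx.1).pair_expansion (h.isPath y hy.1) hs.pos hs.one_le hs.r_pos hs.γ_pos
    hs.γ_le hs.mul_B hs.mul_K hn (fun i hi => (hx.2.1 i hi).trans (hy.2.1 i hi).symm) hx.2.2
    (by rw [h.V_zero x hx.1, h.V_zero y hy.1]; exact h.lipschitz x hx.1 y hy.1) k hk
  rwa [hx.2.1 k hk.le, hx.2.1 (k + 1) hk] at this

set_option maxHeartbeats 1000000 in
theorem exists_pathCylinder_diam_le (r : ℕ) : ∃ C > (0 : ℝ), ∀ (ρ r₁ B K γ : ℝ) (N : ℕ)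
    (Z : Set (Vec (r + 2))) (V W M : Vec (r + 2) → ℕ → Vec (r + 2)),
    Z ⊆ sph (r + 2) → PathFamily ρ r₁ B K N Z V W M → SmallRadius (r + 2) ρ r₁ B K γ →
    ∀ (n : ℕ), n + 1 ≤ N → ∀ (p : ℕ → Vec (r + 2)) (S : Set (Vec (r + 2))),
      S ⊆ pathCylinder γ Z V M (n + 1) p → ∀ δ > 0, δ ≤ 2 * √((r + 2 : ℕ) : ℝ) →
      (∀ x ∈ S, ∀ y ∈ S, ‖W x (n + 1) - W y (n + 1)‖ ≤ δ) →
      sphVol (r + 2) S ≤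
        ENNReal.ofReal (pathWeight r (C * ρ ^ (r + 1)) (n + 1) p * δ ^ (r + 1)) := by
  obtain ⟨C₀, hC₀, hcap⟩ := exists_sphVol_le r
  obtain ⟨C₂, hC₂, hslab⟩ := exists_measure_le_of_slab r
  set s := √((r + 2 : ℕ) : ℝ) with hs
  have hs1 : 1 ≤ s := by
    rw [hs, Real.one_le_sqrt]; push_cast; linarith [(Nat.cast_nonneg r : (0 : ℝ) ≤ r)]
  have hs0 : 0 < s := by linarith
  set C := C₀ * 4 ^ (r + 1) + C₂ * 8 ^ r * (4 * s) ^ (r + 1) with hC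
  have hC0 : 0 < C := by positivity
  refine ⟨C, hC0, ?_⟩
  intro ρ r₁ B K γ N Z V W M hZ hP hsm n
  have hρ := hsm.pos
  have hγ0 := hsm.γ_pos
  have hr := hsm.r_pos
  have hsq := hsm.mul_sq
  have hγ1 := hsm.γ_le
  have hmB : ρ * 16 ≤ r₁ * γ := by nlinarith [hsm.mul_B, hsm.one_le]
  have hγ2 : γ ^ 2 ≤ 1 := by nlinarith
  induction n with
  | zero =>
    intro hn p S hS δ hδ _ hdiam
    rcases S.eq_empty_or_nonempty with rfl | ⟨x₀, hx₀⟩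
    · simp
    have hn0 : 0 < ‖p 1 - p 0‖ := by
      have h1 := (hP.isPath x₀ (hS hx₀).1).sep 0 hn
      rw [(hS hx₀).2.1 0 (by omega), (hS hx₀).2.1 1 (by omega)] at h1
      exact hr.trans_le h1
    refine (hcap S (fun x hx => hZ (hS hx).1) (4 * ρ / ‖p 1 - p 0‖ * δ) (by positivity)
      fun x hx y hy => ?_).trans ?_
    · have h1 := (hP.expansion hsm hn (hS hx) (hS hy) 0 (by omega)).1
      rw [hP.V_zero x (hS hx).1, hP.V_zero y (hS hy).1] at h1
      exact h1.trans (mul_le_mul_of_nonneg_left (hdiam x hx y hy) (by positivity))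
    · refine ENNReal.ofReal_le_ofReal ?_
      rw [pathWeight, Finset.prod_range_one, stepWeight]
      calc C₀ * (4 * ρ / ‖p 1 - p 0‖ * δ) ^ (r + 1)
          = (C₀ * 4 ^ (r + 1)) * (ρ ^ (r + 1) * (‖p 1 - p 0‖ ^ (r + 1))⁻¹ * δ ^ (r + 1)) := by
            rw [mul_pow, div_pow, mul_pow]; ring
        _ ≤ C * (ρ ^ (r + 1) * (‖p 1 - p 0‖ ^ (r + 1))⁻¹ * δ ^ (r + 1)) := by
            gcongr
            rw [hC]
            have : 0 < C₂ * 8 ^ r * (4 * s) ^ (r + 1) := by positivity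
            linarith
        _ = _ := by ring
  | succ n ih =>
    intro hn p S hS δ hδ hδs hdiam
    rcases S.eq_empty_or_nonempty with rfl | ⟨x₀, hx₀⟩
    · simp
    have hx₀c := hS hx₀
    have hp := hP.isPath x₀ hx₀c.1
    set L := ‖p (n + 2) - p (n + 1)‖ with hL
    have hLr : r₁ ≤ L := by
      have h1 := hp.sep (n + 1) hn
      rwa [hx₀c.2.1 (n + 1) (by omega), hx₀c.2.1 (n + 2) (by omega)] at h1
    have hL0 : 0 < L := hr.trans_le hLr
    set δ' := 4 * ρ / L * δ with hδ'
    have hδ'0 : 0 < δ' := by positivity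
    have hδ'r : δ' * r₁ ≤ 8 * s * ρ := by
      have h1 : δ' * L = 4 * ρ * δ := by rw [hδ']; field_simp
      have h2 : δ' * r₁ ≤ δ' * L := by gcongr
      nlinarith
    have hδ'γ : 256 * δ' ≤ γ ^ 2 := by
      have h1 : r₁ * (256 * δ') ≤ r₁ * γ ^ 2 := by linarith
      exact le_of_mul_le_mul_left h1 hr
    set X := ‖V x₀ (n + 1) - V x₀ n‖ with hX
    have hXγ : γ ≤ X := hx₀c.2.2 n (by omega)
    set θ := ‖dir (p (n + 2) - p (n + 1)) - dir (p (n + 1) - p n)‖ with hθ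
    have hXθ : |X - θ| ≤ γ / 2 := by
      have h1 := hp.abs_norm_sub_norm_dir_le hρ hsm.one_le hr hγ1 hsm.mul_B
        (k := n) (by omega)
      rwa [hx₀c.2.1 n (by omega), hx₀c.2.1 (n + 1) (by omega),
        hx₀c.2.1 (n + 2) (by omega)] at h1
    obtain ⟨hXθ1, hXθ2⟩ := abs_le.1 hXθ
    have hX0 : 0 < X := by linarith
    have hθγ : γ / 2 ≤ θ := by linarith
    have hθ0 : 0 < θ := by linarith
    have hθX : θ ≤ 2 * X := by linarith
    have hX2 : X ≤ 2 := by
      refine (norm_sub_le _ _).trans ?_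
      rw [hp.norm_V _ (by omega), hp.norm_V _ (by omega)]; norm_num
    have hθ3 : θ ≤ 3 := by linarith
    set R := 8 * δ' / θ with hR
    have hRδ : R / δ' = 8 / θ := by rw [hR]; field_simp
    have hRX : 4 / X * δ' ≤ R := by
      rw [hR, div_mul_eq_mul_div, div_le_div_iff₀ hX0 hθ0]
      calc 4 * δ' * θ ≤ 4 * δ' * (2 * X) := by gcongr
        _ = 8 * δ' * X := by ring
    have hDV : ∀ x ∈ S, ‖V x₀ (n + 1) - V x (n + 1)‖ ≤ δ' := fun x hx => by
      have h1 := (hP.expansion hsm hn hx₀c (hS hx) (n + 1) (by omega)).1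
      exact h1.trans (mul_le_mul_of_nonneg_left (hdiam x₀ hx₀ x hx) (by positivity))
    have hDW : ∀ x ∈ S, ‖W x₀ (n + 1) - W x (n + 1)‖ ≤ 4 / X * δ' := fun x hx => by
      have h1 := (hP.expansion hsm hn hx₀c (hS hx) n (by omega)).2 (by omega)
      exact h1.trans (mul_le_mul_of_nonneg_left (hDV x hx) (by positivity))
    have hDV' : ∀ x ∈ S, ‖V x₀ n - V x n‖ ≤ δ' := fun x hx => by
      have h1 := (hP.expansion hsm hn hx₀c (hS hx) n (by omega)).1
      have h2 : r₁ ≤ ‖p (n + 1) - p n‖ := by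
        have h3 := hp.sep n (by omega)
        rwa [hx₀c.2.1 n (by omega), hx₀c.2.1 (n + 1) (by omega)] at h3
      calc _ ≤ 4 * ρ / r₁ * (4 / γ * δ') := by
            refine h1.trans (mul_le_mul ?_ ((hDW x hx).trans ?_) (norm_nonneg _) (by positivity))
            · gcongr
            · gcongr
        _ = ρ * 16 / (r₁ * γ) * δ' := by field_simp; ring
        _ ≤ 1 * δ' := by
            gcongr
            rw [div_le_one (by positivity)]; exact hmB
        _ = δ' := one_mul _
    have hinner : ∀ x ∈ S, ‖V x (n + 1) - V x n‖ = -2 * ⟪V x n, W x (n + 1)⟫ := fun x hx =>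
      (hP.isPath x (hS hx).1).norm_reflect n (by omega)
    have hWn : ∀ x ∈ S, ‖W x (n + 1)‖ = 1 := fun x hx =>
      (hP.isPath x (hS hx).1).norm_W n (by omega)
    refine (hslab (sphVol (r + 2)) S (fun x => W x (n + 1)) (W x₀ (n + 1)) (V x₀ n) δ' R
      (ENNReal.ofReal (pathWeight r (C * ρ ^ (r + 1)) (n + 1) p * (s * δ') ^ (r + 1)))
      (hWn x₀ hx₀) (hp.norm_V _ (by omega)) hδ'0 ?_ ?_ ?_ hWn ?_ ?_ ?_).trans ?_
    · rw [hR, le_div_iff₀ hθ0]; nlinarith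
    · rw [hR, div_pow, div_le_iff₀ (by positivity)]
      have h1 : (γ / 2) ^ 2 ≤ θ ^ 2 := by gcongr
      have h2 : 64 * δ' ≤ θ ^ 2 := by linarith [h1, hδ'γ, (by ring : (γ / 2) ^ 2 = γ ^ 2 / 4)]
      calc (8 * δ') ^ 2 = δ' * (64 * δ') := by ring
        _ ≤ δ' * θ ^ 2 := by gcongr
    · by_cases hc : |⟪V x₀ n, W x₀ (n + 1)⟫| ≤ 1 / 2
      · exact Or.inl hc
      · right
        have h1 := hinner x₀ hx₀
        rw [← hX] at h1
        have h2 : |⟪V x₀ n, W x₀ (n + 1)⟫| = X / 2 := by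
          rw [show ⟪V x₀ n, W x₀ (n + 1)⟫ = -(X / 2) by linarith, abs_neg, abs_of_pos (by linarith)]
        rw [h2] at hc
        rw [hR, div_le_iff₀ hθ0]
        nlinarith
    · intro x hx
      rw [norm_sub_rev]
      exact (hDW x hx).trans hRX
    · intro x hx
      have h1 := hinner x₀ hx₀
      have h2 := hinner x hx
      have h3 : ⟪V x₀ n, W x (n + 1) - W x₀ (n + 1)⟫ =
          (‖V x₀ (n + 1) - V x₀ n‖ - ‖V x (n + 1) - V x n‖) / 2 +
            ⟪V x₀ n - V x n, W x (n + 1)⟫ := by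
        rw [inner_sub_right, inner_sub_left, h1, h2]; ring
      have h4 : |‖V x₀ (n + 1) - V x₀ n‖ - ‖V x (n + 1) - V x n‖| ≤ δ' + δ' := by
        refine (abs_norm_sub_norm_le _ _).trans ?_
        rw [sub_sub_sub_comm]
        exact (norm_sub_le _ _).trans (add_le_add (hDV x hx) (hDV' x hx))
      have h5 : |⟪V x₀ n - V x n, W x (n + 1)⟫| ≤ δ' := by
        refine (abs_real_inner_le_norm _ _).trans ?_
        rw [hWn x hx, mul_one]; exact hDV' x hx
      rw [h3]
      refine (abs_add_le _ _).trans ?_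
      rw [abs_div, abs_two]
      linarith
    · intro S' hS' hd'
      refine ih (by omega) p S' (hS'.trans (hS.trans pathCylinder_succ_subset)) (s * δ')
        (by positivity) ?_ hd'
      nlinarith
    · rw [← ENNReal.ofReal_mul (by positivity)]
      refine ENNReal.ofReal_le_ofReal ?_
      rw [pathWeight, pathWeight, Finset.prod_range_succ _ (n + 1), stepWeight, hRδ, ← hL, ← hθ]
      set P := ∏ k ∈ Finset.range (n + 1), stepWeight r (C * ρ ^ (r + 1)) p k with hPdef
      have hP0 : 0 ≤ P := pathWeight_nonneg (by positivity) (n + 1) p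
      calc C₂ * (8 / θ) ^ r * (P * (s * δ') ^ (r + 1))
          = (C₂ * 8 ^ r * (4 * s) ^ (r + 1)) *
            (P * (ρ ^ (r + 1) * ((L ^ (r + 1))⁻¹ * (θ ^ r)⁻¹)) * δ ^ (r + 1)) := by
            rw [hδ', div_pow, show s * (4 * ρ / L * δ) = (4 * s) * (ρ * (L⁻¹ * δ)) by
              rw [div_eq_mul_inv]; ring, mul_pow (4 * s), mul_pow ρ, mul_pow L⁻¹, inv_pow,
              div_eq_mul_inv]
            ring
        _ ≤ C * (P * (ρ ^ (r + 1) * ((L ^ (r + 1))⁻¹ * (θ ^ r)⁻¹)) * δ ^ (r + 1)) := by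
            gcongr
            rw [hC]
            have : 0 < C₀ * 4 ^ (r + 1) := by positivity
            linarith
        _ = _ := by ring

theorem exists_pathCylinder_le (r : ℕ) : ∃ C > (0 : ℝ), ∀ (ρ r₁ B K σ : ℝ) (N : ℕ)
    (Z : Set (Vec (r + 2))) (V W M : Vec (r + 2) → ℕ → Vec (r + 2)),
    Z ⊆ sph (r + 2) → PathFamily ρ r₁ B K N Z V W M → SmallRadius (r + 2) ρ r₁ B K (σ ^ 2) →
    0 < σ → σ ≤ 1 / 2 → √((r + 2 : ℕ) : ℝ) * σ ≤ 1 →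
    ∀ (n : ℕ), n + 1 ≤ N → ∀ (p : ℕ → Vec (r + 2)),
      sphVol (r + 2) (pathCylinder (σ ^ 2) Z V M (n + 1) p) ≤
        ENNReal.ofReal (pathWeight r (C * ρ ^ (r + 1)) (n + 1) p * C) ∧
      sphVol (r + 2) {x ∈ pathCylinder (σ ^ 2) Z V M (n + 1) p | ‖V x (n + 1) - V x n‖ < σ ^ 2} ≤
        ENNReal.ofReal (pathWeight r (C * ρ ^ (r + 1)) (n + 1) p * (C * σ)) := by
  obtain ⟨C, hC, h⟩ := exists_pathCylinder_diam_le r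
  obtain ⟨C₂, hC₂, heq⟩ := exists_measure_le_of_equator r
  set s := √((r + 2 : ℕ) : ℝ) with hs
  have hss : s ^ 2 = (r + 2 : ℕ) := Real.sq_sqrt (by positivity)
  have hs1 : 1 ≤ s := by
    rw [hs, Real.one_le_sqrt]; push_cast; linarith [(Nat.cast_nonneg r : (0 : ℝ) ≤ r)]
  have hs0 : 0 < s := by linarith
  set D := C + 2 ^ (r + 1) + C₂ * (s * (r + 2 : ℕ)) ^ (r + 1) with hD
  have hD0 : 0 < C₂ * (s * (r + 2 : ℕ)) ^ (r + 1) := by positivity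
  have hD1 : 0 < (2 : ℝ) ^ (r + 1) := by positivity
  have hCD : C ≤ D := by rw [hD]; linarith
  have hmono : ∀ (ρ : ℝ), 0 < ρ → ∀ n (p : ℕ → Vec (r + 2)),
      pathWeight r (C * ρ ^ (r + 1)) n p ≤ pathWeight r (D * ρ ^ (r + 1)) n p := by
    intro ρ hρ n p
    refine Finset.prod_le_prod (fun k _ => stepWeight_nonneg (by positivity) p k) fun k _ => ?_
    cases k <;> · rw [stepWeight, stepWeight]; gcongr
  refine ⟨D, by positivity, ?_⟩
  intro ρ r₁ B K σ N Z V W M hZ hP hsm hσ0 hσ2 hσs n hn p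
  have hρ := hsm.pos
  have hr := hsm.r_pos
  have hw := hmono ρ hρ (n + 1) p
  have hw0 : 0 ≤ pathWeight r (C * ρ ^ (r + 1)) (n + 1) p := pathWeight_nonneg (by positivity) _ _
  have hWn : ∀ x ∈ pathCylinder (σ ^ 2) Z V M (n + 1) p, ‖W x (n + 1)‖ = 1 := fun x hx =>
    (hP.isPath x hx.1).norm_W n (by omega)
  have hW2 : ∀ x ∈ pathCylinder (σ ^ 2) Z V M (n + 1) p, ∀ y ∈ pathCylinder (σ ^ 2) Z V M (n + 1) p,
      ‖W x (n + 1) - W y (n + 1)‖ ≤ 2 := fun x hx y hy => by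
    refine (norm_sub_le _ _).trans ?_
    rw [hWn x hx, hWn y hy]; norm_num
  have hw1 : 0 ≤ pathWeight r (D * ρ ^ (r + 1)) (n + 1) p := hw0.trans hw
  constructor
  · refine (h ρ r₁ B K (σ ^ 2) N Z V W M hZ hP hsm n hn p _ subset_rfl 2 (by norm_num)
      (by linarith) hW2).trans (ENNReal.ofReal_le_ofReal ?_)
    have : (2 : ℝ) ^ (r + 1) ≤ D := by rw [hD]; linarith
    gcongr
  · set S := {x ∈ pathCylinder (σ ^ 2) Z V M (n + 1) p | ‖V x (n + 1) - V x n‖ < σ ^ 2} with hS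
    rcases S.eq_empty_or_nonempty with he | ⟨x₀, hx₀⟩
    · rw [he]; simp
    have hp := hP.isPath x₀ hx₀.1.1
    refine (heq (sphVol (r + 2)) S (fun x => W x (n + 1)) (V x₀ n) σ
      (ENNReal.ofReal (pathWeight r (C * ρ ^ (r + 1)) (n + 1) p *
        (s * ((r + 2 : ℕ) * σ ^ 2)) ^ (r + 1)))
      (hp.norm_V _ (by omega)) hσ0 hσ2 hσs (fun x hx => hWn x hx.1) ?_ ?_).trans ?_
    · intro x hx
      have h1 := (hP.isPath x hx.1.1).norm_reflect n (by omega)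
      have h2 : ⟪V x₀ n, W x (n + 1)⟫ =
          -(‖V x (n + 1) - V x n‖ / 2) + ⟪V x₀ n - V x n, W x (n + 1)⟫ := by
        rw [inner_sub_left, h1]; ring
      have h3 : ‖V x₀ n - V x n‖ ≤ σ ^ 2 / 2 := by
        have h4 := (hP.expansion hsm hn hx₀.1 hx.1 n (by omega)).1
        have h5 : r₁ ≤ ‖p (n + 1) - p n‖ := by
          have h6 := hp.sep n (by omega)
          rwa [hx₀.1.2.1 n (by omega), hx₀.1.2.1 (n + 1) (by omega)] at h6
        calc _ ≤ 4 * ρ / r₁ * 2 := by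
              refine h4.trans (mul_le_mul ?_ (hW2 _ hx₀.1 _ hx.1) (norm_nonneg _) (by positivity))
              gcongr
          _ ≤ σ ^ 2 / 2 := by
              rw [div_mul_eq_mul_div, div_le_iff₀ hr]
              nlinarith [hsm.mul_B, hsm.one_le]
      have h4 : |⟪V x₀ n - V x n, W x (n + 1)⟫| ≤ σ ^ 2 / 2 := by
        refine (abs_real_inner_le_norm _ _).trans ?_
        rw [hWn x hx.1, mul_one]; exact h3
      rw [h2]
      refine (abs_add_le _ _).trans ?_
      rw [abs_neg, abs_of_nonneg (by positivity)]
      linarith [hx.2]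
    · intro S' hS' hd'
      refine h ρ r₁ B K (σ ^ 2) N Z V W M hZ hP hsm n hn p S' (fun x hx => (hS' hx).1) _
        (by positivity) ?_ hd'
      have : s ^ 2 * σ ^ 2 ≤ 1 := by rw [← mul_pow]; exact pow_le_one₀ (by positivity) hσs
      rw [← hss]
      nlinarith
    · rw [← ENNReal.ofReal_mul (by positivity)]
      refine ENNReal.ofReal_le_ofReal ?_
      have h1 : C₂ * (s * (r + 2 : ℕ)) ^ (r + 1) ≤ D := by rw [hD]; linarith
      calc _ = pathWeight r (C * ρ ^ (r + 1)) (n + 1) p *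
            ((C₂ * (s * (r + 2 : ℕ)) ^ (r + 1)) * σ) := by
            rw [← mul_assoc s, mul_pow (s * _) (σ ^ 2), ← pow_mul, one_div, inv_pow,
              show 2 * (r + 1) = (2 * r + 1) + 1 by ring, pow_succ σ (2 * r + 1)]
            field_simp
        _ ≤ _ := by gcongr

/-! ### Summation over the tree of admissible paths -/

theorem sum_mul_exp_neg_le {d : ℕ} {C₀ C δ t s ε E : ℝ} {X : Finset (Vec d)} {f : Vec d → ℝ}
    (hC₀ : 0 ≤ C₀) (hs : 0 ≤ s) (hδ : 0 < δ) (ht : 0 < t) (hε : 0 < ε)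
    (hf0 : ∀ x ∈ X, 0 ≤ f x)
    (hf : ∀ R > 0, ∀ X' ⊆ X, (∀ x ∈ X', ‖x‖ ≤ R) → ∑ x ∈ X', f x ≤ C * (R + E))
    (hX : ∀ x ∈ X, ‖x‖ ≤ t * ε⁻¹) (hCE : 0 ≤ C * E) :
    ∑ x ∈ X, C₀ * ε * f x * Real.exp (-(s * ε * ‖x‖)) ≤
      C₀ * C * (δ + Real.exp (-(s * δ)) * t + 2 * (ε * E)) := by
  classical
  have h1 : ∑ x ∈ X with ‖x‖ ≤ δ * ε⁻¹, C₀ * ε * f x * Real.exp (-(s * ε * ‖x‖)) ≤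
      C₀ * ε * (C * (δ * ε⁻¹ + E)) := by
    refine (Finset.sum_le_sum fun x hx => ?_).trans
      (b := ∑ x ∈ X with ‖x‖ ≤ δ * ε⁻¹, C₀ * ε * f x) ?_
    · have := hf0 x (Finset.mem_filter.1 hx).1
      refine mul_le_of_le_one_right (by positivity) ?_
      rw [Real.exp_le_one_iff, neg_nonpos]; positivity
    · rw [← Finset.mul_sum]
      exact mul_le_mul_of_nonneg_left (hf _ (by positivity) _ (Finset.filter_subset _ _)
        fun x hx => (Finset.mem_filter.1 hx).2) (by positivity)
  have h2 : ∑ x ∈ X with ¬ ‖x‖ ≤ δ * ε⁻¹, C₀ * ε * f x * Real.exp (-(s * ε * ‖x‖)) ≤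
      C₀ * ε * (C * (t * ε⁻¹ + E)) * Real.exp (-(s * δ)) := by
    refine (Finset.sum_le_sum fun x hx => ?_).trans
      (b := ∑ x ∈ X with ¬ ‖x‖ ≤ δ * ε⁻¹, C₀ * ε * f x * Real.exp (-(s * δ))) ?_
    · have := hf0 x (Finset.mem_filter.1 hx).1
      refine mul_le_mul_of_nonneg_left (Real.exp_le_exp.2 (neg_le_neg ?_)) (by positivity)
      have h3 : δ * ε⁻¹ ≤ ‖x‖ := (not_le.1 (Finset.mem_filter.1 hx).2).le
      calc s * δ = s * ε * (δ * ε⁻¹) := by field_simp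
        _ ≤ s * ε * ‖x‖ := by gcongr
    · rw [← Finset.sum_mul, ← Finset.mul_sum]
      refine mul_le_mul_of_nonneg_right ?_ (Real.exp_nonneg _)
      exact mul_le_mul_of_nonneg_left (hf _ (by positivity) _ (Finset.filter_subset _ _)
        fun x hx => hX x (Finset.mem_filter.1 hx).1) (by positivity)
  rw [← Finset.sum_filter_add_sum_filter_not X (fun x => ‖x‖ ≤ δ * ε⁻¹)]
  refine (add_le_add h1 h2).trans ?_
  have h3 : Real.exp (-(s * δ)) ≤ 1 := by
    rw [Real.exp_le_one_iff, neg_nonpos]; positivity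
  have h4 : C₀ * ε * (C * E) * Real.exp (-(s * δ)) ≤ C₀ * ε * (C * E) :=
    mul_le_of_le_one_right (by positivity) h3
  have h5 : C₀ * ε * (C * (δ * ε⁻¹ + E)) = C₀ * C * δ + C₀ * ε * (C * E) := by field_simp
  have h6 : C₀ * ε * (C * (t * ε⁻¹ + E)) * Real.exp (-(s * δ)) =
      C₀ * C * (Real.exp (-(s * δ)) * t) + C₀ * ε * (C * E) * Real.exp (-(s * δ)) := by
    field_simp
  rw [h5, h6]
  linarith

theorem exists_sum_mul_exp_neg_le_half (r : ℕ) {r₁ : ℝ} (hr₁ : 0 < r₁) (hr₁' : r₁ ≤ 1)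
    {C₀ t : ℝ} (hC₀ : 0 < C₀) (ht : 0 < t) : ∃ s > (0 : ℝ), ∃ σ₁ > (0 : ℝ), σ₁ ≤ 1 / 2 ∧
      ∀ σ, 0 < σ → σ ≤ σ₁ → ∀ X : Finset (Vec (r + 2)),
        (∀ x ∈ X, ∀ y ∈ X, x ≠ y → r₁ ≤ ‖x - y‖) → (∀ x ∈ X, r₁ ≤ ‖x‖) →
        (∀ x ∈ X, ‖x‖ ≤ t * ((σ ^ 8) ^ (r + 1))⁻¹) →
        (∑ x ∈ X, C₀ * (σ ^ 8) ^ (r + 1) * (‖x‖ ^ (r + 1))⁻¹ *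
            Real.exp (-(s * (σ ^ 8) ^ (r + 1) * ‖x‖)) ≤ 1 / 2) ∧
        ∀ u : Vec (r + 2), ‖u‖ = 1 → (∀ x ∈ X, σ ^ 2 / 2 ≤ ‖dir x - u‖) →
          ∑ x ∈ X, C₀ * (σ ^ 8) ^ (r + 1) * ((‖x‖ ^ (r + 1))⁻¹ * (‖dir x - u‖ ^ r)⁻¹) *
            Real.exp (-(s * (σ ^ 8) ^ (r + 1) * ‖x‖)) ≤ 1 / 2 := by
  obtain ⟨C₁, hC₁, h₁⟩ := exists_sum_inv_norm_pow_le r hr₁ hr₁'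
  obtain ⟨C₂, hC₂, h₂⟩ := exists_sum_inv_norm_pow_mul_le r hr₁ hr₁'
  set C := max C₁ C₂ with hC
  have hC0 : 0 < C := lt_max_of_lt_left hC₁
  set D := C₀ * C with hD
  have hD0 : 0 < D := by positivity
  set δ := 1 / (8 * D) with hδ
  have hδ0 : 0 < δ := by positivity
  have hlim : Tendsto (fun s : ℝ => Real.exp (-(s * δ)) * t) atTop (𝓝 (0 * t)) :=
    (Real.tendsto_exp_neg_atTop_nhds_zero.comp
      (tendsto_id.atTop_mul_const hδ0)).mul_const t
  rw [zero_mul] at hlim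
  obtain ⟨s, hs1, hs0⟩ := ((hlim.eventually_lt_const hδ0).and (eventually_gt_atTop 0)).exists
  refine ⟨s, hs0, min (1 / 2) (δ / (2 * 4 ^ (r + 1))), by positivity, min_le_left _ _, ?_⟩
  intro σ hσ0 hσ X hsep hX1 hX2
  have hσ2 : σ ≤ 1 / 2 := hσ.trans (min_le_left _ _)
  have hσδ : σ * (2 * 4 ^ (r + 1)) ≤ δ :=
    (le_div_iff₀ (by positivity)).1 (hσ.trans (min_le_right _ _))
  set ε := (σ ^ 8) ^ (r + 1) with hε
  have hε0 : 0 < ε := by positivity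
  set γ := σ ^ 2 / 2 with hγ
  have hγ0 : 0 < γ := by positivity
  have hγ1 : γ ≤ 1 := by rw [hγ]; nlinarith
  set E := (γ ^ (2 * r + 2))⁻¹ with hE
  have hE1 : 1 ≤ E := (one_le_inv₀ (by positivity)).2 (pow_le_one₀ hγ0.le hγ1)
  have hεE : 2 * (ε * E) ≤ δ := by
    refine le_trans ?_ hσδ
    have h1 : ε * E = 4 ^ (r + 1) * (σ ^ 4) ^ (r + 1) := by
      rw [hε, hE, ← div_eq_mul_inv, div_eq_iff (by positivity), hγ, show 2 * r + 2 = 2 * (r + 1) by ring,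
        pow_mul, ← mul_pow, ← mul_pow]
      congr 1; ring
    have h2 : (σ ^ 4) ^ (r + 1) ≤ σ := by
      rw [← pow_mul]
      exact pow_le_of_le_one hσ0.le (by linarith) (by omega)
    rw [h1]
    nlinarith [show (0 : ℝ) < 4 ^ (r + 1) by positivity]
  have hfin : C₀ * C * (δ + Real.exp (-(s * δ)) * t + 2 * (ε * E)) ≤ 1 / 2 := by
    have h1 : D * δ = 1 / 8 := by rw [hδ]; field_simp
    calc C₀ * C * (δ + Real.exp (-(s * δ)) * t + 2 * (ε * E)) ≤ D * (δ + δ + δ) := by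
          gcongr
      _ ≤ 1 / 2 := by linarith
  constructor
  · refine (sum_mul_exp_neg_le hC₀.le hs0.le hδ0 ht hε0 (fun x _ => by positivity)
      (fun R hR X' hX' hXR => ?_) hX2 (by positivity)).trans hfin
    refine (h₁ R X' hR (fun x hx y hy => hsep x (hX' hx) y (hX' hy)) (fun x hx => hX1 x (hX' hx))
      hXR).trans ?_
    have := le_max_left C₁ C₂
    gcongr
  · intro u hu hXu
    refine (sum_mul_exp_neg_le hC₀.le hs0.le hδ0 ht hε0 (fun x _ => by positivity)
      (fun R hR X' hX' hXR => ?_) hX2 (by positivity)).trans hfin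
    refine (h₂ u R γ X' hu hR hγ0 hγ1 (fun x hx y hy => hsep x (hX' hx) y (hX' hy))
      (fun x hx => hX1 x (hX' hx)) hXR fun x hx => hXu x (hX' hx)).trans ?_
    have := le_max_right C₁ C₂
    gcongr

theorem pathWeight_succ_update {d : ℕ} (r : ℕ) (c : ℝ) (k : ℕ) (p : ℕ → Vec d) (m : Vec d) :
    pathWeight r c (k + 1) (Function.update p (k + 1) m) =
      pathWeight r c k p * stepWeight r c (Function.update p (k + 1) m) k := by
  rw [pathWeight, Finset.prod_range_succ, pathWeight]
  congr 1
  refine Finset.prod_congr rfl fun i hi => ?_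
  have hi' := Finset.mem_range.1 hi
  cases i with
  | zero =>
    rw [stepWeight, stepWeight, Function.update_of_ne (by omega), Function.update_of_ne (by omega)]
  | succ i =>
    rw [stepWeight, stepWeight, Function.update_of_ne (by omega), Function.update_of_ne (by omega),
      Function.update_of_ne (by omega)]

/-- If the total one-step weight, discounted exponentially in the step length, is at most `1 / 2`,
then the measure of the initial velocities with short paths decays geometrically. -/
theorem measure_short_le_of_sum_stepWeight_le {d : ℕ} (μ : Measure (Vec d)) (r : ℕ)
    {c s τ : ℝ} (hc : 0 ≤ c) (hs : 0 ≤ s) (hτ : 0 ≤ τ) (n : ℕ) {Y Λ : Set (Vec d)}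
    (hΛ : Λ.Countable) {M : Vec d → ℕ → Vec d} (hM : ∀ x ∈ Y, ∀ k < n, M x (k + 1) ∈ Λ)
    (hend : ∀ p : ℕ → Vec d,
      μ {x ∈ Y | ∀ i ≤ n, M x i = p i} ≤ ENNReal.ofReal (pathWeight r c n p * τ))
    (hstep : ∀ k < n, ∀ (p : ℕ → Vec d) (F : Finset (Vec d)),
      (∀ m ∈ F, ∃ x ∈ Y, (∀ i ≤ k, M x i = p i) ∧ M x (k + 1) = m) →
      ∑ m ∈ F, stepWeight r c (Function.update p (k + 1) m) k * Real.exp (-(s * ‖m - p k‖)) ≤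
        1 / 2) (j : ℕ) :
    ∀ (k : ℕ), k + j = n → ∀ (p : ℕ → Vec d) (X : ℝ),
      μ {x ∈ Y | (∀ i ≤ k, M x i = p i) ∧ ∑ i ∈ Finset.Ico k n, ‖M x (i + 1) - M x i‖ ≤ X} ≤
        ENNReal.ofReal (pathWeight r c k p * (τ * (1 / 2) ^ j * Real.exp (s * X))) := by
  induction j with
  | zero =>
    intro k hk p X
    obtain rfl : k = n := by omega
    rcases lt_or_ge X 0 with hX | hX
    · refine (measure_mono_null (t := ∅) ?_ measure_empty).le.trans zero_le
      rintro x ⟨-, -, h⟩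
      simp only [Finset.Ico_self, Finset.sum_empty] at h
      exact absurd h (not_le.2 hX)
    · refine (measure_mono (t := {x ∈ Y | ∀ i ≤ k, M x i = p i})
        fun x hx => ⟨hx.1, hx.2.1⟩).trans ((hend p).trans
        (ENNReal.ofReal_le_ofReal ?_))
      have h1 : 1 ≤ Real.exp (s * X) := Real.one_le_exp (by positivity)
      have h2 := pathWeight_nonneg (r := r) hc k p
      rw [pow_zero, mul_one]
      exact mul_le_mul_of_nonneg_left (le_mul_of_one_le_right hτ h1) h2
  | succ j ih =>
    intro k hk p X
    set T : Set (Vec d) := {m ∈ Λ | ∃ x ∈ Y, (∀ i ≤ k, M x i = p i) ∧ M x (k + 1) = m} with hT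
    have hTc : T.Countable := hΛ.mono fun m hm => hm.1
    have hsub : {x ∈ Y | (∀ i ≤ k, M x i = p i) ∧
        ∑ i ∈ Finset.Ico k n, ‖M x (i + 1) - M x i‖ ≤ X} ⊆
        ⋃ m ∈ T, {x ∈ Y | (∀ i ≤ k + 1, M x i = Function.update p (k + 1) m i) ∧
          ∑ i ∈ Finset.Ico (k + 1) n, ‖M x (i + 1) - M x i‖ ≤ X - ‖m - p k‖} := by
      rintro x ⟨hxY, hxp, hxX⟩
      refine mem_iUnion₂.2 ⟨M x (k + 1), ⟨hM x hxY k (by omega), x, hxY, hxp, rfl⟩, hxY, ?_, ?_⟩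
      · intro i hi
        rcases hi.lt_or_eq with h | rfl
        · rw [Function.update_of_ne (by omega)]; exact hxp i (by omega)
        · rw [Function.update_self]
      · rw [Finset.sum_eq_sum_Ico_succ_bot (by omega)] at hxX
        rw [← hxp k le_rfl]; linarith
    refine (measure_mono hsub).trans ((measure_biUnion_le μ hTc _).trans ?_)
    have hP := pathWeight_nonneg (r := r) hc k p
    rw [ENNReal.tsum_eq_iSup_sum]
    refine iSup_le fun F => ?_
    refine (Finset.sum_le_sum fun m _ => ih (k + 1) (by omega) _ _).trans ?_
    rw [← ENNReal.ofReal_sum_of_nonneg fun m _ =>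
      mul_nonneg (pathWeight_nonneg hc _ _) (by positivity)]
    refine ENNReal.ofReal_le_ofReal ?_
    have hF := hstep k (by omega) p (F.map (Function.Embedding.subtype _)) (by
      intro m hm
      obtain ⟨a, -, rfl⟩ := Finset.mem_map.1 hm
      exact a.2.2)
    rw [Finset.sum_map] at hF
    simp only [Function.Embedding.subtype_apply] at hF
    calc _ = ∑ m ∈ F, pathWeight r c k p * (τ * (1 / 2) ^ j * Real.exp (s * X)) *
          (stepWeight r c (Function.update p (k + 1) (m : Vec d)) k *
            Real.exp (-(s * ‖(m : Vec d) - p k‖))) := by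
          refine Finset.sum_congr rfl fun m _ => ?_
          rw [pathWeight_succ_update, mul_sub, sub_eq_add_neg, Real.exp_add]
          ring
      _ ≤ pathWeight r c k p * (τ * (1 / 2) ^ j * Real.exp (s * X)) * (1 / 2) := by
          rw [← Finset.mul_sum]
          gcongr
      _ = _ := by rw [pow_succ]; ring

theorem PathFamily.sum_stepWeight_le {r : ℕ} {ρ r₁ B K γ c s R : ℝ} {N : ℕ}
    {Z : Set (Vec (r + 2))} {V W M : Vec (r + 2) → ℕ → Vec (r + 2)}
    (hP : PathFamily ρ r₁ B K N Z V W M) (hsm : SmallRadius (r + 2) ρ r₁ B K γ)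
    {Λ : Set (Vec (r + 2))} (hsep : ∀ x ∈ Λ, ∀ y ∈ Λ, x ≠ y → r₁ ≤ ‖x - y‖)
    (hM : ∀ x ∈ Z, ∀ k < N, M x (k + 1) ∈ Λ)
    (hR : ∀ x ∈ Z, ∑ i ∈ Finset.range N, ‖M x (i + 1) - M x i‖ ≤ R)
    (hsum : ∀ X : Finset (Vec (r + 2)),
      (∀ x ∈ X, ∀ y ∈ X, x ≠ y → r₁ ≤ ‖x - y‖) → (∀ x ∈ X, r₁ ≤ ‖x‖) → (∀ x ∈ X, ‖x‖ ≤ R) →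
      (∑ x ∈ X, c * (‖x‖ ^ (r + 1))⁻¹ * Real.exp (-(s * ‖x‖)) ≤ 1 / 2) ∧
      ∀ u : Vec (r + 2), ‖u‖ = 1 → (∀ x ∈ X, γ / 2 ≤ ‖dir x - u‖) →
        ∑ x ∈ X, c * ((‖x‖ ^ (r + 1))⁻¹ * (‖dir x - u‖ ^ r)⁻¹) * Real.exp (-(s * ‖x‖)) ≤ 1 / 2)
    {n : ℕ} (hn : n + 1 ≤ N) {Y : Set (Vec (r + 2))} (hYZ : Y ⊆ Z)
    (hY : ∀ x ∈ Y, ∀ k < n, γ ≤ ‖V x (k + 1) - V x k‖) {k : ℕ} (hk : k < n + 1)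
    (p : ℕ → Vec (r + 2)) (F : Finset (Vec (r + 2)))
    (hF : ∀ m ∈ F, ∃ x ∈ Y, (∀ i ≤ k, M x i = p i) ∧ M x (k + 1) = m) :
    ∑ m ∈ F, stepWeight r c (Function.update p (k + 1) m) k * Real.exp (-(s * ‖m - p k‖)) ≤
      1 / 2 := by
  classical
  have hinj : Set.InjOn (fun m => m - p k) F := fun a _ b _ h => sub_left_injective h
  have hsum' := hsum (F.image fun m => m - p k) (by
      intro a ha b hb hab
      obtain ⟨m, hm, rfl⟩ := Finset.mem_image.1 ha
      obtain ⟨m', hm', rfl⟩ := Finset.mem_image.1 hb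
      rw [sub_sub_sub_cancel_right]
      obtain ⟨x, hx, -, rfl⟩ := hF m hm
      obtain ⟨x', hx', -, rfl⟩ := hF m' hm'
      refine hsep _ (hM x (hYZ hx) k (by omega)) _ (hM x' (hYZ hx') k (by omega)) fun h => hab ?_
      simp only [h])
    (by
      intro a ha
      obtain ⟨m, hm, rfl⟩ := Finset.mem_image.1 ha
      obtain ⟨x, hx, hxp, rfl⟩ := hF m hm
      rw [← hxp k le_rfl]
      exact (hP.isPath x (hYZ hx)).sep k (by omega))
    (by
      intro a ha
      obtain ⟨m, hm, rfl⟩ := Finset.mem_image.1 ha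
      obtain ⟨x, hx, hxp, rfl⟩ := hF m hm
      rw [← hxp k le_rfl]
      refine le_trans ?_ (hR x (hYZ hx))
      exact Finset.single_le_sum (f := fun i => ‖M x (i + 1) - M x i‖) (fun _ _ => norm_nonneg _)
        (Finset.mem_range.2 (by omega)))
  rcases F.eq_empty_or_nonempty with rfl | ⟨m₀, hm₀⟩
  · rw [Finset.sum_empty]; norm_num
  cases k with
  | zero =>
    have h1 := hsum'.1
    rw [Finset.sum_image hinj] at h1
    refine le_trans (le_of_eq (Finset.sum_congr rfl fun m _ => ?_)) h1
    rw [stepWeight, Function.update_self, Function.update_of_ne (by omega)]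
  | succ k =>
    obtain ⟨x₀, hx₀, hxp₀, -⟩ := hF m₀ hm₀
    have h0 : p (k + 1) - p k ≠ 0 := by
      have h1 := (hP.isPath x₀ (hYZ hx₀)).sep k (by omega)
      rw [hxp₀ k (by omega), hxp₀ (k + 1) le_rfl] at h1
      exact norm_pos_iff.1 (hsm.r_pos.trans_le h1)
    have h1 := hsum'.2 (dir (p (k + 1) - p k)) (norm_dir h0) (by
      intro a ha
      obtain ⟨m, hm, rfl⟩ := Finset.mem_image.1 ha
      obtain ⟨x, hx, hxp, rfl⟩ := hF m hm
      have h2 := (hP.isPath x (hYZ hx)).abs_norm_sub_norm_dir_le hsm.pos hsm.one_le hsm.r_pos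
        hsm.γ_le hsm.mul_B (k := k) (by omega)
      rw [hxp k (by omega), hxp (k + 1) le_rfl] at h2
      have h3 := hY x hx k (by omega)
      linarith [(abs_le.1 h2).2])
    rw [Finset.sum_image hinj] at h1
    refine le_trans (le_of_eq (Finset.sum_congr rfl fun m _ => ?_)) h1
    rw [stepWeight, Function.update_self, Function.update_of_ne (by omega),
      Function.update_of_ne (by omega)]

theorem exists_measure_short_le (r : ℕ) {r₁ : ℝ} (hr₁ : 0 < r₁) (hr₁' : r₁ ≤ 1) {t : ℝ}
    (ht : 0 < t) : ∃ C > (0 : ℝ), ∃ σ₁ > (0 : ℝ), ∀ σ, 0 < σ → σ ≤ σ₁ →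
      ∀ (B K : ℝ) (N : ℕ) (Z : Set (Vec (r + 2))) (V W M : Vec (r + 2) → ℕ → Vec (r + 2)),
      0 < N → Z ⊆ sph (r + 2) → PathFamily (σ ^ 8) r₁ B K N Z V W M →
      SmallRadius (r + 2) (σ ^ 8) r₁ B K (σ ^ 2) →
      ∀ (Λ : Set (Vec (r + 2))) (q₀ : Vec (r + 2)), Λ.Countable →
      (∀ x ∈ Λ, ∀ y ∈ Λ, x ≠ y → r₁ ≤ ‖x - y‖) → (∀ x ∈ Z, ∀ k < N, M x (k + 1) ∈ Λ) →
      (∀ x ∈ Z, M x 0 = q₀) →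
      (∀ x ∈ Z, ∑ i ∈ Finset.range N, ‖M x (i + 1) - M x i‖ ≤ t * ((σ ^ 8) ^ (r + 1))⁻¹) →
      sphVol (r + 2) Z ≤ ENNReal.ofReal (C * ((1 / 2) ^ N + N * σ)) := by
  obtain ⟨D, hD, hcyl⟩ := exists_pathCylinder_le r
  obtain ⟨s, hs, σ₁, hσ₁, hσ₁', hsum⟩ := exists_sum_mul_exp_neg_le_half r hr₁ hr₁' hD ht
  have hsq : 0 < √((r + 2 : ℕ) : ℝ) := Real.sqrt_pos.2 (by positivity)
  refine ⟨D * Real.exp (s * t), by positivity, min σ₁ (√((r + 2 : ℕ) : ℝ))⁻¹,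
    by positivity, ?_⟩
  intro σ hσ0 hσ B K N Z V W M hN hZ hP hsm Λ q₀ hΛ hsep hM hM0 hR
  have hσσ : σ ≤ σ₁ := hσ.trans (min_le_left _ _)
  have hσs : √((r + 2 : ℕ) : ℝ) * σ ≤ 1 := by
    calc _ ≤ √((r + 2 : ℕ) : ℝ) * (√((r + 2 : ℕ) : ℝ))⁻¹ := by
          gcongr; exact hσ.trans (min_le_right _ _)
      _ = 1 := mul_inv_cancel₀ hsq.ne'
  set c := D * (σ ^ 8) ^ (r + 1) with hc
  have hc0 : 0 ≤ c := by positivity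
  have hcyl' := hcyl (σ ^ 8) r₁ B K σ N Z V W M hZ hP hsm hσ0 (hσσ.trans hσ₁') hσs
  have key : ∀ n, n + 1 ≤ N → ∀ τ, 0 ≤ τ → ∀ Y ⊆ Z,
      (∀ x ∈ Y, ∀ k < n, σ ^ 2 ≤ ‖V x (k + 1) - V x k‖) →
      (∀ p : ℕ → Vec (r + 2), sphVol (r + 2) {x ∈ Y | ∀ i ≤ n + 1, M x i = p i} ≤
        ENNReal.ofReal (pathWeight r c (n + 1) p * τ)) →
      sphVol (r + 2) Y ≤ ENNReal.ofReal (τ * (1 / 2) ^ (n + 1) * Real.exp (s * t)) := by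
    intro n hn τ hτ Y hYZ hY hend
    have h1 := measure_short_le_of_sum_stepWeight_le (sphVol (r + 2)) r hc0
      (s := s * (σ ^ 8) ^ (r + 1)) (by positivity) hτ (n + 1) hΛ
      (fun x hx k hk => hM x (hYZ hx) k (by omega)) hend
      (fun k hk p F hF => hP.sum_stepWeight_le hsm hsep hM hR
        (fun X h2 h3 h4 => hsum σ hσ0 hσσ X h2 h3 h4) hn hYZ hY hk p F hF) (n + 1) 0 (by omega)
      (fun _ => q₀) (t * ((σ ^ 8) ^ (r + 1))⁻¹)
    have h2 : s * (σ ^ 8) ^ (r + 1) * (t * ((σ ^ 8) ^ (r + 1))⁻¹) = s * t := by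
      field_simp
    rw [h2, pathWeight, Finset.prod_range_zero, one_mul] at h1
    refine le_trans (measure_mono ?_) h1
    refine fun x hx => ⟨hx, fun i hi => ?_, ?_⟩
    · obtain rfl : i = 0 := by omega
      exact hM0 x (hYZ hx)
    · refine le_trans ?_ (hR x (hYZ hx))
      rw [← Finset.range_eq_Ico]
      exact Finset.sum_le_sum_of_subset_of_nonneg (Finset.range_mono hn)
        fun _ _ _ => norm_nonneg _
  obtain ⟨N, rfl⟩ : ∃ n, N = n + 1 := ⟨N - 1, by omega⟩
  have hgood := key N le_rfl D hD.le
    {x ∈ Z | ∀ k < N, σ ^ 2 ≤ ‖V x (k + 1) - V x k‖} (fun x hx => hx.1) (fun x hx => hx.2)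
    fun p => by
      refine le_trans (measure_mono ?_) (hcyl' N le_rfl p).1
      exact fun x hx => ⟨hx.1.1, hx.2, fun k hk => hx.1.2 k (by omega)⟩
  have hbad : ∀ n < N, sphVol (r + 2) {x ∈ Z | (∀ k < n, σ ^ 2 ≤ ‖V x (k + 1) - V x k‖) ∧
      ‖V x (n + 1) - V x n‖ < σ ^ 2} ≤ ENNReal.ofReal (D * σ * Real.exp (s * t)) := by
    intro n hn
    refine (key n (by omega) (D * σ) (by positivity) _ (fun x hx => hx.1) (fun x hx => hx.2.1)
      fun p => by
        refine le_trans (measure_mono ?_) (hcyl' n (by omega) p).2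
        exact fun x hx => ⟨⟨hx.1.1, hx.2, fun k hk => hx.1.2.1 k (by omega)⟩, hx.1.2.2⟩).trans (ENNReal.ofReal_le_ofReal ?_)
    have : (1 / 2 : ℝ) ^ (n + 1) ≤ 1 := pow_le_one₀ (by norm_num) (by norm_num)
    calc D * σ * (1 / 2) ^ (n + 1) * Real.exp (s * t) ≤ D * σ * 1 * Real.exp (s * t) := by gcongr
      _ = _ := by ring
  have hsub : Z ⊆ {x ∈ Z | ∀ k < N, σ ^ 2 ≤ ‖V x (k + 1) - V x k‖} ∪
      ⋃ n ∈ Finset.range N, {x ∈ Z | (∀ k < n, σ ^ 2 ≤ ‖V x (k + 1) - V x k‖) ∧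
        ‖V x (n + 1) - V x n‖ < σ ^ 2} := by
    intro x hx
    by_cases h : ∀ k < N, σ ^ 2 ≤ ‖V x (k + 1) - V x k‖
    · exact Or.inl ⟨hx, h⟩
    · right
      push Not at h
      classical
      refine mem_iUnion₂.2 ⟨Nat.find h, Finset.mem_range.2 (Nat.find_spec h).1, hx, fun k hk => ?_,
        (Nat.find_spec h).2⟩
      have h1 := Nat.find_min h hk
      push Not at h1
      exact h1 (hk.trans (Nat.find_spec h).1)
  refine (measure_mono hsub).trans ((measure_union_le _ _).trans ?_)
  refine (add_le_add hgood ((measure_biUnion_finset_le _ _).trans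
    (Finset.sum_le_sum fun n hn => hbad n (Finset.mem_range.1 hn)))).trans ?_
  rw [Finset.sum_const, Finset.card_range, ← ENNReal.ofReal_nsmul,
    ← ENNReal.ofReal_add (by positivity) (by positivity), nsmul_eq_mul]
  refine ENNReal.ofReal_le_ofReal ?_
  have h1 : (N : ℝ) * (D * σ * Real.exp (s * t)) ≤
      ((N + 1 : ℕ) : ℝ) * (D * σ * Real.exp (s * t)) := by gcongr; omega
  calc _ ≤ _ := add_le_add_right h1 _
    _ = _ := by ring

/-! ### Assembly -/

theorem exists_pos_forall_measure_lt {α : Type*} [MeasurableSpace α] {μ ν : Measure α}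
    [IsFiniteMeasure μ] [IsFiniteMeasure ν] (h : ν ≪ μ) {ε : ℝ≥0∞} (hε : ε ≠ 0) :
    ∃ δ > (0 : ℝ), ∀ s, μ s < ENNReal.ofReal δ → ν s < ε := by
  obtain ⟨δ, hδ, H⟩ := exists_pos_setLIntegral_lt_of_measure_lt (μ := μ) (f := ν.rnDeriv μ)
    (Measure.lintegral_rnDeriv_lt_top ν μ).ne hε
  obtain ⟨δ', hδ'0, hδ'⟩ := ENNReal.lt_iff_exists_nnreal_btwn.1 hδ
  refine ⟨δ', by exact_mod_cast hδ'0, fun s hs => ?_⟩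
  rw [ENNReal.ofReal_coe_nnreal] at hs
  have h1 := H (toMeasurable μ s) (by rw [measure_toMeasurable]; exact hs.trans hδ')
  rw [Measure.setLIntegral_rnDeriv h] at h1
  exact (measure_mono (subset_toMeasurable μ s)).trans_lt h1

theorem exists_lipschitz_pieces {d : ℕ} {β : Vec d → Vec d} {Dβ : Vec d → Vec d →L[ℝ] Vec d}
    {S : Set (Vec d)} (hβ : ∀ v ∈ S, HasFDerivWithinAt β (Dβ v) S v) (ν : Measure (Vec d))
    [IsFiniteMeasure ν] (hν : ν Sᶜ = 0) {ε : ℝ≥0∞} (hε : ε ≠ 0) :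
    ∃ (K : ℝ) (n : ℕ) (T : ℕ → Set (Vec d)), 0 ≤ K ∧
      (∀ i < n, ∀ x ∈ S ∩ T i, ∀ y ∈ S ∩ T i, ‖β x - β y‖ ≤ K * ‖x - y‖) ∧
      ν (⋃ i ∈ Finset.range n, S ∩ T i)ᶜ < ε := by
  obtain ⟨T, A, -, hTm, hST, hA, -⟩ :=
    exists_partition_approximatesLinearOn_of_hasFDerivWithinAt β S Dβ hβ (fun _ => 1)
      fun _ => one_ne_zero
  have hlim : Tendsto (fun n => ν (⋃ i ∈ Finset.range n, T i)ᶜ) atTop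
      (𝓝 (ν (⋂ n, (⋃ i ∈ Finset.range n, T i)ᶜ))) := by
    refine tendsto_measure_iInter_atTop
      (fun n => (Finset.measurableSet_biUnion _ fun i _ => hTm i).compl.nullMeasurableSet)
      (fun m n hmn => ?_) ⟨0, measure_ne_top _ _⟩
    exact compl_subset_compl.2 (biUnion_subset_biUnion_left (Finset.range_mono hmn))
  have hzero : ν (⋂ n, (⋃ i ∈ Finset.range n, T i)ᶜ) = 0 := by
    refine measure_mono_null (t := Sᶜ) (fun x hx hxS => ?_) hν
    obtain ⟨i, hi⟩ := mem_iUnion.1 (hST hxS)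
    exact mem_iInter.1 hx (i + 1) (mem_iUnion₂.2 ⟨i, Finset.mem_range.2 i.lt_succ_self, hi⟩)
  rw [hzero] at hlim
  obtain ⟨n, hn⟩ := (hlim.eventually_lt_const (pos_iff_ne_zero.2 hε)).exists
  refine ⟨∑ i ∈ Finset.range n, (‖A i‖ + 1), n, T,
    Finset.sum_nonneg fun i _ => by positivity, fun i hi x hx y hy => ?_, ?_⟩
  · have h1 := hA i x hx y hy
    have h2 : ‖β x - β y‖ ≤ (‖A i‖ + 1) * ‖x - y‖ := by
      have h3 := (A i).le_opNorm (x - y)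
      have h4 := norm_sub_norm_le (β x - β y) (A i (x - y))
      simp only [NNReal.coe_one, one_mul] at h1
      linarith
    refine h2.trans (mul_le_mul_of_nonneg_right ?_ (norm_nonneg _))
    exact Finset.single_le_sum (f := fun i => ‖A i‖ + 1) (fun _ _ => by positivity)
      (Finset.mem_range.2 hi)
  · refine lt_of_le_of_lt ?_ hn
    have hsub : (⋃ i ∈ Finset.range n, S ∩ T i)ᶜ ⊆ (⋃ i ∈ Finset.range n, T i)ᶜ ∪ Sᶜ := by
      rw [← inter_iUnion₂, compl_inter, union_comm]
    calc _ ≤ _ := measure_mono hsub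
      _ ≤ _ := measure_union_le _ _
      _ = _ := by rw [hν, add_zero]

theorem sphVol_compl_sph (d : ℕ) : sphVol d (sph d)ᶜ = 0 := by
  rw [sphVol, sph, Measure.map_apply measurable_subtype_coe isClosed_sphere.measurableSet.compl]
  refine measure_mono_null (t := ∅) (fun x hx => ?_) measure_empty
  exact hx x.2

theorem smallRadius_of_le {d : ℕ} {σ r₁ B K : ℝ} (hσ : 0 < σ) (hσ1 : σ ≤ 1) (hr₁ : 0 < r₁)
    (hB : 1 ≤ B) (hK : 0 ≤ K) (h : σ * (16 * B + 4 * K + 2048 * √(d : ℝ)) ≤ r₁) :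
    SmallRadius d (σ ^ 8) r₁ B K (σ ^ 2) := by
  have hsq := Real.sqrt_nonneg (d : ℝ)
  have hB0 : 0 ≤ B := by linarith
  have h1 : σ * (16 * B) ≤ r₁ := le_trans (by gcongr; linarith) h
  have h2 : σ * (4 * K) ≤ r₁ := le_trans (by gcongr; linarith) h
  have h3 : σ * (2048 * √(d : ℝ)) ≤ r₁ := le_trans (by gcongr; linarith) h
  refine ⟨by positivity, hB, hr₁, by positivity, pow_le_one₀ hσ.le hσ1, ?_, ?_, ?_⟩
  · calc σ ^ 8 * (16 * B) ≤ σ ^ 3 * (16 * B) := by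
          gcongr ?_ * _
          exact pow_le_pow_of_le_one hσ.le hσ1 (by norm_num)
      _ = σ * (16 * B) * σ ^ 2 := by ring
      _ ≤ r₁ * σ ^ 2 := by gcongr
  · refine le_trans ?_ h2
    gcongr ?_ * _
    exact pow_le_of_le_one hσ.le hσ1 (by norm_num)
  · calc σ ^ 8 * (2048 * √(d : ℝ)) ≤ σ ^ 5 * (2048 * √(d : ℝ)) := by
          gcongr ?_ * _
          exact pow_le_pow_of_le_one hσ.le hσ1 (by norm_num)
      _ = σ * (2048 * √(d : ℝ)) * (σ ^ 2) ^ 2 := by ring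
      _ ≤ r₁ * (σ ^ 2) ^ 2 := by gcongr

theorem exists_sphVol_hitsAll_le (r : ℕ) {M₀ : Matrix (Fin (r + 2)) (Fin (r + 2)) ℝ}
    (hM₀ : M₀.det = 1) (q₀ : Vec (r + 2)) {β : Vec (r + 2) → Vec (r + 2)}
    (hβL : q₀ ∈ lattice M₀ → ∀ v ∈ sph (r + 2), ∀ t > (0 : ℝ),
      β v + t • v ∉ ball (0 : Vec (r + 2)) 1)
    {t : ℝ} (ht : 0 < t) : ∃ C > (0 : ℝ), ∀ B K : ℝ, 1 ≤ B → 0 ≤ K → ∃ σ₁ > (0 : ℝ),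
      ∀ σ, 0 < σ → σ ≤ σ₁ → ∀ N : ℕ, 0 < N → ∀ Z ⊆ sph (r + 2), (∀ v ∈ Z, ‖β v‖ ≤ B) →
        (∀ x ∈ Z, ∀ y ∈ Z, ‖β x - β y‖ ≤ K * ‖x - y‖) →
        (∀ v ∈ Z, ∀ k < N, ∃ s > (0 : ℝ), (traj M₀ (σ ^ 8) (q₀ + σ ^ 8 • β v, v) k).1 +
          s • (traj M₀ (σ ^ 8) (q₀ + σ ^ 8 • β v, v) k).2 ∉ Kset M₀ (σ ^ 8)) →
        (∀ v ∈ Z, ∑ k ∈ Finset.range N, ‖seg M₀ (σ ^ 8) (q₀ + σ ^ 8 • β v, v) k‖ ≤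
          ((σ ^ 8) ^ (r + 1))⁻¹ * t) →
        sphVol (r + 2) Z ≤ ENNReal.ofReal (C * ((1 / 2) ^ N + N * σ)) := by
  obtain ⟨ra, hra, hLa⟩ := exists_lattice_separation hM₀
  obtain ⟨rb, hrb, hqb⟩ := exists_point_separation hra hLa q₀
  set r₁ := min (min ra rb) 1 with hr₁def
  have hr₁ : 0 < r₁ := lt_min (lt_min hra hrb) one_pos
  have hr₁' : r₁ ≤ 1 := min_le_right _ _
  have hL : ∀ x ∈ lattice M₀, ∀ y ∈ lattice M₀, x ≠ y → r₁ ≤ ‖x - y‖ := fun x hx y hy hxy =>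
    ((min_le_left _ _).trans (min_le_left _ _)).trans (hLa x hx y hy hxy)
  have hq : ∀ y ∈ lattice M₀, y ≠ q₀ → r₁ ≤ ‖y - q₀‖ := fun y hy hyq =>
    ((min_le_left _ _).trans (min_le_right _ _)).trans (hqb y hy hyq)
  obtain ⟨C, hC, σ₁, hσ₁, hmeas⟩ := exists_measure_short_le r hr₁ hr₁' (t := 2 * t) (by positivity)
  refine ⟨C, hC, fun B K hB hK => ?_⟩
  set G := 16 * B + 4 * K + 2048 * √((r + 2 : ℕ) : ℝ) with hG
  have hG0 : 0 < G := by positivity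
  refine ⟨min (min σ₁ 1) (r₁ / G), by positivity, ?_⟩
  intro σ hσ hσle N hN Z hZ hβB hβK hhit hshort
  have hsm : SmallRadius (r + 2) (σ ^ 8) r₁ B K (σ ^ 2) :=
    smallRadius_of_le hσ (hσle.trans ((min_le_left _ _).trans (min_le_right _ _))) hr₁ hB hK
      ((le_div_iff₀ hG0).1 (hσle.trans (min_le_right _ _)))
  have hmB : σ ^ 8 * (16 * B) ≤ r₁ := hsm.mul_B.trans (mul_le_of_le_one_right hr₁.le hsm.γ_le)
  have hρB : σ ^ 8 ≤ σ ^ 8 * B := le_mul_of_one_le_right hsm.pos.le hB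
  have hpath := fun v (hv : v ∈ Z) => isPath_of_hitsAll (B := B) (w₀ := β v) hsm.pos
    (by linarith [hsm.pos]) hB (by linarith [hsm.pos]) hL hq
    (mem_sphere_zero_iff_norm.1 (hZ hv)) (hβB v hv) (fun h => hβL h v (hZ hv)) (hhit v hv)
  refine hmeas σ hσ (hσle.trans ((min_le_left _ _).trans (min_le_left _ _))) B K N Z _ _ _ hN hZ
    ⟨fun v hv => (hpath v hv).1, fun _ _ => rfl, hβK⟩ hsm (lattice M₀) q₀ (countable_lattice M₀) hL
    (fun v hv => (hpath v hv).2.1) (fun _ _ => rfl) fun v hv => ?_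
  calc _ ≤ ∑ k ∈ Finset.range N, 2 * ‖seg M₀ (σ ^ 8) (q₀ + σ ^ 8 • β v, v) k‖ :=
        Finset.sum_le_sum fun k hk => by
          linarith [(hpath v hv).2.2 k (Finset.mem_range.1 hk)]
    _ ≤ _ := by
        rw [← Finset.mul_sum]
        linarith [hshort v hv]

/-- Lemma `diffLem` of Marklof–Strömbergsson: for any fixed macroscopic
time `t`, the probability that the trajectory undergoes at least `N` collisions within
microscopic time `ρ^{-(d-1)}t` can be made arbitrarily small, uniformly for all small `ρ`. -/
theorem statement12 (d : ℕ) (hd : 2 ≤ d) (M₀ : Matrix (Fin d) (Fin d) ℝ) (hM₀ : M₀.det = 1)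
    (q₀ : Vec d) (β : Vec d → Vec d)
    -- `β` is C¹ on the unit sphere
    (hβ : ∃ Dβ : Vec d → Vec d →L[ℝ] Vec d, ContinuousOn Dβ (sph d) ∧
      ∀ v ∈ sph d, HasFDerivWithinAt β (Dβ v) (sph d) v)
    (hβL : q₀ ∈ lattice M₀ → ∀ v ∈ sph d, ∀ t > (0:ℝ), β v + t • v ∉ ball (0 : Vec d) 1)
    (lam : Measure (Vec d)) (hlam : IsProbabilityMeasure lam) (hac : lam ≪ sphVol d) :
    ∀ t > (0:ℝ), ∀ ε > (0:ℝ), ∃ ρ₀ > (0:ℝ), ∃ N : ℕ, 0 < N ∧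
      ∀ ρ ∈ Set.Ioo 0 ρ₀,
        lam {v₀ | hitsAll M₀ ρ (q₀ + ρ • β v₀, v₀) N ∧
            ∑ k ∈ Finset.range N, ‖seg M₀ ρ (q₀ + ρ • β v₀, v₀) k‖ ≤ (ρ ^ (d - 1))⁻¹ * t} <
          ENNReal.ofReal ε := by
  obtain ⟨r, rfl⟩ : ∃ r, d = r + 2 := ⟨d - 2, by omega⟩
  obtain ⟨Dβ, -, hD⟩ := hβ
  intro t ht ε hε
  have hε2 : ENNReal.ofReal (ε / 2) ≠ 0 := (ENNReal.ofReal_pos.2 (by linarith)).ne'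
  obtain ⟨B, hB1, hB⟩ : ∃ B : ℝ, 1 ≤ B ∧ ∀ v ∈ sph (r + 2), ‖β v‖ ≤ B := by
    obtain ⟨B, hB⟩ := (isCompact_sphere (0 : Vec (r + 2)) 1).exists_bound_of_continuousOn
      fun v hv => (hD v hv).continuousWithinAt
    exact ⟨max B 1, le_max_right _ _, fun v hv => (hB v hv).trans (le_max_left _ _)⟩
  obtain ⟨K, n, T, hK, hKT, hrest⟩ := exists_lipschitz_pieces hD lam
    (hac (sphVol_compl_sph _)) hε2
  obtain ⟨δ, hδ, hlam_lt⟩ := exists_pos_forall_measure_lt hac hε2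
  obtain ⟨C, hC, hmain⟩ := exists_sphVol_hitsAll_le r hM₀ q₀ hβL ht
  obtain ⟨σ₁, hσ₁, hmain⟩ := hmain B K hB1 hK
  obtain ⟨N, hN0, hN⟩ : ∃ N : ℕ, 0 < N ∧ n * C * (1 / 2) ^ N < δ / 2 := by
    have hlim : Tendsto (fun N : ℕ => n * C * (1 / 2 : ℝ) ^ N) atTop (𝓝 (n * C * 0)) :=
      (tendsto_pow_atTop_nhds_zero_of_lt_one (by norm_num) (by norm_num)).const_mul _
    rw [mul_zero] at hlim
    exact ((eventually_gt_atTop 0).and (hlim.eventually_lt_const (by linarith))).exists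
  set σ₀ := min σ₁ (δ / (2 * (n * C * N + 1))) with hσ₀
  have hσ₀0 : 0 < σ₀ := by positivity
  refine ⟨σ₀ ^ 8, by positivity, N, hN0, ?_⟩
  rintro ρ ⟨hρ0, hρ⟩
  obtain ⟨σ, hσ, rfl⟩ : ∃ σ > (0 : ℝ), σ ^ 8 = ρ :=
    ⟨ρ ^ ((8 : ℕ) : ℝ)⁻¹, by positivity, Real.rpow_inv_natCast_pow hρ0.le (by norm_num)⟩
  have hσσ : σ < σ₀ := lt_of_pow_lt_pow_left₀ 8 hσ₀0.le hρ
  have hσN : n * C * N * σ ≤ δ / 2 := by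
    have h1 := hσσ.le.trans (min_le_right _ _)
    rw [le_div_iff₀ (by positivity)] at h1
    nlinarith
  set E := {v₀ : Vec (r + 2) | hitsAll M₀ (σ ^ 8) (q₀ + σ ^ 8 • β v₀, v₀) N ∧
    ∑ k ∈ Finset.range N, ‖seg M₀ (σ ^ 8) (q₀ + σ ^ 8 • β v₀, v₀) k‖ ≤
      ((σ ^ 8) ^ (r + 2 - 1))⁻¹ * t} with hE
  have hpiece : ∀ i < n, sphVol (r + 2) (E ∩ (sph (r + 2) ∩ T i)) ≤
      ENNReal.ofReal (C * ((1 / 2) ^ N + N * σ)) := fun i hi =>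
    hmain σ hσ (hσσ.le.trans (min_le_left _ _)) N hN0 _ (fun v hv => hv.2.1)
      (fun v hv => hB v hv.2.1) (fun x hx y hy => hKT i hi x hx.2 y hy.2)
      (fun v hv k hk => collides_real (hv.1.1 k hk)) (fun v hv => hv.1.2)
  have hunion : sphVol (r + 2) (⋃ i ∈ Finset.range n, E ∩ (sph (r + 2) ∩ T i)) <
      ENNReal.ofReal δ := by
    refine ((measure_biUnion_finset_le _ _).trans (Finset.sum_le_sum fun i hi =>
      hpiece i (Finset.mem_range.1 hi))).trans_lt ?_
    rw [Finset.sum_const, Finset.card_range, ← ENNReal.ofReal_nsmul, nsmul_eq_mul]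
    refine (ENNReal.ofReal_lt_ofReal_iff hδ).2 ?_
    calc _ = n * C * (1 / 2) ^ N + n * C * N * σ := by ring
      _ < δ := by linarith
  have hsub : E ⊆ (⋃ i ∈ Finset.range n, E ∩ (sph (r + 2) ∩ T i)) ∪
      (⋃ i ∈ Finset.range n, sph (r + 2) ∩ T i)ᶜ := by
    rw [← inter_iUnion₂]
    intro x hx
    by_cases h : x ∈ ⋃ i ∈ Finset.range n, sph (r + 2) ∩ T i
    · exact Or.inl ⟨hx, h⟩
    · exact Or.inr h
  calc lam E ≤ _ := measure_mono hsub
    _ ≤ _ := measure_union_le _ _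
    _ < ENNReal.ofReal (ε / 2) + ENNReal.ofReal (ε / 2) :=
        ENNReal.add_lt_add (hlam_lt _ hunion) hrest
    _ = ENNReal.ofReal ε := by
        rw [← ENNReal.ofReal_add (by linarith) (by linarith), add_halves]
end
end
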